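/- (Theorem 3.1) Assume (H0)-(H5). If (\bar v^{ij})_{(i,j)\in\Gamma^1\times\Gamma^2} is a continuous viscosity solution of polynomial growth of the min-max system min{ v^{ij}-L^{ij}(\vec v) ; max{ v^{ij}-U^{ij}(\vec v) ; -\partial_t v^{ij}-\mathcal{L}^X v^{ij}-f^{ij}(t,x,\vec v,\sigma^\top D_x v^{ij}) } } = 0, v^{ij}(T,\cdot)=h^{ij}, and (\underline v^{ij}) is a continuous viscosity solution of polynomial growth of the max-min system max{ v^{ij}-U^{ij}(\vec v) ; min{ v^{ij}-L^{ij}(\vec v) ; -\partial_t v^{ij}-\mathcal{L}^X v^{ij}-f^{ij}(t,x,\vec v,\sigma^\top D_x v^{ij}) } } = 0, v^{ij}(T,\cdot)=h^{ij}, then \bar v^{ij}=\underline v^{ij} for every (i,j)\in\Gamma^1\times\Gamma^2. -/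

import Mathlib

open Set Matrix

noncomputable section

abbrev Euc (k : ℕ) : Type := EuclideanSpace ℝ (Fin k)

/-- Partial derivative in the `i`-th coordinate direction. -/
noncomputable def pd {k : ℕ} (i : Fin k) (ψ : Euc k → ℝ) (x : Euc k) : ℝ :=
  fderiv ℝ ψ x (EuclideanSpace.single i 1)

/-- Time derivative of `φ(t,x)` in `t`. -/
noncomputable def timeDeriv {k : ℕ} (φ : ℝ → Euc k → ℝ) (t : ℝ) (x : Euc k) : ℝ :=
  deriv (fun s => φ s x) t

/-- The second order generator
`𝓛^X φ(t,x) = ½ Tr[σσᵀ(t,x) D²_{xx} φ(t,x)] + b(t,x)ᵀ D_x φ(t,x)`. -/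
noncomputable def genL {k d : ℕ} (b : ℝ → Euc k → Fin k → ℝ)
    (σm : ℝ → Euc k → Matrix (Fin k) (Fin d) ℝ) (φ : ℝ → Euc k → ℝ)
    (t : ℝ) (x : Euc k) : ℝ :=
  (1 / 2) * ∑ i, ∑ j, (σm t x * (σm t x)ᵀ) i j * pd i (fun y => pd j (φ t) y) x
    + ∑ i, b t x i * pd i (φ t) x

/-- `σ(t,x)ᵀ D_x φ(t,x)` as a vector of `ℝ^d`. -/
noncomputable def sigGrad {k d : ℕ} (σm : ℝ → Euc k → Matrix (Fin k) (Fin d) ℝ)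
    (φ : ℝ → Euc k → ℝ) (t : ℝ) (x : Euc k) : Fin d → ℝ :=
  fun l => ∑ i, σm t x i l * pd i (φ t) x

/-- `φ` is of class `C^{1,2}`: once differentiable in `t`, twice in `x`,
with (jointly) continuous derivatives. -/
def IsC12 {k : ℕ} (φ : ℝ → Euc k → ℝ) : Prop :=
  (∀ x, Differentiable ℝ fun s => φ s x) ∧
  Continuous (fun p : ℝ × Euc k => deriv (fun s => φ s p.2) p.1) ∧
  (∀ t, ContDiff ℝ 2 (φ t)) ∧
  Continuous (fun p : ℝ × Euc k => fderiv ℝ (φ p.1) p.2) ∧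
  Continuous (fun p : ℝ × Euc k => fderiv ℝ (fderiv ℝ (φ p.1)) p.2)

/-- Polynomial growth on `[0,T] × ℝ^k`. -/
def PolyGrowth {k : ℕ} (T : ℝ) (Φ : ℝ → Euc k → ℝ) : Prop :=
  ∃ C γ : ℝ, 0 ≤ C ∧ 0 ≤ γ ∧ ∀ t ∈ Icc (0 : ℝ) T, ∀ x : Euc k, |Φ t x| ≤ C * (1 + ‖x‖ ^ γ)

/-- (H0): `b` and `σ` are jointly continuous and Lipschitz in `x` uniformly in `t`. -/
def H0 {k d : ℕ} (T : ℝ) (b : ℝ → Euc k → Fin k → ℝ)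
    (σm : ℝ → Euc k → Matrix (Fin k) (Fin d) ℝ) : Prop :=
  Continuous (fun p : ℝ × Euc k => b p.1 p.2) ∧
  Continuous (fun p : ℝ × Euc k => σm p.1 p.2) ∧
  ∃ C : ℝ, ∀ t ∈ Icc (0 : ℝ) T, ∀ x x' : Euc k,
    (∀ i, |b t x i - b t x' i| ≤ C * ‖x - x'‖) ∧
    (∀ i l, |σm t x i l - σm t x' i l| ≤ C * ‖x - x'‖)


/-- The lower inter-connected obstacle
`L^{ij}(\vec v)(t,x) = max_{kk ∈ Γ¹, kk ≠ i} ( v^{kk j}(t,x) - \underline g_{i kk}(t,x) )`,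
evaluated on the vector `vv = (v^{kl}(t,x))_{(k,l)}` of current values. -/
noncomputable def lowerObst {k : ℕ} {Γ1 Γ2 : Type} [Fintype Γ1] [DecidableEq Γ1]
    [Nontrivial Γ1] (gLow : Γ1 → Γ1 → ℝ → Euc k → ℝ) (i : Γ1) (j : Γ2)
    (t : ℝ) (x : Euc k) (vv : Γ1 × Γ2 → ℝ) : ℝ :=
  Finset.sup' (Finset.univ.erase i)
    (by
      obtain ⟨kk, hkk⟩ := exists_ne i
      exact ⟨kk, Finset.mem_erase.mpr ⟨hkk, Finset.mem_univ kk⟩⟩)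
    (fun kk => vv (kk, j) - gLow i kk t x)

/-- The upper inter-connected obstacle
`U^{ij}(\vec v)(t,x) = min_{l ∈ Γ², l ≠ j} ( v^{il}(t,x) + \bar g_{jl}(t,x) )`. -/
noncomputable def upperObst {k : ℕ} {Γ1 Γ2 : Type} [Fintype Γ2] [DecidableEq Γ2]
    [Nontrivial Γ2] (gUp : Γ2 → Γ2 → ℝ → Euc k → ℝ) (i : Γ1) (j : Γ2)
    (t : ℝ) (x : Euc k) (vv : Γ1 × Γ2 → ℝ) : ℝ :=
  Finset.inf' (Finset.univ.erase j)
    (by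
      obtain ⟨l, hl⟩ := exists_ne j
      exact ⟨l, Finset.mem_erase.mpr ⟨hl, Finset.mem_univ l⟩⟩)
    (fun l => vv (i, l) + gUp j l t x)

/-- Viscosity subsolution of the system of terminal value problems
`F^{ij}(t, x, (v^{kl})_{kl}, ∂_t v^{ij}, 𝓛^X v^{ij}, σᵀ D_x v^{ij}) = 0` on `(0,T) × ℝ^k`
with terminal data `v^{ij}(T,·) = h^{ij}`, in the sense of `C^{1,2}` test functions. -/
def IsViscSubsolSys {k d : ℕ} {Γ : Type} (T : ℝ) (b : ℝ → Euc k → Fin k → ℝ)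
    (σm : ℝ → Euc k → Matrix (Fin k) (Fin d) ℝ) (hterm : Γ → Euc k → ℝ)
    (F : Γ → ℝ → Euc k → (Γ → ℝ) → ℝ → ℝ → (Fin d → ℝ) → ℝ)
    (v : Γ → ℝ → Euc k → ℝ) : Prop :=
  (∀ ij x, v ij T x ≤ hterm ij x) ∧
  ∀ (ij : Γ) (t : ℝ) (x : Euc k), t ∈ Ioo (0 : ℝ) T →
    ∀ φ : ℝ → Euc k → ℝ, IsC12 φ →
      IsLocalMax (fun p : ℝ × Euc k => v ij p.1 p.2 - φ p.1 p.2) (t, x) →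
      v ij t x = φ t x →
      F ij t x (fun kl => v kl t x) (timeDeriv φ t x) (genL b σm φ t x)
        (sigGrad σm φ t x) ≤ 0

/-- Viscosity supersolution of the system. -/
def IsViscSupersolSys {k d : ℕ} {Γ : Type} (T : ℝ) (b : ℝ → Euc k → Fin k → ℝ)
    (σm : ℝ → Euc k → Matrix (Fin k) (Fin d) ℝ) (hterm : Γ → Euc k → ℝ)
    (F : Γ → ℝ → Euc k → (Γ → ℝ) → ℝ → ℝ → (Fin d → ℝ) → ℝ)
    (v : Γ → ℝ → Euc k → ℝ) : Prop :=
  (∀ ij x, hterm ij x ≤ v ij T x) ∧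
  ∀ (ij : Γ) (t : ℝ) (x : Euc k), t ∈ Ioo (0 : ℝ) T →
    ∀ φ : ℝ → Euc k → ℝ, IsC12 φ →
      IsLocalMin (fun p : ℝ × Euc k => v ij p.1 p.2 - φ p.1 p.2) (t, x) →
      v ij t x = φ t x →
      0 ≤ F ij t x (fun kl => v kl t x) (timeDeriv φ t x) (genL b σm φ t x)
        (sigGrad σm φ t x)

/-- Viscosity solution of the system: both a subsolution and a supersolution. -/
def IsViscSolSys {k d : ℕ} {Γ : Type} (T : ℝ) (b : ℝ → Euc k → Fin k → ℝ)
    (σm : ℝ → Euc k → Matrix (Fin k) (Fin d) ℝ) (hterm : Γ → Euc k → ℝ)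
    (F : Γ → ℝ → Euc k → (Γ → ℝ) → ℝ → ℝ → (Fin d → ℝ) → ℝ)
    (v : Γ → ℝ → Euc k → ℝ) : Prop :=
  IsViscSubsolSys T b σm hterm F v ∧ IsViscSupersolSys T b σm hterm F v

/-- The min-max expression of system (1.1):
`min{ v^{ij} - L^{ij}(\vec v) ; max{ v^{ij} - U^{ij}(\vec v) ;
  -∂_t v^{ij} - 𝓛^X v^{ij} - f^{ij}(t,x,\vec v, σᵀ D_x v^{ij}) } }`. -/
noncomputable def FminMax {k d : ℕ} {Γ1 Γ2 : Type} [Fintype Γ1] [Fintype Γ2]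
    [DecidableEq Γ1] [DecidableEq Γ2] [Nontrivial Γ1] [Nontrivial Γ2]
    (f : Γ1 → Γ2 → ℝ → Euc k → ((Γ1 × Γ2) → ℝ) → (Fin d → ℝ) → ℝ)
    (gLow : Γ1 → Γ1 → ℝ → Euc k → ℝ) (gUp : Γ2 → Γ2 → ℝ → Euc k → ℝ) :
    Γ1 × Γ2 → ℝ → Euc k → ((Γ1 × Γ2) → ℝ) → ℝ → ℝ → (Fin d → ℝ) → ℝ :=
  fun ij t x vv dtφ Lφ zφ =>
    min (vv ij - lowerObst gLow ij.1 ij.2 t x vv)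
      (max (vv ij - upperObst gUp ij.1 ij.2 t x vv)
        (-dtφ - Lφ - f ij.1 ij.2 t x vv zφ))

/-- The max-min expression of system (1.2):
`max{ v^{ij} - U^{ij}(\vec v) ; min{ v^{ij} - L^{ij}(\vec v) ;
  -∂_t v^{ij} - 𝓛^X v^{ij} - f^{ij}(t,x,\vec v, σᵀ D_x v^{ij}) } }`. -/
noncomputable def FmaxMin {k d : ℕ} {Γ1 Γ2 : Type} [Fintype Γ1] [Fintype Γ2]
    [DecidableEq Γ1] [DecidableEq Γ2] [Nontrivial Γ1] [Nontrivial Γ2]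
    (f : Γ1 → Γ2 → ℝ → Euc k → ((Γ1 × Γ2) → ℝ) → (Fin d → ℝ) → ℝ)
    (gLow : Γ1 → Γ1 → ℝ → Euc k → ℝ) (gUp : Γ2 → Γ2 → ℝ → Euc k → ℝ) :
    Γ1 × Γ2 → ℝ → Euc k → ((Γ1 × Γ2) → ℝ) → ℝ → ℝ → (Fin d → ℝ) → ℝ :=
  fun ij t x vv dtφ Lφ zφ =>
    max (vv ij - upperObst gUp ij.1 ij.2 t x vv)
      (min (vv ij - lowerObst gLow ij.1 ij.2 t x vv)
        (-dtφ - Lφ - f ij.1 ij.2 t x vv zφ))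

/-- (H4), the non-free-loop property: for every loop in `Γ¹ × Γ²` (a sequence of
pairs `p 0, p 1, …, p M` with `p M = p 0`, the first `M` pairs pairwise distinct,
`M ≥ 2`, and each step leaving at least one coordinate unchanged), the sum
`∑_q φ_{i_q j_q}(t,x)` does not vanish, where
`φ_{i_q j_q} = -\underline g_{i_q i_{q+1}} 1_{i_q ≠ i_{q+1}} + \bar g_{j_q j_{q+1}} 1_{j_q ≠ j_{q+1}}`. -/
def NoFreeLoop {k : ℕ} {Γ1 Γ2 : Type} [DecidableEq Γ1] [DecidableEq Γ2]
    (T : ℝ) (gLow : Γ1 → Γ1 → ℝ → Euc k → ℝ) (gUp : Γ2 → Γ2 → ℝ → Euc k → ℝ) : Prop :=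
  ∀ M : ℕ, 2 ≤ M → ∀ p : ℕ → Γ1 × Γ2,
    p M = p 0 →
    (∀ q q', q < M → q' < M → p q = p q' → q = q') →
    (∀ q < M, (p q).1 = (p (q + 1)).1 ∨ (p q).2 = (p (q + 1)).2) →
    ∀ t ∈ Icc (0 : ℝ) T, ∀ x : Euc k,
      (∑ q ∈ Finset.range M,
        ((if (p q).1 = (p (q + 1)).1 then 0 else -gLow (p q).1 (p (q + 1)).1 t x) +
          (if (p q).2 = (p (q + 1)).2 then 0 else gUp (p q).2 (p (q + 1)).2 t x))) ≠ 0

section SupConvolution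

variable {E : Type*} [NormedAddCommGroup E]

/-- The sup-convolution with parameter `ε` of the restriction of `u` to `K`. -/
def supConv (K : Set E) (u : E → ℝ) (ε : ℝ) (x : E) : ℝ :=
  sSup ((fun y => u y - ‖x - y‖ ^ 2 / (2 * ε)) '' K)

variable {K : Set E} {u : E → ℝ}

theorem bddAbove_supConv (hK : IsCompact K) (hu : Continuous u) (ε : ℝ) (x : E) :
    BddAbove ((fun y => u y - ‖x - y‖ ^ 2 / (2 * ε)) '' K) :=
  (hK.image (by fun_prop)).bddAbove

theorem le_supConv (hK : IsCompact K) (hu : Continuous u) (ε : ℝ) (x : E) {y : E} (hy : y ∈ K) :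
    u y - ‖x - y‖ ^ 2 / (2 * ε) ≤ supConv K u ε x :=
  le_csSup (bddAbove_supConv hK hu ε x) ⟨y, hy, rfl⟩

theorem exists_supConv_eq (hK : IsCompact K) (hne : K.Nonempty) (hu : Continuous u) (ε : ℝ)
    (x : E) : ∃ y ∈ K, supConv K u ε x = u y - ‖x - y‖ ^ 2 / (2 * ε) :=
  hK.exists_sSup_image_eq hne (by fun_prop)

theorem continuous_supConv (hK : IsCompact K) (hu : Continuous u) (ε : ℝ) :
    Continuous (supConv K u ε) :=
  hK.continuous_sSup (f := fun x y => u y - ‖x - y‖ ^ 2 / (2 * ε)) (by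
    simp only [Function.HasUncurry.uncurry, id]; fun_prop)

variable [InnerProductSpace ℝ E]

theorem norm_add_sq_le_quadratic_interp {ε δ : ℝ} (hε : 0 < ε) (hδ : 0 < δ) (a b : E) :
    ‖a + b‖ ^ 2 / (2 * (ε + δ)) ≤ ‖a‖ ^ 2 / (2 * ε) + ‖b‖ ^ 2 / (2 * δ) := by
  have key : ‖δ • a - ε • b‖ ^ 2 = δ ^ 2 * ‖a‖ ^ 2 - 2 * (δ * ε) * inner ℝ a b + ε ^ 2 * ‖b‖ ^ 2 := by
    rw [norm_sub_sq_real, norm_smul, norm_smul, inner_smul_left, inner_smul_right, mul_pow, mul_pow]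
    simp; ring
  have h0 := sq_nonneg ‖δ • a - ε • b‖
  rw [key] at h0
  rw [norm_add_sq_real, div_add_div _ _ (by positivity) (by positivity),
    div_le_div_iff₀ (by positivity) (by positivity)]
  nlinarith

theorem supConv_sub_le_supConv (hK : IsCompact K) (hne : K.Nonempty) (hu : Continuous u)
    {ε δ : ℝ} (hε : 0 < ε) (hδ : 0 < δ) (x y : E) :
    supConv K u ε x - ‖x - y‖ ^ 2 / (2 * δ) ≤ supConv K u (ε + δ) y := by
  obtain ⟨k, hk, he⟩ := exists_supConv_eq hK hne hu ε x
  have h1 := le_supConv hK hu (ε + δ) y hk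
  have h2 := norm_add_sq_le_quadratic_interp hε hδ (x - k) (y - x)
  rw [show x - k + (y - x) = y - k by abel, norm_sub_rev y x] at h2
  linarith

theorem supConv_le_of_le_paraboloid (hK : IsCompact K) (hne : K.Nonempty) (hu : Continuous u)
    {ε δ : ℝ} (hε : 0 < ε) (hδ : 0 < δ) {a : ℝ} {c : E}
    (h : ∀ x, supConv K u ε x ≤ a + ‖x - c‖ ^ 2 / (2 * δ)) : supConv K u (ε + δ) c ≤ a := by
  obtain ⟨k, hk, he⟩ := exists_supConv_eq hK hne hu (ε + δ) c
  have hs : ε + δ ≠ 0 := by positivity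
  set x := k + (ε / (ε + δ)) • (c - k) with hx
  have h1 := le_supConv hK hu ε x hk
  have h2 := h x
  have e1 : x - k = (ε / (ε + δ)) • (c - k) := by rw [hx]; abel
  have e2 : x - c = -((δ / (ε + δ)) • (c - k)) := by
    have : (δ / (ε + δ)) = 1 - ε / (ε + δ) := by field_simp; ring
    rw [hx, this, sub_smul, one_smul]; abel
  rw [e2, norm_neg, norm_smul, Real.norm_of_nonneg (by positivity)] at h2
  rw [e1, norm_smul, Real.norm_of_nonneg (by positivity)] at h1
  have h3 : (ε / (ε + δ) * ‖c - k‖) ^ 2 / (2 * ε) + (δ / (ε + δ) * ‖c - k‖) ^ 2 / (2 * δ)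
      = ‖c - k‖ ^ 2 / (2 * (ε + δ)) := by
    field_simp
  linarith

theorem supConv_midpoint_le (hK : IsCompact K) (hne : K.Nonempty) (hu : Continuous u)
    {ε : ℝ} (hε : 0 < ε) (y z : E) :
    supConv K u ε ((1 / 2 : ℝ) • (y + z)) ≤
      (supConv K u ε y + supConv K u ε z) / 2 + ‖y - z‖ ^ 2 / (8 * ε) := by
  obtain ⟨k, hk, he⟩ := exists_supConv_eq hK hne hu ε ((1 / 2 : ℝ) • (y + z))
  have h1 := le_supConv hK hu ε y hk
  have h2 := le_supConv hK hu ε z hk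
  have e1 : ((1 / 2 : ℝ) • (y + z)) - k = (1 / 2 : ℝ) • ((y - k) + (z - k)) := by
    module
  have e2 : y - z = (y - k) - (z - k) := by abel
  rw [he, e1, e2]
  rw [norm_smul, norm_sub_sq_real, mul_pow, norm_add_sq_real]
  have : ‖(1 / 2 : ℝ)‖ = 1 / 2 := by norm_num
  rw [this]
  have h3 : (1 / 2 : ℝ) ^ 2 * (‖y - k‖ ^ 2 + 2 * inner ℝ (y - k) (z - k) + ‖z - k‖ ^ 2) / (2 * ε)
      + (‖y - k‖ ^ 2 - 2 * inner ℝ (y - k) (z - k) + ‖z - k‖ ^ 2) / (8 * ε)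
      = (‖y - k‖ ^ 2 / (2 * ε) + ‖z - k‖ ^ 2 / (2 * ε)) / 2 := by
    field_simp; ring
  linarith

theorem exists_forall_le_of_quadratic_decay {G : Type*} [NormedAddCommGroup G] [ProperSpace G]
    {F : G → ℝ} (hF : Continuous F) {A B c : ℝ} (hc : 0 < c)
    (h : ∀ x, F x ≤ A + B * ‖x‖ - c * ‖x‖ ^ 2) : ∃ x, ∀ y, F y ≤ F x := by
  refine hF.exists_forall_ge' 0 ?_
  have h1 : Filter.Tendsto (fun r : ℝ => r * (c * r - B) - A) Filter.atTop Filter.atTop := by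
    refine Filter.tendsto_atTop_add_const_right _ _ (Filter.tendsto_id.atTop_mul_atTop₀ ?_)
    exact Filter.tendsto_atTop_add_const_right _ _ (Filter.tendsto_id.const_mul_atTop hc)
  have h2 := (h1.comp (tendsto_norm_cocompact_atTop (E := G))).eventually_ge_atTop (-F 0)
  filter_upwards [h2] with x hx
  have := h x
  simp only [Function.comp] at hx
  nlinarith

variable [FiniteDimensional ℝ E]

/-- The function `g` is the infimum of the paraboloids of opening `1 / δ` lying above the
sup-convolution; it is of class `C^{1,1}`. -/
theorem exists_paraboloid_hull (hK : IsCompact K) (hne : K.Nonempty) (hu : Continuous u)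
    {ε δ : ℝ} (hε : 0 < ε) (hδ : 0 < δ) :
    ∃ (g : E → ℝ) (Dg : E → E) (C : ℝ), 0 ≤ C ∧ (∀ x, supConv K u ε x ≤ g x) ∧
      (∀ x h, |g (x + h) - g x - inner ℝ (Dg x) h| ≤ C * ‖h‖ ^ 2) ∧
      (∀ c a, (∀ x, supConv K u ε x ≤ a + ‖x - c‖ ^ 2 / (2 * δ)) →
        ∀ x, g x ≤ a + ‖x - c‖ ^ 2 / (2 * δ)) := by
  set V := supConv K u (ε + δ) with hV
  have hVc : Continuous V := continuous_supConv hK hu _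
  have hmin : ∀ x, ∃ y, ∀ y', V y + ‖x - y‖ ^ 2 / (2 * δ) ≤ V y' + ‖x - y'‖ ^ 2 / (2 * δ) := by
    intro x
    obtain ⟨k, hk⟩ := hne
    have hF : Continuous fun y => -(V y + ‖x - y‖ ^ 2 / (2 * δ)) := by fun_prop
    obtain ⟨y, hy⟩ := exists_forall_le_of_quadratic_decay hF (c := 1 / (2 * δ) - 1 / (2 * (ε + δ)))
      (A := - u k + ‖k‖ ^ 2 / (2 * (ε + δ)))
      (B := 2 * ‖k‖ / (2 * (ε + δ)) + 2 * ‖x‖ / (2 * δ)) (by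
        rw [sub_pos]; apply one_div_lt_one_div_of_lt <;> linarith) (by
        intro y
        have h1 : u k - ‖y - k‖ ^ 2 / (2 * (ε + δ)) ≤ V y := le_supConv hK hu _ y hk
        have h2 : ‖y - k‖ ^ 2 / (2 * (ε + δ)) ≤ (‖y‖ + ‖k‖) ^ 2 / (2 * (ε + δ)) := by
          gcongr; exact norm_sub_le _ _
        have h3 : (‖y‖ ^ 2 - 2 * ‖x‖ * ‖y‖) / (2 * δ) ≤ ‖x - y‖ ^ 2 / (2 * δ) := by
          gcongr
          rw [norm_sub_sq_real]
          nlinarith [real_inner_le_norm x y, sq_nonneg ‖x‖]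
        have e2 : (‖y‖ + ‖k‖) ^ 2 / (2 * (ε + δ)) = ‖y‖ ^ 2 * (1 / (2 * (ε + δ)))
          + 2 * ‖k‖ / (2 * (ε + δ)) * ‖y‖ + ‖k‖ ^ 2 / (2 * (ε + δ)) := by field_simp; ring
        have e3 : (‖y‖ ^ 2 - 2 * ‖x‖ * ‖y‖) / (2 * δ) = ‖y‖ ^ 2 * (1 / (2 * δ)) -
          2 * ‖x‖ / (2 * δ) * ‖y‖ := by field_simp
        rw [e2] at h2
        rw [e3] at h3
        linarith)
    exact ⟨y, fun y' => by linarith [hy y']⟩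
  choose Y hY using hmin
  set g : E → ℝ := fun x => V (Y x) + ‖x - Y x‖ ^ 2 / (2 * δ) with hg
  have hup : ∀ x h, g (x + h) ≤ g x + inner ℝ ((1 / δ) • (x - Y x)) h + 1 / (2 * δ) * ‖h‖ ^ 2 := by
    intro x h
    have := hY (x + h) (Y x)
    rw [show x + h - Y x = (x - Y x) + h by abel, norm_add_sq_real (x - Y x) h] at this
    simp only [hg]
    rw [inner_smul_left]
    simp only [conj_trivial]
    refine this.trans (le_of_eq ?_)
    field_simp
    ring
  have hmid : ∀ x h, 2 * g x ≤ g (x + h) + g (x - h) + 1 / ε * ‖h‖ ^ 2 := by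
    intro x h
    set a := Y (x + h)
    set b := Y (x - h)
    have h1 := hY x ((1 / 2 : ℝ) • (a + b))
    have h2 := supConv_midpoint_le hK hne hu (add_pos hε hδ) a b
    have e1 : x - (1 / 2 : ℝ) • (a + b) = (1 / 2 : ℝ) • ((x + h - a) + (x - h - b)) := by module
    have e2 : (2 : ℝ) • h = (a - b) + ((x + h - a) - (x - h - b)) := by module
    have h4 : ‖a - b‖ ^ 2 / (2 * (ε + δ)) ≤
        ‖(2 : ℝ) • h‖ ^ 2 / (2 * ε) + ‖(x + h - a) - (x - h - b)‖ ^ 2 / (2 * δ) := by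
      have := norm_add_sq_le_quadratic_interp hε hδ ((2 : ℝ) • h) (-((x + h - a) - (x - h - b)))
      rw [norm_neg] at this
      rwa [show (2 : ℝ) • h + -((x + h - a) - (x - h - b)) = a - b by rw [e2]; abel] at this
    rw [e1, norm_smul, mul_pow] at h1
    have hh : ‖(1 / 2 : ℝ)‖ = 1 / 2 := by norm_num
    rw [hh] at h1
    have h5 : ‖(x + h - a) + (x - h - b)‖ ^ 2 + ‖(x + h - a) - (x - h - b)‖ ^ 2 =
        2 * ‖x + h - a‖ ^ 2 + 2 * ‖x - h - b‖ ^ 2 := by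
      have := parallelogram_law_with_norm ℝ (x + h - a) (x - h - b)
      nlinarith
    rw [norm_smul, mul_pow, Real.norm_ofNat] at h4
    have e5 : (1 / 2 : ℝ) ^ 2 * ‖(x + h - a) + (x - h - b)‖ ^ 2 / (2 * δ) =
        (‖x + h - a‖ ^ 2 / (2 * δ) + ‖x - h - b‖ ^ 2 / (2 * δ)) / 2
        - ‖(x + h - a) - (x - h - b)‖ ^ 2 / (2 * δ) / 4 := by
      rw [show ‖(x + h - a) + (x - h - b)‖ ^ 2 =
        2 * ‖x + h - a‖ ^ 2 + 2 * ‖x - h - b‖ ^ 2 - ‖(x + h - a) - (x - h - b)‖ ^ 2 by linarith]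
      field_simp; ring
    have e6 : ‖a - b‖ ^ 2 / (8 * (ε + δ)) = ‖a - b‖ ^ 2 / (2 * (ε + δ)) / 4 := by
      field_simp; ring
    have e7 : (2 : ℝ) ^ 2 * ‖h‖ ^ 2 / (2 * ε) / 2 = 1 / ε * ‖h‖ ^ 2 := by
      field_simp
    simp only [hg]
    rw [e5] at h1
    rw [e6] at h2
    linarith
  refine ⟨g, fun x => (1 / δ) • (x - Y x), 1 / (2 * δ) + 1 / ε, by positivity, ?_, ?_, ?_⟩
  · intro x
    have := supConv_sub_le_supConv hK hne hu hε hδ x (Y x)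
    simp only [hg]
    linarith
  · intro x h
    have h1 := hup x h
    have h2 := hup x (-h)
    have h3 := hmid x h
    rw [inner_neg_right, norm_neg, ← sub_eq_add_neg] at h2
    have h4 : 0 ≤ 1 / ε * ‖h‖ ^ 2 := by positivity
    rw [abs_le]
    constructor <;> nlinarith
  · intro c a h x
    have h1 := supConv_le_of_le_paraboloid hK hne hu hε hδ h
    have h2 := hY x c
    simp only [hg]
    linarith

end SupConvolution

section TheoremOnSums

open Filter Topology

variable {E : Type*} [NormedAddCommGroup E] [InnerProductSpace ℝ E]

theorem norm_gradient_sub_le_of_quadratic_error {g : E → ℝ} {Dg : E → E} {C : ℝ}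
    (h : ∀ x h, |g (x + h) - g x - inner ℝ (Dg x) h| ≤ C * ‖h‖ ^ 2) (x y : E) :
    ‖Dg x - Dg y‖ ≤ 6 * C * ‖x - y‖ := by
  by_cases hD : ‖Dg x - Dg y‖ = 0
  · rw [hD]
    have h1 := (abs_nonneg _).trans (h x (x - y))
    by_cases hk : ‖x - y‖ = 0
    · simp [hk]
    · have : 0 < ‖x - y‖ := lt_of_le_of_ne (norm_nonneg _) (Ne.symm hk)
      have hC : 0 ≤ C := nonneg_of_mul_nonneg_left h1 (by positivity)
      positivity
  by_cases hk : ‖x - y‖ = 0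
  · rw [norm_eq_zero, sub_eq_zero] at hk
    simp [hk] at hD
  have hkp : 0 < ‖x - y‖ := lt_of_le_of_ne (norm_nonneg _) (Ne.symm hk)
  have hDp : 0 < ‖Dg x - Dg y‖ := lt_of_le_of_ne (norm_nonneg _) (Ne.symm hD)
  set k := y - x with hkdef
  have hkn : ‖x - y‖ = ‖k‖ := by rw [hkdef, norm_sub_rev]
  set e := (‖k‖ / ‖Dg x - Dg y‖) • (Dg x - Dg y) with he
  have hen : ‖e‖ = ‖k‖ := by
    rw [he, norm_smul, Real.norm_of_nonneg (by positivity)]; field_simp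
  have h1 := abs_le.1 (h x k)
  have h2 := abs_le.1 (h x (k + e))
  have h3 := abs_le.1 (h y e)
  have e1 : x + k = y := by rw [hkdef]; abel
  rw [e1] at h1
  rw [← add_assoc, e1, inner_add_right] at h2
  have h4 : inner ℝ (Dg x) e - inner ℝ (Dg y) e = ‖k‖ * ‖Dg x - Dg y‖ := by
    rw [← inner_sub_left, he, inner_smul_right, real_inner_self_eq_norm_sq]; field_simp
  have h5 : ‖k + e‖ ^ 2 ≤ 4 * ‖k‖ ^ 2 := by
    have := norm_add_le k e
    rw [hen] at this
    nlinarith [norm_nonneg (k + e)]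
  have hC : 0 ≤ C := by
    have := (abs_nonneg _).trans (h x k)
    exact nonneg_of_mul_nonneg_left this (by rw [← hkn]; positivity)
  rw [hen] at h3
  rw [hkn] at hkp ⊢
  have h6 : C * ‖k + e‖ ^ 2 ≤ C * (4 * ‖k‖ ^ 2) := by gcongr
  have h7 : ‖k‖ * ‖Dg x - Dg y‖ ≤ ‖k‖ * (6 * C * ‖k‖) := by nlinarith
  exact le_of_mul_le_mul_left h7 hkp

theorem hasFDerivAt_of_quadratic_error {g : E → ℝ} {Dg : E → E} {C : ℝ}
    (h : ∀ x h, |g (x + h) - g x - inner ℝ (Dg x) h| ≤ C * ‖h‖ ^ 2) (x : E) :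
    HasFDerivAt g (innerSL ℝ (Dg x)) x := by
  rw [hasFDerivAt_iff_isLittleO_nhds_zero]
  have h1 : (fun k => g (x + k) - g x - innerSL ℝ (Dg x) k) =O[𝓝 0] fun k : E => ‖k‖ ^ 2 :=
    Asymptotics.IsBigO.of_bound C (Eventually.of_forall fun k => by
      simpa using h x k)
  exact h1.trans_isLittleO (Asymptotics.isLittleO_norm_pow_id one_lt_two)

theorem eventually_second_order_expansion {g : E → ℝ} {Dg : E → E} {x : E} {X : E →L[ℝ] E}
    (hg : ∀ x, HasFDerivAt g (innerSL ℝ (Dg x)) x) (hX : HasFDerivAt Dg X x) {η : ℝ}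
    (hη : 0 < η) :
    ∀ᶠ h in 𝓝 (0 : E),
      |g (x + h) - g x - inner ℝ (Dg x) h - 1 / 2 * inner ℝ (X h) h| ≤ η * ‖h‖ ^ 2 := by
  rw [hasFDerivAt_iff_isLittleO_nhds_zero] at hX
  have h1 := hX.def hη
  rw [Metric.eventually_nhds_iff_ball] at h1 ⊢
  obtain ⟨r, hr, h1⟩ := h1
  refine ⟨r, hr, fun h hh => ?_⟩
  set F : ℝ → ℝ := fun s => g (x + s • h) - s * inner ℝ (Dg x) h
    - s ^ 2 * (1 / 2 * inner ℝ (X h) h) with hF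
  have hd : ∀ s : ℝ, HasDerivAt F (inner ℝ (Dg (x + s • h)) h - inner ℝ (Dg x) h
      - s * inner ℝ (X h) h) s := by
    intro s
    have a1 : HasDerivAt (fun s : ℝ => x + s • h) h s := by
      simpa using ((hasDerivAt_id s).smul_const h).const_add x
    have a2 : HasDerivAt (fun s : ℝ => g (x + s • h)) (inner ℝ (Dg (x + s • h)) h) s := by
      exact (hg (x + s • h)).comp_hasDerivAt s a1
    have a3 := (hasDerivAt_id s).mul_const (inner ℝ (Dg x) h)
    have a4 := (hasDerivAt_pow 2 s).mul_const (1 / 2 * inner ℝ (X h) h)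
    refine ((a2.sub a3).sub a4).congr_deriv ?_
    push_cast; ring
  have hb : ∀ s ∈ Icc (0 : ℝ) 1, ‖inner ℝ (Dg (x + s • h)) h - inner ℝ (Dg x) h
      - s * inner ℝ (X h) h‖ ≤ η * ‖h‖ ^ 2 := by
    intro s hs
    have b1 : s • h ∈ Metric.ball (0 : E) r := by
      rw [mem_ball_zero_iff] at hh ⊢
      rw [norm_smul, Real.norm_of_nonneg hs.1]
      exact lt_of_le_of_lt (mul_le_of_le_one_left (norm_nonneg _) hs.2) hh
    have b2 := h1 _ b1
    rw [map_smul, norm_smul, Real.norm_of_nonneg hs.1] at b2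
    have b3 : inner ℝ (Dg (x + s • h)) h - inner ℝ (Dg x) h - s * inner ℝ (X h) h
        = inner ℝ (Dg (x + s • h) - Dg x - s • X h) h := by
      rw [inner_sub_left, inner_sub_left, inner_smul_left]; simp
    rw [b3]
    calc _ ≤ ‖Dg (x + s • h) - Dg x - s • X h‖ * ‖h‖ := norm_inner_le_norm _ _
      _ ≤ (η * (s * ‖h‖)) * ‖h‖ := by gcongr
      _ ≤ (η * (1 * ‖h‖)) * ‖h‖ := by gcongr; exact hs.2
      _ = η * ‖h‖ ^ 2 := by ring
  have := (convex_Icc (0 : ℝ) 1).norm_image_sub_le_of_norm_hasDerivWithin_le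
    (fun s _ => (hd s).hasDerivWithinAt) hb (left_mem_Icc.2 zero_le_one)
    (right_mem_Icc.2 zero_le_one)
  simp only [hF, Real.norm_eq_abs] at this
  simp only [one_smul, one_mul, zero_smul, zero_mul, add_zero, sub_zero, abs_one, mul_one,
    one_pow, ne_eq, OfNat.ofNat_ne_zero, not_false_eq_true, zero_pow] at this
  refine le_trans (le_of_eq ?_) this
  congr 1; ring

theorem exists_mem_differentiableAt_of_ball_subset_image {G F : Type*} [NormedAddCommGroup G]
    [NormedSpace ℝ G] [FiniteDimensional ℝ G] [NormedAddCommGroup F] [NormedSpace ℝ F]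
    [FiniteDimensional ℝ F] {Ψ : G → G} {Φ : G → F} {C C' : NNReal} (hΨ : LipschitzWith C Ψ)
    (hΦ : LipschitzWith C' Φ) {A : Set G} {r : ℝ} (hr : 0 < r)
    (hA : Metric.ball 0 r ⊆ Ψ '' A) : ∃ z ∈ A, DifferentiableAt ℝ Φ z := by
  let _ : MeasurableSpace G := borel G
  have _ : BorelSpace G := ⟨rfl⟩
  by_contra! hcon
  set μ : MeasureTheory.Measure G :=
    MeasureTheory.Measure.hausdorffMeasure (Module.finrank ℝ G : ℝ) with hμ
  have _ : μ.IsAddHaarMeasure := MeasureTheory.isAddHaarMeasure_hausdorffMeasure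
  have h1 : μ {z | ¬ DifferentiableAt ℝ Φ z} = 0 := hΦ.ae_differentiableAt
  have h2 : μ A = 0 := MeasureTheory.measure_mono_null (fun z hz => hcon z hz) h1
  have h3 : μ (Ψ '' A) = 0 := by
    have := hΨ.hausdorffMeasure_image_le (d := (Module.finrank ℝ G : ℝ)) (by positivity) A
    rw [← hμ, h2, mul_zero] at this
    exact le_antisymm this zero_le
  have h4 : 0 < μ (Metric.ball (0 : G) r) := Metric.measure_ball_pos μ 0 hr
  exact absurd (MeasureTheory.measure_mono_null hA h3) h4.ne'

theorem eventually_touching_of_sup_convolution {K : Set E} (hK : IsCompact K) {u : E → ℝ}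
    (hu : Continuous u) {ε : ℝ} {g : E → ℝ} {Dg : E → E} {x y : E} {X : E →L[ℝ] E}
    (hle : ∀ x, supConv K u ε x ≤ g x) (heq : g x = supConv K u ε x)
    (hy : supConv K u ε x = u y - ‖x - y‖ ^ 2 / (2 * ε))
    (hg : ∀ x, HasFDerivAt g (innerSL ℝ (Dg x)) x) (hX : HasFDerivAt Dg X x) {η : ℝ}
    (hη : 0 < η) :
    ∀ᶠ h in 𝓝 (0 : E), y + h ∈ K →
      u (y + h) ≤ u y + inner ℝ (Dg x) h + 1 / 2 * inner ℝ (X h) h + η * ‖h‖ ^ 2 := by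
  filter_upwards [eventually_second_order_expansion hg hX hη] with h hh hK'
  have h1 := le_supConv hK hu ε (x + h) hK'
  have h2 := hle (x + h)
  have h3 := (abs_le.1 hh).2
  rw [add_sub_add_right_eq_sub] at h1
  linarith

theorem quadratic_second_difference (Q : E →L[ℝ] E)
    (hsymm : ∀ x y, inner ℝ (Q x) y = inner ℝ x (Q y)) (x h : E) :
    inner ℝ (Q (x + h)) (x + h) = inner ℝ (Q x) x + 2 * inner ℝ (Q x) h + inner ℝ (Q h) h := by
  rw [map_add, inner_add_left, inner_add_right, inner_add_right, hsymm h x,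
    real_inner_comm (Q x) h]
  ring

theorem hull_le_of_supConv_le_quadratic {K : Set E} {u : E → ℝ} {ε δ : ℝ} (hδ : 0 < δ)
    {g : E → ℝ}
    (hmin : ∀ c a, (∀ x, supConv K u ε x ≤ a + ‖x - c‖ ^ 2 / (2 * δ)) →
        ∀ x, g x ≤ a + ‖x - c‖ ^ 2 / (2 * δ))
    (Q : E →L[ℝ] E) (hsymm : ∀ x y, inner ℝ (Q x) y = inner ℝ x (Q y))
    (hQδ : ∀ x, inner ℝ (Q x) x ≤ ‖x‖ ^ 2 / δ) (c p : E) (a : ℝ)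
    (h : ∀ x, supConv K u ε x ≤ a + inner ℝ p x + 1 / 2 * inner ℝ (Q (x - c)) (x - c)) (x : E) :
    g x ≤ a + inner ℝ p x + 1 / 2 * inner ℝ (Q (x - c)) (x - c) := by
  set q := p + Q (x - c) with hq
  have key : ∀ y, ‖y - (x - δ • q)‖ ^ 2 / (2 * δ) =
      ‖y - x‖ ^ 2 / (2 * δ) + inner ℝ q (y - x) + δ * ‖q‖ ^ 2 / 2 := by
    intro y
    rw [show y - (x - δ • q) = (y - x) + δ • q by abel, norm_add_sq_real, inner_smul_right,
      norm_smul, mul_pow, real_inner_comm]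
    simp only [Real.norm_eq_abs, sq_abs]
    field_simp
  have := hmin (x - δ • q)
    (a + inner ℝ p x + 1 / 2 * inner ℝ (Q (x - c)) (x - c) - δ * ‖q‖ ^ 2 / 2) (by
      intro y
      have h1 := h y
      have h2 := quadratic_second_difference Q hsymm (x - c) (y - x)
      rw [show x - c + (y - x) = y - c by abel] at h2
      have h3 := hQδ (y - x)
      have h4 : ‖y - x‖ ^ 2 / δ = 2 * (‖y - x‖ ^ 2 / (2 * δ)) := by field_simp
      have h5 : inner ℝ p y = inner ℝ p x + inner ℝ p (y - x) := by
        rw [← inner_add_right]; congr 1; abel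
      rw [key y, hq, inner_add_left]
      linarith) x
  rw [key x] at this
  simp only [sub_self, norm_zero, ne_eq, OfNat.ofNat_ne_zero, not_false_eq_true, zero_pow,
    zero_div, inner_zero_right] at this
  linarith

variable [FiniteDimensional ℝ E]

set_option maxHeartbeats 1600000 in
/-- The theorem on sums, for the penalization by a quadratic form in the difference of the
variables. -/
theorem exists_second_order_touching {K : Set E} (hK : IsCompact K) (hne : K.Nonempty)
    {u₁ u₂ : E → ℝ} (hu₁ : Continuous u₁) (hu₂ : Continuous u₂) (Q : E →L[ℝ] E)
    (hsymm : ∀ x y, inner ℝ (Q x) y = inner ℝ x (Q y)) (hpos : ∀ x, 0 ≤ inner ℝ (Q x) x)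
    {τ : ℝ} (hτ : 0 < τ) :
    ∃ y₁ ∈ K, ∃ y₂ ∈ K, ∃ (p₁ p₂ : E) (X₁ X₂ : E →L[ℝ] E),
      (∀ a ∈ K, ∀ b ∈ K, u₁ a + u₂ b - 1 / 2 * inner ℝ (Q (a - b)) (a - b) ≤
        u₁ y₁ + u₂ y₂ - 1 / 2 * inner ℝ (Q (y₁ - y₂)) (y₁ - y₂) + τ) ∧
      ‖p₁ - Q (y₁ - y₂)‖ ≤ τ ∧ ‖p₂ + Q (y₁ - y₂)‖ ≤ τ ∧
      (∀ η > 0, ∀ᶠ h in 𝓝 (0 : E), y₁ + h ∈ K → u₁ (y₁ + h) ≤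
        u₁ y₁ + inner ℝ p₁ h + 1 / 2 * inner ℝ (X₁ h) h + η * ‖h‖ ^ 2) ∧
      (∀ η > 0, ∀ᶠ h in 𝓝 (0 : E), y₂ + h ∈ K → u₂ (y₂ + h) ≤
        u₂ y₂ + inner ℝ p₂ h + 1 / 2 * inner ℝ (X₂ h) h + η * ‖h‖ ^ 2) ∧
      (∀ h k, inner ℝ (X₁ h) h + inner ℝ (X₂ k) k ≤ inner ℝ (Q (h - k)) (h - k)) := by
  obtain ⟨ρ, hρ0, hρ⟩ : ∃ ρ, 0 < ρ ∧ ∀ y ∈ K, ‖y‖ ≤ ρ := by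
    obtain ⟨ρ, hρ⟩ := hK.isBounded.exists_norm_le
    exact ⟨max ρ 1, by positivity, fun y hy => (hρ y hy).trans (le_max_left _ _)⟩
  set Λ := ‖Q‖ + 1 with hΛ
  have hΛ0 : 0 < Λ := by positivity
  have hQn : ∀ x, ‖Q x‖ ≤ Λ * ‖x‖ := fun x =>
    (Q.le_opNorm x).trans (by gcongr; linarith)
  have hQi : ∀ x y, |inner ℝ (Q x) y| ≤ Λ * ‖x‖ * ‖y‖ := fun x y =>
    (abs_real_inner_le_norm _ _).trans (by gcongr; exact hQn x)
  set N := 8 * Λ * ρ + 8 * ρ + 8 + 4 * Λ with hN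
  have hN0 : 0 < N := by positivity
  set s := min 1 (τ / N) with hs
  have hs0 : 0 < s := by positivity
  have hs1 : s ≤ 1 := min_le_left _ _
  have hsN : s * N ≤ τ := by
    have : s ≤ τ / N := min_le_right _ _
    rwa [le_div_iff₀ hN0] at this
  set C₁ := 2 * Λ * ρ ^ 2 + 2 with hC₁
  have hC₁0 : 0 < C₁ := by positivity
  set ε := s ^ 2 / (4 * C₁) with hε
  have hε0 : 0 < ε := by positivity
  have hε1 : ε ≤ 1 := by
    rw [hε, div_le_one (by positivity)]
    have : 0 ≤ 2 * Λ * ρ ^ 2 := by positivity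
    nlinarith
  set δ := 1 / Λ with hδ
  have hδ0 : 0 < δ := by positivity
  have hQδ : ∀ x, inner ℝ (Q x) x ≤ ‖x‖ ^ 2 / δ := by
    intro x
    have h1 := (abs_le.1 (hQi x x)).2
    rw [hδ, div_div_eq_mul_div, div_one]
    nlinarith
  obtain ⟨g₁, D₁, c₁, hc₁, hle₁, hexp₁, hmin₁⟩ := exists_paraboloid_hull hK hne hu₁ hε0 hδ0
  obtain ⟨g₂, D₂, c₂, hc₂, hle₂, hexp₂, hmin₂⟩ := exists_paraboloid_hull hK hne hu₂ hε0 hδ0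
  have hD₁ := hasFDerivAt_of_quadratic_error hexp₁
  have hD₂ := hasFDerivAt_of_quadratic_error hexp₂
  have hL₁ : LipschitzWith (Real.toNNReal (6 * c₁)) D₁ := LipschitzWith.of_dist_le_mul
    fun x y => by
      rw [dist_eq_norm, dist_eq_norm, Real.coe_toNNReal _ (by positivity)]
      exact norm_gradient_sub_le_of_quadratic_error hexp₁ x y
  have hL₂ : LipschitzWith (Real.toNNReal (6 * c₂)) D₂ := LipschitzWith.of_dist_le_mul
    fun x y => by
      rw [dist_eq_norm, dist_eq_norm, Real.coe_toNNReal _ (by positivity)]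
      exact norm_gradient_sub_le_of_quadratic_error hexp₂ x y
  set F : E × E → E × E → ℝ := fun p z =>
    supConv K u₁ ε z.1 + supConv K u₂ ε z.2 - 1 / 2 * inner ℝ (Q (z.1 - z.2)) (z.1 - z.2)
      - inner ℝ p.1 z.1 - inner ℝ p.2 z.2 with hF
  have hFc : ∀ p, Continuous (F p) := by
    intro p
    have h1 := (continuous_supConv hK hu₁ ε).comp (continuous_fst (X := E) (Y := E))
    have h2 := (continuous_supConv hK hu₂ ε).comp (continuous_snd (X := E) (Y := E))
    simp only [Function.comp_def] at h1 h2
    simp only [hF]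
    fun_prop
  -- a quadratic upper bound for the sup-convolutions
  have hub : ∀ u : E → ℝ, Continuous u → ∃ m, ∀ x, supConv K u ε x ≤
      m + ρ / ε * ‖x‖ - 1 / (2 * ε) * ‖x‖ ^ 2 := by
    intro u hu
    obtain ⟨m, hm⟩ := (hK.image hu).bddAbove
    refine ⟨m, fun x => ?_⟩
    obtain ⟨y, hy, he⟩ := exists_supConv_eq hK hne hu ε x
    have h1 : u y ≤ m := hm ⟨y, hy, rfl⟩
    have h2 : (‖x‖ ^ 2 - 2 * (ρ * ‖x‖)) / (2 * ε) ≤ ‖x - y‖ ^ 2 / (2 * ε) := by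
      gcongr
      rw [norm_sub_sq_real]
      nlinarith [real_inner_le_norm x y, sq_nonneg ‖y‖, hρ y hy, norm_nonneg x,
        mul_le_mul_of_nonneg_left (hρ y hy) (norm_nonneg x)]
    have h3 : (‖x‖ ^ 2 - 2 * (ρ * ‖x‖)) / (2 * ε) = 1 / (2 * ε) * ‖x‖ ^ 2 - ρ / ε * ‖x‖ := by
      field_simp
    rw [he]; linarith
  obtain ⟨m₁, hm₁⟩ := hub u₁ hu₁
  obtain ⟨m₂, hm₂⟩ := hub u₂ hu₂
  have hmax : ∀ p, ∃ z, ∀ y, F p y ≤ F p z := by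
    intro p
    refine exists_forall_le_of_quadratic_decay (hFc p) (c := 1 / (2 * ε)) (A := m₁ + m₂)
      (B := 2 * (ρ / ε) + ‖p.1‖ + ‖p.2‖) (by positivity) fun z => ?_
    have a1 := hm₁ z.1
    have a2 := hm₂ z.2
    have a3 := hpos (z.1 - z.2)
    have a4 := abs_le.1 (abs_real_inner_le_norm p.1 z.1)
    have a5 := abs_le.1 (abs_real_inner_le_norm p.2 z.2)
    have a6 : ‖z.1‖ ≤ ‖z‖ := norm_fst_le z
    have a7 : ‖z.2‖ ≤ ‖z‖ := norm_snd_le z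
    have a8 : ‖z‖ ^ 2 ≤ ‖z.1‖ ^ 2 + ‖z.2‖ ^ 2 := by
      rcases max_choice ‖z.1‖ ‖z.2‖ with h | h <;> rw [Prod.norm_def, h] <;> nlinarith
    have b1 : ρ / ε * ‖z.1‖ ≤ ρ / ε * ‖z‖ := by gcongr
    have b2 : ρ / ε * ‖z.2‖ ≤ ρ / ε * ‖z‖ := by gcongr
    have b3 : ‖p.1‖ * ‖z.1‖ ≤ ‖p.1‖ * ‖z‖ := by gcongr
    have b4 : ‖p.2‖ * ‖z.2‖ ≤ ‖p.2‖ * ‖z‖ := by gcongr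
    have b5 : 1 / (2 * ε) * ‖z‖ ^ 2 ≤ 1 / (2 * ε) * (‖z.1‖ ^ 2 + ‖z.2‖ ^ 2) := by gcongr
    have e1 : (2 * (ρ / ε) + ‖p.1‖ + ‖p.2‖) * ‖z‖ =
        2 * (ρ / ε * ‖z‖) + ‖p.1‖ * ‖z‖ + ‖p.2‖ * ‖z‖ := by ring
    have e2 : 1 / (2 * ε) * (‖z.1‖ ^ 2 + ‖z.2‖ ^ 2) =
        1 / (2 * ε) * ‖z.1‖ ^ 2 + 1 / (2 * ε) * ‖z.2‖ ^ 2 := by ring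
    simp only [hF]
    linarith [a4.1, a5.1]
  -- at the maximum points, the hulls agree with the sup-convolutions
  have hhull : ∀ p z, (∀ y, F p y ≤ F p z) → ∀ y : E × E,
      g₁ y.1 + g₂ y.2 - 1 / 2 * inner ℝ (Q (y.1 - y.2)) (y.1 - y.2)
        - inner ℝ p.1 y.1 - inner ℝ p.2 y.2 ≤ F p z := by
    intro p z hz y
    have s1 : ∀ x y : E, g₁ x + supConv K u₂ ε y - 1 / 2 * inner ℝ (Q (x - y)) (x - y)
        - inner ℝ p.1 x - inner ℝ p.2 y ≤ F p z := by
      intro x y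
      have := hull_le_of_supConv_le_quadratic hδ0 hmin₁ Q hsymm hQδ y p.1
        (F p z + inner ℝ p.2 y - supConv K u₂ ε y) (fun x' => by
          have := hz (x', y)
          simp only [hF] at this ⊢
          linarith) x
      linarith
    have hneg : ∀ a b : E, inner ℝ (Q (a - b)) (a - b) = inner ℝ (Q (b - a)) (b - a) := by
      intro a b
      rw [← neg_sub b a, map_neg, inner_neg_neg]
    have := hull_le_of_supConv_le_quadratic hδ0 hmin₂ Q hsymm hQδ y.1 p.2
        (F p z + inner ℝ p.1 y.1 - g₁ y.1) (fun y' => by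
          have := s1 y.1 y'
          rw [hneg y.1 y'] at this
          linarith) y.2
    rw [hneg y.1 y.2]
    linarith
  have hhull' : ∀ p z, (∀ y, F p y ≤ F p z) →
      g₁ z.1 = supConv K u₁ ε z.1 ∧ g₂ z.2 = supConv K u₂ ε z.2 := by
    intro p z hz
    have h1 := hhull p z hz z
    have h2 := hle₁ z.1
    have h3 := hle₂ z.2
    simp only [hF] at h1
    constructor <;> linarith
  have hcurve : ∀ p z, (∀ y, F p y ≤ F p z) → ∀ h k : E,
      g₁ (z.1 + h) - g₁ z.1 + (g₂ (z.2 + k) - g₂ z.2) ≤ inner ℝ (Q (z.1 - z.2)) (h - k) +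
        1 / 2 * inner ℝ (Q (h - k)) (h - k) + inner ℝ p.1 h + inner ℝ p.2 k := by
    intro p z hz h k
    have h1 := hhull p z hz (z.1 + h, z.2 + k)
    obtain ⟨h2, h3⟩ := hhull' p z hz
    have h4 := quadratic_second_difference Q hsymm (z.1 - z.2) (h - k)
    simp only [hF] at h1
    rw [show z.1 + h - (z.2 + k) = z.1 - z.2 + (h - k) by abel, h4, inner_add_right,
      inner_add_right] at h1
    rw [h2, h3]
    linarith
  have hgrad : ∀ p z, (∀ y, F p y ≤ F p z) →
      D₁ z.1 = Q (z.1 - z.2) + p.1 ∧ D₂ z.2 = -Q (z.1 - z.2) + p.2 := by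
    intro p z hz
    have aux : ∀ (g : E → ℝ) (Dg : E → E) (c : ℝ) (x q : E),
        (∀ x h, |g (x + h) - g x - inner ℝ (Dg x) h| ≤ c * ‖h‖ ^ 2) →
        (∀ h, g (x + h) - g x ≤ inner ℝ q h + 1 / 2 * inner ℝ (Q h) h) → Dg x = q := by
      intro g Dg c x q h1 h2
      rw [← sub_eq_zero, ← norm_eq_zero]
      by_contra hne
      have hpos' : 0 < ‖Dg x - q‖ := lt_of_le_of_ne (norm_nonneg _) (Ne.symm hne)
      have h3 : ∀ t : ℝ, 0 < t → ‖Dg x - q‖ ^ 2 ≤ t * ((|c| + Λ) * ‖Dg x - q‖ ^ 2) := by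
        intro t ht
        have a1 := (abs_le.1 (h1 x (t • (Dg x - q)))).1
        have a2 := h2 (t • (Dg x - q))
        have a3 := (abs_le.1 (hQi (t • (Dg x - q)) (t • (Dg x - q)))).2
        rw [norm_smul, Real.norm_of_nonneg ht.le] at a1 a3
        have a4 : inner ℝ (Dg x) (t • (Dg x - q)) - inner ℝ q (t • (Dg x - q))
            = t * ‖Dg x - q‖ ^ 2 := by
          rw [← inner_sub_left, inner_smul_right, real_inner_self_eq_norm_sq]
        have a5 : c * (t * ‖Dg x - q‖) ^ 2 ≤ |c| * (t * ‖Dg x - q‖) ^ 2 := by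
          gcongr; exact le_abs_self c
        have a6 : t * ‖Dg x - q‖ ^ 2 ≤ t * (t * ((|c| + Λ) * ‖Dg x - q‖ ^ 2)) := by
          nlinarith [show 0 ≤ Λ * (t * ‖Dg x - q‖) ^ 2 by positivity]
        exact le_of_mul_le_mul_left a6 ht
      have hcΛ : 0 < |c| + Λ := by positivity
      have h4 := h3 (1 / (2 * (|c| + Λ))) (by positivity)
      have h5 : 1 / (2 * (|c| + Λ)) * ((|c| + Λ) * ‖Dg x - q‖ ^ 2) = ‖Dg x - q‖ ^ 2 / 2 := by
        field_simp
      rw [h5] at h4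
      nlinarith
    refine ⟨aux g₁ D₁ c₁ _ _ hexp₁ fun h => ?_, aux g₂ D₂ c₂ _ _ hexp₂ fun k => ?_⟩
    · have := hcurve p z hz h 0
      simp only [add_zero, sub_self, sub_zero, inner_zero_right] at this
      rw [inner_add_left]; linarith
    · have := hcurve p z hz 0 k
      simp only [add_zero, sub_self, inner_zero_right, zero_sub, map_neg, inner_neg_left,
        inner_neg_right, neg_neg] at this
      rw [inner_add_left, inner_neg_left]; linarith
  -- a maximum point at which both gradients are differentiable
  set A : Set (E × E) := {z | ∃ p ∈ Metric.ball (0 : E × E) s, ∀ y, F p y ≤ F p z} with hA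
  set Φ : E × E → E × E := fun z => (D₁ z.1, D₂ z.2) with hΦ
  have hΦL : LipschitzWith _ Φ :=
    (hL₁.comp LipschitzWith.prod_fst).prodMk (hL₂.comp LipschitzWith.prod_snd)
  set Qd : E × E →L[ℝ] E × E :=
    (Q.comp (ContinuousLinearMap.fst ℝ E E - ContinuousLinearMap.snd ℝ E E)).prod
      (-(Q.comp (ContinuousLinearMap.fst ℝ E E - ContinuousLinearMap.snd ℝ E E))) with hQd
  obtain ⟨z, ⟨p, hp, hz⟩, hdiff⟩ :=
    exists_mem_differentiableAt_of_ball_subset_image (hΦL.sub Qd.lipschitz) hΦL (A := A) hs0 (by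
      intro p hp
      obtain ⟨z, hz⟩ := hmax p
      refine ⟨z, ⟨p, hp, hz⟩, ?_⟩
      obtain ⟨h1, h2⟩ := hgrad p z hz
      ext1
      · simp [hΦ, hQd, h1]
      · simp [hΦ, hQd, h2])
  obtain ⟨hz₁, hz₂⟩ := hgrad p z hz
  obtain ⟨he₁, he₂⟩ := hhull' p z hz
  have hdiff₁ : DifferentiableAt ℝ D₁ z.1 := by
    have h1 : DifferentiableAt ℝ (fun x : E => (x, z.2)) z.1 := by fun_prop
    have h2 : DifferentiableAt ℝ Φ ((fun x : E => (x, z.2)) z.1) := hdiff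
    exact (h2.comp z.1 h1).fst
  have hdiff₂ : DifferentiableAt ℝ D₂ z.2 := by
    have h1 : DifferentiableAt ℝ (fun x : E => (z.1, x)) z.2 := by fun_prop
    have h2 : DifferentiableAt ℝ Φ ((fun x : E => (z.1, x)) z.2) := hdiff
    exact (h2.comp z.2 h1).snd
  obtain ⟨y₁, hy₁, hye₁⟩ := exists_supConv_eq hK hne hu₁ ε z.1
  obtain ⟨y₂, hy₂, hye₂⟩ := exists_supConv_eq hK hne hu₂ ε z.2
  have hp1 : ‖p.1‖ < s := (norm_fst_le p).trans_lt (mem_ball_zero_iff.1 hp)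
  have hp2 : ‖p.2‖ < s := (norm_snd_le p).trans_lt (mem_ball_zero_iff.1 hp)
  have hcmp : ∀ a ∈ K, ∀ b ∈ K, u₁ a + u₂ b - 1 / 2 * inner ℝ (Q (a - b)) (a - b)
      + (‖z.1 - y₁‖ ^ 2 / (2 * ε) + ‖z.2 - y₂‖ ^ 2 / (2 * ε)) ≤ u₁ y₁ + u₂ y₂
      - 1 / 2 * inner ℝ (Q (z.1 - z.2)) (z.1 - z.2) + inner ℝ p.1 (a - z.1)
      + inner ℝ p.2 (b - z.2) := by
    intro a ha b hb
    have h1 := hz (a, b)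
    have h2 := le_supConv hK hu₁ ε a ha
    have h3 := le_supConv hK hu₂ ε b hb
    simp only [hF, hye₁, hye₂] at h1
    simp only [sub_self, norm_zero, ne_eq, OfNat.ofNat_ne_zero, not_false_eq_true, zero_pow,
      zero_div, sub_zero] at h2 h3
    rw [inner_sub_right p.1, inner_sub_right p.2]
    linarith
  have hy12 : ‖y₁ - y₂‖ ≤ 2 * ρ := (norm_sub_le _ _).trans (by linarith [hρ _ hy₁, hρ _ hy₂])
  have hdist : ‖z.1 - y₁‖ ≤ s ∧ ‖z.2 - y₂‖ ≤ s := by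
    have h1 := hcmp y₁ hy₁ y₂ hy₂
    have h2 := (abs_le.1 (hQi (y₁ - y₂) (y₁ - y₂))).2
    have h3 := hpos (z.1 - z.2)
    have h4 := (abs_le.1 (abs_real_inner_le_norm p.1 (y₁ - z.1))).2
    have h5 := (abs_le.1 (abs_real_inner_le_norm p.2 (y₂ - z.2))).2
    rw [norm_sub_rev] at h4 h5
    have h6 : Λ * ‖y₁ - y₂‖ * ‖y₁ - y₂‖ ≤ Λ * (2 * ρ) * (2 * ρ) := by gcongr
    have h7 : ∀ d q : ℝ, 0 ≤ d → 0 ≤ q → q ≤ s → q * d ≤ d ^ 2 / (4 * ε) + 1 := by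
      intro d q hd hq hqs
      have : d ≤ d ^ 2 / (4 * ε) + 1 := by
        have e0 : d ^ 2 / (4 * ε) * (4 * ε) = d ^ 2 := by field_simp
        have e1 : 0 ≤ d ^ 2 / (4 * ε) := by positivity
        nlinarith [sq_nonneg (d - 2 * ε)]
      have : q * d ≤ 1 * d := by gcongr; linarith
      linarith
    have h8 := h7 _ _ (norm_nonneg (z.1 - y₁)) (norm_nonneg p.1) hp1.le
    have h9 := h7 _ _ (norm_nonneg (z.2 - y₂)) (norm_nonneg p.2) hp2.le
    have e1 : ∀ d : ℝ, d ^ 2 / (2 * ε) = 2 * (d ^ 2 / (4 * ε)) := by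
      intro d; field_simp; norm_num
    rw [e1, e1] at h1
    have h10 : ‖z.1 - y₁‖ ^ 2 / (4 * ε) + ‖z.2 - y₂‖ ^ 2 / (4 * ε) ≤ C₁ := by
      rw [hC₁]; nlinarith
    have h11 : C₁ * (4 * ε) = s ^ 2 := by rw [hε]; field_simp
    have h12 : ∀ d e : ℝ, 0 ≤ d → d ^ 2 / (4 * ε) + e ^ 2 / (4 * ε) ≤ C₁ → d ≤ s := by
      intro d e hd h
      have : 0 ≤ e ^ 2 / (4 * ε) := by positivity
      have h13 : d ^ 2 / (4 * ε) ≤ C₁ := by linarith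
      rw [div_le_iff₀ (by positivity), h11] at h13
      exact le_of_sq_le_sq h13 hs0.le
    exact ⟨h12 _ _ (norm_nonneg _) h10, h12 _ _ (norm_nonneg _) (by rwa [add_comm] at h10)⟩
  have hshift : ‖(z.1 - z.2) - (y₁ - y₂)‖ ≤ 2 * s := by
    rw [show (z.1 - z.2) - (y₁ - y₂) = (z.1 - y₁) - (z.2 - y₂) by abel]
    exact (norm_sub_le _ _).trans (by linarith [hdist.1, hdist.2])
  have hQshift : ‖Q (z.1 - z.2) - Q (y₁ - y₂)‖ ≤ Λ * (2 * s) := by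
    rw [← map_sub]
    exact (hQn _).trans (by gcongr)
  have hτs : Λ * (2 * s) + s ≤ τ := by
    refine le_trans ?_ hsN
    rw [hN]
    nlinarith [mul_pos hs0 hΛ0, mul_pos hs0 hρ0, mul_pos (mul_pos hs0 hρ0) hΛ0]
  refine ⟨y₁, hy₁, y₂, hy₂, D₁ z.1, D₂ z.2, fderiv ℝ D₁ z.1, fderiv ℝ D₂ z.2,
    ?_, ?_, ?_, ?_, ?_, ?_⟩
  · intro a ha b hb
    have h1 := hcmp a ha b hb
    have h2 : 0 ≤ ‖z.1 - y₁‖ ^ 2 / (2 * ε) + ‖z.2 - y₂‖ ^ 2 / (2 * ε) := by positivity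
    have h3 := quadratic_second_difference Q hsymm (y₁ - y₂) ((z.1 - z.2) - (y₁ - y₂))
    rw [add_sub_cancel] at h3
    have h4 := (abs_le.1 (hQi (y₁ - y₂) ((z.1 - z.2) - (y₁ - y₂)))).1
    have h5 := hpos ((z.1 - z.2) - (y₁ - y₂))
    have h6 : Λ * ‖y₁ - y₂‖ * ‖(z.1 - z.2) - (y₁ - y₂)‖ ≤ Λ * (2 * ρ) * (2 * s) := by gcongr
    have hnz₁ : ‖a - z.1‖ ≤ 2 * ρ + 1 := by
      rw [show a - z.1 = a - y₁ - (z.1 - y₁) by abel]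
      refine (norm_sub_le _ _).trans ?_
      linarith [norm_sub_le a y₁, hρ a ha, hρ y₁ hy₁, hdist.1]
    have hnz₂ : ‖b - z.2‖ ≤ 2 * ρ + 1 := by
      rw [show b - z.2 = b - y₂ - (z.2 - y₂) by abel]
      refine (norm_sub_le _ _).trans ?_
      linarith [norm_sub_le b y₂, hρ b hb, hρ y₂ hy₂, hdist.2]
    have h7 := (abs_le.1 (abs_real_inner_le_norm p.1 (a - z.1))).2
    have h8 := (abs_le.1 (abs_real_inner_le_norm p.2 (b - z.2))).2
    have h9 : ‖p.1‖ * ‖a - z.1‖ ≤ s * (2 * ρ + 1) := by gcongr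
    have h10 : ‖p.2‖ * ‖b - z.2‖ ≤ s * (2 * ρ + 1) := by gcongr
    have h11 : Λ * (2 * ρ) * (2 * s) + 2 * (s * (2 * ρ + 1)) ≤ τ := by
      refine le_trans ?_ hsN
      rw [hN]
      nlinarith [mul_pos hs0 hΛ0, mul_pos hs0 hρ0, mul_pos (mul_pos hs0 hρ0) hΛ0]
    linarith
  · rw [hz₁, show Q (z.1 - z.2) + p.1 - Q (y₁ - y₂) =
      (Q (z.1 - z.2) - Q (y₁ - y₂)) + p.1 by abel]
    exact (norm_add_le _ _).trans (by linarith)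
  · rw [hz₂, show -Q (z.1 - z.2) + p.2 + Q (y₁ - y₂) =
      -(Q (z.1 - z.2) - Q (y₁ - y₂)) + p.2 by abel]
    exact (norm_add_le _ _).trans (by rw [norm_neg]; linarith)
  · intro η hη
    exact eventually_touching_of_sup_convolution hK hu₁ hle₁ he₁ hye₁ hD₁
      hdiff₁.hasFDerivAt hη
  · intro η hη
    exact eventually_touching_of_sup_convolution hK hu₂ hle₂ he₂ hye₂ hD₂
      hdiff₂.hasFDerivAt hη
  · intro h k
    refine le_of_forall_pos_le_add fun η hη => ?_
    set η' := η / (2 * (‖h‖ ^ 2 + ‖k‖ ^ 2 + 1)) with hη'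
    have hη'0 : 0 < η' := by positivity
    have e1 := eventually_second_order_expansion hD₁ hdiff₁.hasFDerivAt hη'0
    have e2 := eventually_second_order_expansion hD₂ hdiff₂.hasFDerivAt hη'0
    have t1 : Tendsto (fun t : ℝ => t • h) (𝓝[>] 0) (𝓝 0) :=
      tendsto_nhdsWithin_of_tendsto_nhds (by
        have : Continuous fun t : ℝ => t • h := by fun_prop
        simpa using this.tendsto 0)
    have t2 : Tendsto (fun t : ℝ => t • k) (𝓝[>] 0) (𝓝 0) :=
      tendsto_nhdsWithin_of_tendsto_nhds (by
        have : Continuous fun t : ℝ => t • k := by fun_prop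
        simpa using this.tendsto 0)
    obtain ⟨t, ⟨ht1, ht2⟩, ht0⟩ :=
      (((t1.eventually e1).and (t2.eventually e2)).and self_mem_nhdsWithin).exists
    have ht0' : (0 : ℝ) < t := ht0
    have h1 := hcurve p z hz (t • h) (t • k)
    rw [hz₁] at ht1
    rw [hz₂] at ht2
    have b1 := (abs_le.1 ht1).1
    have b2 := (abs_le.1 ht2).1
    simp only [map_smul, inner_smul_left, inner_smul_right, conj_trivial, ← smul_sub,
      inner_add_left, inner_neg_left, norm_smul, mul_pow, Real.norm_eq_abs,
      sq_abs] at h1 b1 b2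
    rw [inner_sub_right (Q (z.1 - z.2))] at h1
    have b3 : η' * (‖h‖ ^ 2 + ‖k‖ ^ 2) ≤ η / 2 := by
      have : η' * (‖h‖ ^ 2 + ‖k‖ ^ 2 + 1) = η / 2 := by rw [hη']; field_simp
      nlinarith
    have b4 : t ^ 2 * (inner ℝ ((fderiv ℝ D₁ z.1) h) h + inner ℝ ((fderiv ℝ D₂ z.2) k) k) ≤
        t ^ 2 * (inner ℝ (Q (h - k)) (h - k) + η) := by
      nlinarith [mul_le_mul_of_nonneg_left b3 (sq_nonneg t)]
    exact le_of_mul_le_mul_left b4 (by positivity)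

end TheoremOnSums

section Obstacles

open Filter Topology

variable {k d : ℕ} {Γ1 Γ2 : Type} {gLow : Γ1 → Γ1 → ℝ → Euc k → ℝ} {gUp : Γ2 → Γ2 → ℝ → Euc k → ℝ}

/-- A map of a finite set into itself admits a simple cycle. -/
theorem exists_simple_cycle {α : Type*} [Finite α] (s : α → α) (a : α) :
    ∃ (M : ℕ) (p : ℕ → α), 0 < M ∧ p M = p 0 ∧
      (∀ q q', q < M → q' < M → p q = p q' → q = q') ∧ (∀ q, p (q + 1) = s (p q)) ∧
      ∃ n, p 0 = s^[n] a := by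
  obtain ⟨n, m, hnm, h⟩ := Finite.exists_ne_map_eq_of_infinite fun n => s^[n] a
  have hper : ∃ n M, 0 < M ∧ s^[n + M] a = s^[n] a := by
    rcases lt_or_gt_of_ne hnm with h1 | h1
    · exact ⟨n, m - n, by omega, by rw [show n + (m - n) = m by omega]; exact h.symm⟩
    · exact ⟨m, n - m, by omega, by rw [show m + (n - m) = n by omega]; exact h⟩
  obtain ⟨n, hn⟩ := hper
  have hpos : (Function.minimalPeriod s (s^[n] a)) ≠ 0 := by
    obtain ⟨M, hM, h⟩ := hn
    have : Function.IsPeriodicPt s M (s^[n] a) := by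
      rw [Function.IsPeriodicPt, Function.IsFixedPt, ← Function.iterate_add_apply, add_comm M, h]
    exact (this.minimalPeriod_pos hM).ne'
  refine ⟨Function.minimalPeriod s (s^[n] a), fun q => s^[q] (s^[n] a), Nat.pos_of_ne_zero hpos,
    Function.iterate_minimalPeriod, ?_, fun q => Function.iterate_succ_apply' _ _ _, n, rfl⟩
  intro q q' hq hq' h
  exact Function.iterate_injOn_Iio_minimalPeriod hq hq' h

theorem NoFreeLoop.exists_forall_not_step [Finite Γ1] [Finite Γ2] [DecidableEq Γ1] [DecidableEq Γ2]
    {T : ℝ} (H : NoFreeLoop T gLow gUp) {t : ℝ}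
    (ht : t ∈ Icc 0 T) (x : Euc k) (y : Γ1 × Γ2 → ℝ) {A : Set (Γ1 × Γ2)} (hA : A.Nonempty) :
    ∃ a ∈ A, (∀ i, i ≠ a.1 → (i, a.2) ∈ A → y a - y (i, a.2) ≠ -gLow a.1 i t x) ∧
      ∀ j, j ≠ a.2 → (a.1, j) ∈ A → y a - y (a.1, j) ≠ gUp a.2 j t x := by
  by_contra! hcon
  have hstep : ∀ a : A, ∃ a' : A, a'.1 ≠ a.1 ∧ (a.1.1 = a'.1.1 ∨ a.1.2 = a'.1.2) ∧
      (if a.1.1 = a'.1.1 then 0 else -gLow a.1.1 a'.1.1 t x) +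
        (if a.1.2 = a'.1.2 then 0 else gUp a.1.2 a'.1.2 t x) = y a.1 - y a'.1 := by
    rintro ⟨a, ha⟩
    by_cases h : ∀ i, i ≠ a.1 → (i, a.2) ∈ A → y a - y (i, a.2) ≠ -gLow a.1 i t x
    · obtain ⟨j, hj, hjA, he⟩ := hcon a ha h
      refine ⟨⟨(a.1, j), hjA⟩, fun h' => hj (congrArg Prod.snd h'), Or.inl rfl, ?_⟩
      simp [he, hj.symm]
    · push Not at h
      obtain ⟨i, hi, hiA, he⟩ := h
      refine ⟨⟨(i, a.2), hiA⟩, fun h' => hi (congrArg Prod.fst h'), Or.inr rfl, ?_⟩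
      simp [he, hi.symm]
  choose s hs1 hs2 hs3 using hstep
  obtain ⟨a, ha⟩ := hA
  obtain ⟨M, p, hM, hp0, hinj, hp, -⟩ := exists_simple_cycle s ⟨a, ha⟩
  have hM2 : 2 ≤ M := by
    by_contra hlt
    obtain rfl : M = 1 := by omega
    rw [show (1 : ℕ) = 0 + 1 from rfl, hp 0] at hp0
    exact hs1 (p 0) (congrArg Subtype.val hp0)
  refine H M hM2 (fun q => (p q).1) (congrArg Subtype.val hp0)
    (fun q q' hq hq' h => hinj q q' hq hq' (Subtype.ext h))
    (fun q _ => by rw [hp q]; exact hs2 (p q)) t ht x ?_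
  have : ∀ q, (if (p q).1.1 = (p (q + 1)).1.1 then 0 else -gLow (p q).1.1 (p (q + 1)).1.1 t x) +
      (if (p q).1.2 = (p (q + 1)).1.2 then 0 else gUp (p q).1.2 (p (q + 1)).1.2 t x) =
      y (p q).1 - y (p (q + 1)).1 := fun q => by rw [hp q]; exact hs3 (p q)
  simp only [this]
  rw [Finset.sum_range_sub' (fun q => y (p q).1), hp0, sub_self]

theorem le_lowerObst [Fintype Γ1] [DecidableEq Γ1] [Nontrivial Γ1]
    {i i' : Γ1} (h : i' ≠ i) (j : Γ2) (t : ℝ) (x : Euc k) (y : Γ1 × Γ2 → ℝ) :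
    y (i', j) - gLow i i' t x ≤ lowerObst gLow i j t x y :=
  Finset.le_sup' (fun kk => y (kk, j) - gLow i kk t x)
    (Finset.mem_erase.mpr ⟨h, Finset.mem_univ _⟩)

theorem exists_lowerObst_eq [Fintype Γ1] [DecidableEq Γ1] [Nontrivial Γ1]
    (gLow : Γ1 → Γ1 → ℝ → Euc k → ℝ) (i : Γ1) (j : Γ2) (t : ℝ)
    (x : Euc k) (y : Γ1 × Γ2 → ℝ) :
    ∃ i', i' ≠ i ∧ lowerObst gLow i j t x y = y (i', j) - gLow i i' t x := by
  obtain ⟨i', hi', h⟩ := Finset.exists_mem_eq_sup' (s := Finset.univ.erase i) (by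
      obtain ⟨kk, hkk⟩ := exists_ne i
      exact ⟨kk, Finset.mem_erase.mpr ⟨hkk, Finset.mem_univ kk⟩⟩)
    (fun kk => y (kk, j) - gLow i kk t x)
  exact ⟨i', (Finset.mem_erase.1 hi').1, h⟩

theorem upperObst_le [Fintype Γ2] [DecidableEq Γ2] [Nontrivial Γ2]
    {j j' : Γ2} (h : j' ≠ j) (i : Γ1) (t : ℝ) (x : Euc k) (y : Γ1 × Γ2 → ℝ) :
    upperObst gUp i j t x y ≤ y (i, j') + gUp j j' t x :=
  Finset.inf'_le (fun l => y (i, l) + gUp j l t x)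
    (Finset.mem_erase.mpr ⟨h, Finset.mem_univ _⟩)

theorem exists_upperObst_eq [Fintype Γ2] [DecidableEq Γ2] [Nontrivial Γ2]
    (gUp : Γ2 → Γ2 → ℝ → Euc k → ℝ) (i : Γ1) (j : Γ2) (t : ℝ)
    (x : Euc k) (y : Γ1 × Γ2 → ℝ) :
    ∃ j', j' ≠ j ∧ upperObst gUp i j t x y = y (i, j') + gUp j j' t x := by
  obtain ⟨j', hj', h⟩ := Finset.exists_mem_eq_inf' (s := Finset.univ.erase j) (by
      obtain ⟨l, hl⟩ := exists_ne j
      exact ⟨l, Finset.mem_erase.mpr ⟨hl, Finset.mem_univ l⟩⟩)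
    (fun l => y (i, l) + gUp j l t x)
  exact ⟨j', (Finset.mem_erase.1 hj').1, h⟩

theorem continuous_lowerObst [Fintype Γ1] [DecidableEq Γ1] [Nontrivial Γ1]
    (hg : ∀ i i' : Γ1, Continuous fun p : ℝ × Euc k => gLow i i' p.1 p.2)
    {v : Γ1 × Γ2 → ℝ → Euc k → ℝ} (hv : ∀ ij, Continuous fun p : ℝ × Euc k => v ij p.1 p.2)
    (i : Γ1) (j : Γ2) :
    Continuous fun p : ℝ × Euc k => lowerObst gLow i j p.1 p.2 fun kl => v kl p.1 p.2 := by
  unfold lowerObst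
  exact Continuous.finset_sup'_apply _ fun i' _ => (hv (i', j)).sub (hg i i')

theorem continuous_upperObst [Fintype Γ2] [DecidableEq Γ2] [Nontrivial Γ2]
    (hg : ∀ j j' : Γ2, Continuous fun p : ℝ × Euc k => gUp j j' p.1 p.2)
    {v : Γ1 × Γ2 → ℝ → Euc k → ℝ} (hv : ∀ ij, Continuous fun p : ℝ × Euc k => v ij p.1 p.2)
    (i : Γ1) (j : Γ2) :
    Continuous fun p : ℝ × Euc k => upperObst gUp i j p.1 p.2 fun kl => v kl p.1 p.2 := by
  unfold upperObst
  exact Continuous.finset_inf'_apply _ fun j' _ => (hv (i, j')).add (hg j j')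

theorem isC12_of_contDiff {φ : ℝ → Euc k → ℝ} (h : ContDiff ℝ 2 (Function.uncurry φ)) :
    IsC12 φ := by
  have h1 : ∀ t x, deriv (fun s => φ s x) t = fderiv ℝ (Function.uncurry φ) (t, x) (1, 0) := by
    intro t x
    have h2 : HasDerivAt (fun s : ℝ => (s, x)) ((1 : ℝ), (0 : Euc k)) t :=
      (hasDerivAt_id t).prodMk (hasDerivAt_const t x)
    exact (((h.differentiable (by norm_num)) (t, x)).hasFDerivAt.comp_hasDerivAt t h2).deriv
  have h2 : ContDiff ℝ 1 fun p : ℝ × Euc k => fderiv ℝ (φ p.1) p.2 :=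
    ContDiff.fderiv (f := fun p : ℝ × Euc k => φ p.1) (g := fun p => p.2) (n := 1) (m := 2)
      (h.comp ((contDiff_fst.comp contDiff_fst).prodMk contDiff_snd)) contDiff_snd
      (by norm_num)
  have h3 : ContDiff ℝ 0 fun p : ℝ × Euc k => fderiv ℝ (fderiv ℝ (φ p.1)) p.2 :=
    ContDiff.fderiv (f := fun p : ℝ × Euc k => fderiv ℝ (φ p.1)) (g := fun p => p.2) (n := 0)
      (m := 1) (h2.comp ((contDiff_fst.comp contDiff_fst).prodMk contDiff_snd)) contDiff_snd
      (by norm_num)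
  refine ⟨fun x => ?_, ?_, fun t => ?_, h2.continuous, h3.continuous⟩
  · exact (h.differentiable (by norm_num)).comp
      (differentiable_id.prodMk (differentiable_const x))
  · simp only [h1]
    exact (h.continuous_fderiv (by norm_num)).clm_apply continuous_const
  · exact h.comp (contDiff_const.prodMk contDiff_id)

/-- A continuous function is touched from above by a test function at a dense set of points. -/
theorem exists_mem_isLocalMax_sub {v : ℝ → Euc k → ℝ}
    (hv : Continuous fun p : ℝ × Euc k => v p.1 p.2) {V : Set (ℝ × Euc k)} (hV : IsOpen V)
    {t : ℝ} {x : Euc k} (hx : (t, x) ∈ V) :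
    ∃ t' x', (t', x') ∈ V ∧ ∃ φ : ℝ → Euc k → ℝ, IsC12 φ ∧
      IsLocalMax (fun p : ℝ × Euc k => v p.1 p.2 - φ p.1 p.2) (t', x') ∧ v t' x' = φ t' x' := by
  obtain ⟨r, hr, hrV⟩ := Metric.nhds_basis_closedBall.mem_iff.1 (hV.mem_nhds hx)
  have hK : IsCompact (Metric.closedBall (t, x) r) := isCompact_closedBall _ _
  obtain ⟨m, hm⟩ := (hK.image hv).isBounded.exists_norm_le
  have hm' : ∀ p ∈ Metric.closedBall (t, x) r, |v p.1 p.2| ≤ m := fun p hp => hm _ ⟨p, hp, rfl⟩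
  set n := (2 * m + 1) / r ^ 2 with hn
  have hm0 : 0 ≤ m := (abs_nonneg _).trans (hm' (t, x) (Metric.mem_closedBall_self hr.le))
  have hn0 : 0 < n := by positivity
  have hnr : n * r ^ 2 = 2 * m + 1 := by rw [hn]; field_simp
  set q : ℝ × Euc k → ℝ := fun p => n * ((p.1 - t) ^ 2 + ‖p.2 - x‖ ^ 2) with hq
  have hqs : ContDiff ℝ 2 q := by
    refine contDiff_const.mul (((contDiff_fst.sub contDiff_const).pow 2).add ?_)
    exact (contDiff_snd.sub contDiff_const).norm_sq ℝ
  obtain ⟨z, hz, hmax⟩ := hK.exists_isMaxOn ⟨_, Metric.mem_closedBall_self hr.le⟩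
    ((hv.sub hqs.continuous).continuousOn)
  have hzr : dist z (t, x) < r := by
    refine lt_of_le_of_ne hz fun he => ?_
    have h1 : v t x - q (t, x) ≤ v z.1 z.2 - q z := hmax (Metric.mem_closedBall_self hr.le)
    have h2 : n * r ^ 2 ≤ q z := by
      refine mul_le_mul_of_nonneg_left ?_ hn0.le
      rw [← he, Prod.dist_eq, dist_eq_norm, dist_eq_norm, Real.norm_eq_abs]
      rcases max_choice |z.1 - t| ‖z.2 - x‖ with h | h
      · rw [h, sq_abs]; exact le_add_of_nonneg_right (sq_nonneg _)
      · rw [h]; exact le_add_of_nonneg_left (sq_nonneg _)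
    have h3 : q (t, x) = 0 := by simp [hq]
    have h4 := abs_le.1 (hm' z hz)
    have h5 := abs_le.1 (hm' (t, x) (Metric.mem_closedBall_self hr.le))
    simp only at h5
    linarith [h4.2, h5.1]
  have hmax' : ∀ p ∈ Metric.closedBall (t, x) r, v p.1 p.2 - q p ≤ v z.1 z.2 - q z :=
    fun p hp => hmax hp
  refine ⟨z.1, z.2, hrV hz, fun s y => q (s, y) + (v z.1 z.2 - q z), isC12_of_contDiff ?_, ?_, ?_⟩
  · exact hqs.add contDiff_const
  · filter_upwards [Metric.isOpen_ball.mem_nhds hzr] with p hp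
    have := hmax' p (Metric.ball_subset_closedBall hp)
    simp only [Prod.mk.eta]
    linarith
  · simp

theorem timeDeriv_neg (φ : ℝ → Euc k → ℝ) (t : ℝ) (x : Euc k) :
    timeDeriv (fun s y => -φ s y) t x = -timeDeriv φ t x := by
  simp only [timeDeriv]
  exact deriv.fun_neg

theorem pd_neg (i : Fin k) (ψ : Euc k → ℝ) (x : Euc k) :
    pd i (fun y => -ψ y) x = -pd i ψ x := by
  simp only [pd, fderiv_fun_neg]
  rfl

theorem genL_neg (b : ℝ → Euc k → Fin k → ℝ) (σm : ℝ → Euc k → Matrix (Fin k) (Fin d) ℝ)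
    (φ : ℝ → Euc k → ℝ) (t : ℝ) (x : Euc k) :
    genL b σm (fun s y => -φ s y) t x = -genL b σm φ t x := by
  simp only [genL, pd_neg, mul_neg, Finset.sum_neg_distrib]
  ring

theorem sigGrad_neg (σm : ℝ → Euc k → Matrix (Fin k) (Fin d) ℝ)
    (φ : ℝ → Euc k → ℝ) (t : ℝ) (x : Euc k) :
    sigGrad σm (fun s y => -φ s y) t x = -sigGrad σm φ t x := by
  ext l
  simp only [sigGrad, pd_neg, mul_neg, Finset.sum_neg_distrib, Pi.neg_apply]

theorem IsC12.neg {φ : ℝ → Euc k → ℝ} (h : IsC12 φ) : IsC12 fun s y => -φ s y := by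
  obtain ⟨h1, h2, h3, h4, h5⟩ := h
  have e1 : ∀ t, fderiv ℝ (fun y => -φ t y) = fun y => -fderiv ℝ (φ t) y := fun t => by
    ext1 y; exact fderiv_fun_neg
  refine ⟨fun x => (h1 x).neg, ?_, fun t => (h3 t).neg, ?_, ?_⟩
  · simpa only [deriv.fun_neg] using h2.fun_neg
  · simpa only [e1] using h4.fun_neg
  · simpa only [e1, fderiv_fun_neg] using h5.fun_neg

theorem exists_mem_isLocalMin_sub {v : ℝ → Euc k → ℝ}
    (hv : Continuous fun p : ℝ × Euc k => v p.1 p.2) {V : Set (ℝ × Euc k)} (hV : IsOpen V)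
    {t : ℝ} {x : Euc k} (hx : (t, x) ∈ V) :
    ∃ t' x', (t', x') ∈ V ∧ ∃ φ : ℝ → Euc k → ℝ, IsC12 φ ∧
      IsLocalMin (fun p : ℝ × Euc k => v p.1 p.2 - φ p.1 p.2) (t', x') ∧ v t' x' = φ t' x' := by
  obtain ⟨t', x', h, φ, hφ, hmax, he⟩ :=
    exists_mem_isLocalMax_sub (v := fun s y => -v s y) hv.neg hV hx
  refine ⟨t', x', h, fun s y => -φ s y, hφ.neg, ?_, by simp only [← he, neg_neg]⟩
  filter_upwards [hmax] with p hp
  linarith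

end Obstacles

section ObstacleBounds

variable {k d : ℕ} {Γ1 Γ2 : Type} [Fintype Γ1] [Fintype Γ2] [DecidableEq Γ1] [DecidableEq Γ2]
  [Nontrivial Γ1] [Nontrivial Γ2] {T : ℝ} {b : ℝ → Euc k → Fin k → ℝ}
  {σm : ℝ → Euc k → Matrix (Fin k) (Fin d) ℝ} {h : Γ1 × Γ2 → Euc k → ℝ}
  {f : Γ1 → Γ2 → ℝ → Euc k → ((Γ1 × Γ2) → ℝ) → (Fin d → ℝ) → ℝ}
  {gLow : Γ1 → Γ1 → ℝ → Euc k → ℝ} {gUp : Γ2 → Γ2 → ℝ → Euc k → ℝ}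
  {v : Γ1 × Γ2 → ℝ → Euc k → ℝ}

theorem lowerObst_le_of_minMax (hv : ∀ ij, Continuous fun p : ℝ × Euc k => v ij p.1 p.2)
    (hgl : ∀ i i' : Γ1, Continuous fun p : ℝ × Euc k => gLow i i' p.1 p.2)
    (hsup : IsViscSupersolSys T b σm h (FminMax f gLow gUp) v) (ij : Γ1 × Γ2) {t : ℝ}
    (ht : t ∈ Ioo 0 T) (x : Euc k) :
    lowerObst gLow ij.1 ij.2 t x (fun kl => v kl t x) ≤ v ij t x := by
  by_contra! hlt
  obtain ⟨t', x', ⟨hV, ht'⟩, φ, hφ, hmin, he⟩ := exists_mem_isLocalMin_sub (hv ij)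
    ((isOpen_lt (hv ij) (continuous_lowerObst hgl hv ij.1 ij.2)).inter
      (isOpen_Ioo.preimage continuous_fst)) (show (t, x) ∈ _ from ⟨hlt, ht⟩)
  have := (le_min_iff.1 (hsup.2 ij t' x' ht' φ hφ hmin he)).1
  simp only [Set.mem_ofPred_eq] at hV
  linarith

theorem le_obst_of_minMax (hv : ∀ ij, Continuous fun p : ℝ × Euc k => v ij p.1 p.2)
    (hgl : ∀ i i' : Γ1, Continuous fun p : ℝ × Euc k => gLow i i' p.1 p.2)
    (hgu : ∀ j j' : Γ2, Continuous fun p : ℝ × Euc k => gUp j j' p.1 p.2)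
    (hsub : IsViscSubsolSys T b σm h (FminMax f gLow gUp) v) (ij : Γ1 × Γ2) {t : ℝ}
    (ht : t ∈ Ioo 0 T) (x : Euc k) :
    v ij t x ≤ lowerObst gLow ij.1 ij.2 t x (fun kl => v kl t x) ∨
      v ij t x ≤ upperObst gUp ij.1 ij.2 t x (fun kl => v kl t x) := by
  by_contra! hlt
  obtain ⟨t', x', ⟨⟨hV₁, hV₂⟩, ht'⟩, φ, hφ, hmax, he⟩ := exists_mem_isLocalMax_sub (hv ij)
    (((isOpen_lt (continuous_lowerObst hgl hv ij.1 ij.2) (hv ij)).inter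
      (isOpen_lt (continuous_upperObst hgu hv ij.1 ij.2) (hv ij))).inter
      (isOpen_Ioo.preimage continuous_fst)) (show (t, x) ∈ _ from ⟨hlt, ht⟩)
  simp only [Set.mem_ofPred_eq] at hV₁ hV₂
  rcases min_le_iff.1 (hsub.2 ij t' x' ht' φ hφ hmax he) with h1 | h1
  · linarith
  · linarith [(max_le_iff.1 h1).1]

theorem le_upperObst_of_minMax (hv : ∀ ij, Continuous fun p : ℝ × Euc k => v ij p.1 p.2)
    (hgl : ∀ i i' : Γ1, Continuous fun p : ℝ × Euc k => gLow i i' p.1 p.2)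
    (hgu : ∀ j j' : Γ2, Continuous fun p : ℝ × Euc k => gUp j j' p.1 p.2)
    (hnfl : NoFreeLoop T gLow gUp)
    (hsol : IsViscSolSys T b σm h (FminMax f gLow gUp) v) (ij : Γ1 × Γ2) {t : ℝ}
    (ht : t ∈ Ioo 0 T) (x : Euc k) :
    v ij t x ≤ upperObst gUp ij.1 ij.2 t x (fun kl => v kl t x) := by
  obtain ⟨i, j⟩ := ij
  by_contra! hlt
  obtain ⟨l, hl, he⟩ := exists_upperObst_eq gUp i j t x fun kl => v kl t x
  rw [he] at hlt
  obtain ⟨m, hm⟩ := Finite.exists_max fun i => v (i, j) t x - v (i, l) t x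
  obtain ⟨⟨i₁, j₁⟩, ⟨rfl, hmax⟩, hA, -⟩ := hnfl.exists_forall_not_step (Ioo_subset_Icc_self ht) x
    (fun kl => v kl t x)
    (A := {a | a.2 = j ∧ ∀ i, v (i, j) t x - v (i, l) t x ≤ v (a.1, j) t x - v (a.1, l) t x})
    ⟨(m, j), rfl, hm⟩
  simp only at hmax hA hlt hl
  have hgt := hmax i
  have hU : upperObst gUp i₁ j₁ t x (fun kl => v kl t x) < v (i₁, j₁) t x :=
    (upperObst_le hl i₁ t x fun kl => v kl t x).trans_lt (by linarith)
  have hL := (le_obst_of_minMax hv hgl hgu hsol.1 (i₁, j₁) ht x).resolve_right hU.not_ge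
  obtain ⟨i₂, hi₂, he₂⟩ := exists_lowerObst_eq gLow i₁ j₁ t x fun kl => v kl t x
  rw [he₂] at hL
  have h1 := (le_lowerObst hi₂ j₁ t x _).trans (lowerObst_le_of_minMax hv hgl hsol.2 (i₁, j₁) ht x)
  have h2 := (le_lowerObst hi₂ l t x _).trans (lowerObst_le_of_minMax hv hgl hsol.2 (i₁, l) ht x)
  refine hA i₂ hi₂ ⟨rfl, fun i => (hmax i).trans ?_⟩ ?_
  · simp only
    linarith
  · linarith

theorem le_upperObst_of_maxMin (hv : ∀ ij, Continuous fun p : ℝ × Euc k => v ij p.1 p.2)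
    (hgu : ∀ j j' : Γ2, Continuous fun p : ℝ × Euc k => gUp j j' p.1 p.2)
    (hsub : IsViscSubsolSys T b σm h (FmaxMin f gLow gUp) v) (ij : Γ1 × Γ2) {t : ℝ}
    (ht : t ∈ Ioo 0 T) (x : Euc k) :
    v ij t x ≤ upperObst gUp ij.1 ij.2 t x (fun kl => v kl t x) := by
  by_contra! hlt
  obtain ⟨t', x', ⟨hV, ht'⟩, φ, hφ, hmax, he⟩ := exists_mem_isLocalMax_sub (hv ij)
    ((isOpen_lt (continuous_upperObst hgu hv ij.1 ij.2) (hv ij)).inter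
      (isOpen_Ioo.preimage continuous_fst)) (show (t, x) ∈ _ from ⟨hlt, ht⟩)
  have := (max_le_iff.1 (hsub.2 ij t' x' ht' φ hφ hmax he)).1
  simp only [Set.mem_ofPred_eq] at hV
  linarith

theorem obst_le_of_maxMin (hv : ∀ ij, Continuous fun p : ℝ × Euc k => v ij p.1 p.2)
    (hgl : ∀ i i' : Γ1, Continuous fun p : ℝ × Euc k => gLow i i' p.1 p.2)
    (hgu : ∀ j j' : Γ2, Continuous fun p : ℝ × Euc k => gUp j j' p.1 p.2)
    (hsup : IsViscSupersolSys T b σm h (FmaxMin f gLow gUp) v) (ij : Γ1 × Γ2) {t : ℝ}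
    (ht : t ∈ Ioo 0 T) (x : Euc k) :
    upperObst gUp ij.1 ij.2 t x (fun kl => v kl t x) ≤ v ij t x ∨
      lowerObst gLow ij.1 ij.2 t x (fun kl => v kl t x) ≤ v ij t x := by
  by_contra! hlt
  obtain ⟨t', x', ⟨⟨hV₁, hV₂⟩, ht'⟩, φ, hφ, hmin, he⟩ := exists_mem_isLocalMin_sub (hv ij)
    (((isOpen_lt (hv ij) (continuous_upperObst hgu hv ij.1 ij.2)).inter
      (isOpen_lt (hv ij) (continuous_lowerObst hgl hv ij.1 ij.2))).inter
      (isOpen_Ioo.preimage continuous_fst)) (show (t, x) ∈ _ from ⟨hlt, ht⟩)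
  simp only [Set.mem_ofPred_eq] at hV₁ hV₂
  rcases le_max_iff.1 (hsup.2 ij t' x' ht' φ hφ hmin he) with h1 | h1
  · linarith
  · linarith [(le_min_iff.1 h1).1]

theorem lowerObst_le_of_maxMin (hv : ∀ ij, Continuous fun p : ℝ × Euc k => v ij p.1 p.2)
    (hgl : ∀ i i' : Γ1, Continuous fun p : ℝ × Euc k => gLow i i' p.1 p.2)
    (hgu : ∀ j j' : Γ2, Continuous fun p : ℝ × Euc k => gUp j j' p.1 p.2)
    (hnfl : NoFreeLoop T gLow gUp)
    (hsol : IsViscSolSys T b σm h (FmaxMin f gLow gUp) v) (ij : Γ1 × Γ2) {t : ℝ}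
    (ht : t ∈ Ioo 0 T) (x : Euc k) :
    lowerObst gLow ij.1 ij.2 t x (fun kl => v kl t x) ≤ v ij t x := by
  obtain ⟨i, j⟩ := ij
  by_contra! hlt
  obtain ⟨l, hl, he⟩ := exists_lowerObst_eq gLow i j t x fun kl => v kl t x
  rw [he] at hlt
  obtain ⟨m, hm⟩ := Finite.exists_max fun j => v (l, j) t x - v (i, j) t x
  obtain ⟨⟨i₁, j₁⟩, ⟨rfl, hmax⟩, -, hA⟩ := hnfl.exists_forall_not_step (Ioo_subset_Icc_self ht) x
    (fun kl => v kl t x)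
    (A := {a | a.1 = i ∧ ∀ j, v (l, j) t x - v (i, j) t x ≤ v (l, a.2) t x - v (i, a.2) t x})
    ⟨(i, m), rfl, hm⟩
  simp only at hmax hA hlt hl
  have hgt := hmax j
  have hL : v (i₁, j₁) t x < lowerObst gLow i₁ j₁ t x (fun kl => v kl t x) :=
    lt_of_lt_of_le (by linarith) (le_lowerObst hl j₁ t x fun kl => v kl t x)
  have hU := (obst_le_of_maxMin hv hgl hgu hsol.2 (i₁, j₁) ht x).resolve_right hL.not_ge
  obtain ⟨j₂, hj₂, he₂⟩ := exists_upperObst_eq gUp i₁ j₁ t x fun kl => v kl t x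
  rw [he₂] at hU
  have h1 := (le_upperObst_of_maxMin hv hgu hsol.1 (i₁, j₁) ht x).trans
    (upperObst_le hj₂ i₁ t x _)
  have h2 := (le_upperObst_of_maxMin hv hgu hsol.1 (l, j₁) ht x).trans (upperObst_le hj₂ l t x _)
  refine hA j₂ hj₂ ⟨rfl, fun j => (hmax j).trans ?_⟩ ?_
  · simp only
    linarith
  · linarith

end ObstacleBounds

section Jets

open Filter Topology

variable {k d : ℕ}

/-- Space-time with its Euclidean structure. -/
abbrev SpaceTime (k : ℕ) : Type := WithLp 2 (ℝ × Euc k)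

/-- The space-time vector field `(1, b)`. -/
def driftDir (b : ℝ → Euc k → Fin k → ℝ) (t : ℝ) (x : Euc k) : SpaceTime k :=
  WithLp.toLp 2 (1, WithLp.toLp 2 (b t x))

/-- The space-time vector fields `(0, σ_l)` given by the columns of `σ`. -/
def noiseDir (σm : ℝ → Euc k → Matrix (Fin k) (Fin d) ℝ) (t : ℝ) (x : Euc k) (l : Fin d) :
    SpaceTime k :=
  WithLp.toLp 2 (0, WithLp.toLp 2 fun i => σm t x i l)

/-- The inclusion of space in space-time. -/
def spaceIncl (k : ℕ) : Euc k →L[ℝ] SpaceTime k :=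
  (WithLp.prodContinuousLinearEquiv 2 ℝ ℝ (Euc k)).symm.toContinuousLinearMap.comp
    (ContinuousLinearMap.inr ℝ ℝ (Euc k))

theorem spaceIncl_apply (x : Euc k) : spaceIncl k x = WithLp.toLp 2 ((0 : ℝ), x) := rfl

theorem toLp_eq_sum_single (a : Fin k → ℝ) :
    (WithLp.toLp 2 a : Euc k) = ∑ i, a i • EuclideanSpace.single i (1 : ℝ) := by
  ext i
  simp [Finset.sum_apply, Pi.single_apply]

theorem noiseDir_eq (σm : ℝ → Euc k → Matrix (Fin k) (Fin d) ℝ) (t : ℝ) (x : Euc k) (l : Fin d) :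
    noiseDir σm t x l = ∑ i, σm t x i l • spaceIncl k (EuclideanSpace.single i 1) := by
  rw [noiseDir, ← spaceIncl_apply, toLp_eq_sum_single, map_sum]
  simp only [map_smul]

theorem driftDir_eq (b : ℝ → Euc k → Fin k → ℝ) (t : ℝ) (x : Euc k) :
    driftDir b t x = WithLp.toLp 2 ((1 : ℝ), (0 : Euc k)) +
      ∑ i, b t x i • spaceIncl k (EuclideanSpace.single i 1) := by
  have : ∑ i, b t x i • spaceIncl k (EuclideanSpace.single i 1) =
      WithLp.toLp 2 ((0 : ℝ), (WithLp.toLp 2 (b t x) : Euc k)) := by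
    rw [← spaceIncl_apply, toLp_eq_sum_single, map_sum]
    simp only [map_smul]
  rw [this, ← WithLp.toLp_add, driftDir]
  simp

theorem pd_add (i : Fin k) {ψ₁ ψ₂ : Euc k → ℝ} {x : Euc k} (h₁ : DifferentiableAt ℝ ψ₁ x)
    (h₂ : DifferentiableAt ℝ ψ₂ x) : pd i (fun y => ψ₁ y + ψ₂ y) x = pd i ψ₁ x + pd i ψ₂ x := by
  simp only [pd]
  rw [fderiv_fun_add h₁ h₂]
  rfl

theorem differentiable_pd (i : Fin k) {ψ : Euc k → ℝ} (h : ContDiff ℝ 2 ψ) :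
    Differentiable ℝ fun y => pd i ψ y := by
  have h1 : ContDiff ℝ 1 (fderiv ℝ ψ) := h.fderiv_right (by norm_num)
  exact (h1.clm_apply contDiff_const).differentiable (by norm_num)

theorem timeDeriv_add {φ ψ : ℝ → Euc k → ℝ} {t : ℝ} {x : Euc k}
    (hφ : DifferentiableAt ℝ (fun s => φ s x) t) (hψ : DifferentiableAt ℝ (fun s => ψ s x) t) :
    timeDeriv (fun s y => φ s y + ψ s y) t x = timeDeriv φ t x + timeDeriv ψ t x :=
  deriv_fun_add hφ hψ

theorem genL_add (b : ℝ → Euc k → Fin k → ℝ) (σm : ℝ → Euc k → Matrix (Fin k) (Fin d) ℝ)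
    {φ ψ : ℝ → Euc k → ℝ} {t : ℝ} (hφ : ContDiff ℝ 2 (φ t)) (hψ : ContDiff ℝ 2 (ψ t))
    (x : Euc k) :
    genL b σm (fun s y => φ s y + ψ s y) t x = genL b σm φ t x + genL b σm ψ t x := by
  have hφ' := hφ.differentiable (by norm_num)
  have hψ' := hψ.differentiable (by norm_num)
  have h1 : ∀ j, (fun y => pd j (fun y => φ t y + ψ t y) y) =
      fun y => pd j (φ t) y + pd j (ψ t) y := fun j => by
    ext1 y; exact pd_add j (hφ' y) (hψ' y)
  simp only [genL, h1]
  simp only [fun i j => pd_add i (differentiable_pd j hφ x) (differentiable_pd j hψ x),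
    mul_add, Finset.sum_add_distrib]
  ring

theorem sigGrad_add (σm : ℝ → Euc k → Matrix (Fin k) (Fin d) ℝ)
    {φ ψ : ℝ → Euc k → ℝ} {t : ℝ} {x : Euc k} (hφ : DifferentiableAt ℝ (φ t) x)
    (hψ : DifferentiableAt ℝ (ψ t) x) :
    sigGrad σm (fun s y => φ s y + ψ s y) t x = sigGrad σm φ t x + sigGrad σm ψ t x := by
  ext l
  simp only [sigGrad, Pi.add_apply, pd_add _ hφ hψ, mul_add, Finset.sum_add_distrib]

/-- The quadratic test function with value `m`, gradient `p` and Hessian `X` at `(t₀, x₀)`. -/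
def quadTest (m : ℝ) (p : SpaceTime k) (X : SpaceTime k →L[ℝ] SpaceTime k) (t₀ : ℝ) (x₀ : Euc k)
    (t : ℝ) (x : Euc k) : ℝ :=
  m + inner ℝ p (WithLp.toLp 2 (t - t₀, x - x₀)) +
    1 / 2 * inner ℝ (X (WithLp.toLp 2 (t - t₀, x - x₀))) (WithLp.toLp 2 (t - t₀, x - x₀))

variable (m : ℝ) (p : SpaceTime k) (X : SpaceTime k →L[ℝ] SpaceTime k) (t₀ : ℝ) (x₀ : Euc k)

theorem contDiff_quadTest : ContDiff ℝ 2 (Function.uncurry (quadTest m p X t₀ x₀)) := by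
  have h : ContDiff ℝ 2 fun z : ℝ × Euc k => (WithLp.toLp 2 (z.1 - t₀, z.2 - x₀) : SpaceTime k) :=
    (WithLp.prodContinuousLinearEquiv 2 ℝ ℝ (Euc k)).symm.contDiff.comp
      ((contDiff_fst.sub contDiff_const).prodMk (contDiff_snd.sub contDiff_const))
  exact (contDiff_const.add (contDiff_const.inner ℝ h)).add
    (contDiff_const.mul ((X.contDiff.comp h).inner ℝ h))

theorem quadTest_self : quadTest m p X t₀ x₀ t₀ x₀ = m := by
  have : (WithLp.toLp 2 ((0 : ℝ), (0 : Euc k)) : SpaceTime k) = 0 := rfl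
  simp [quadTest, this]

theorem timeDeriv_quadTest :
    timeDeriv (quadTest m p X t₀ x₀) t₀ x₀ =
      inner ℝ p (WithLp.toLp 2 ((1 : ℝ), (0 : Euc k))) := by
  set e : SpaceTime k := WithLp.toLp 2 ((1 : ℝ), (0 : Euc k)) with he
  have h1 : ∀ s, quadTest m p X t₀ x₀ s x₀ =
      m + (s - t₀) * inner ℝ p e + 1 / 2 * ((s - t₀) * ((s - t₀) * inner ℝ (X e) e)) := by
    intro s
    have : (WithLp.toLp 2 (s - t₀, x₀ - x₀) : SpaceTime k) = (s - t₀) • e := by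
      rw [he, ← WithLp.toLp_smul]; simp
    rw [quadTest, this, map_smul, inner_smul_left, inner_smul_right, inner_smul_right]
    simp
  have h2 : HasDerivAt (fun s => s - t₀) 1 t₀ := (hasDerivAt_id t₀).sub_const t₀
  have h3 := ((h2.mul_const (inner ℝ p e)).const_add m).add
    ((h2.fun_mul (h2.mul_const (inner ℝ (X e) e))).const_mul (1 / 2))
  simp only [timeDeriv, h1]
  refine h3.deriv.trans ?_
  simp

theorem pd_quadTest (i : Fin k) (y : Euc k) :
    pd i (quadTest m p X t₀ x₀ t₀) y = inner ℝ p (spaceIncl k (EuclideanSpace.single i 1)) +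
      1 / 2 * (inner ℝ (X (spaceIncl k (y - x₀))) (spaceIncl k (EuclideanSpace.single i 1)) +
        inner ℝ (X (spaceIncl k (EuclideanSpace.single i 1))) (spaceIncl k (y - x₀))) := by
  have h1 : ∀ y, quadTest m p X t₀ x₀ t₀ y = m + inner ℝ p (spaceIncl k (y - x₀)) +
      1 / 2 * inner ℝ (X (spaceIncl k (y - x₀))) (spaceIncl k (y - x₀)) := by
    intro y
    rw [quadTest, sub_self, spaceIncl_apply]
  have h2 : HasFDerivAt (fun y => spaceIncl k (y - x₀)) (spaceIncl k) y :=
    (spaceIncl k).hasFDerivAt.comp y ((hasFDerivAt_id y).sub_const x₀)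
  have h3 : HasFDerivAt (fun y => X (spaceIncl k (y - x₀))) (X.comp (spaceIncl k)) y :=
    X.hasFDerivAt.comp y h2
  have h4 := (((hasFDerivAt_const p y).inner ℝ h2).const_add m).add
    ((h3.inner ℝ h2).const_mul (1 / 2))
  simp only [pd]
  rw [show quadTest m p X t₀ x₀ t₀ = _ from funext h1]
  have h5 := h4.fderiv
  simp only [Pi.add_def] at h5
  rw [h5]
  simp [fderivInnerCLM_apply]

theorem pd_pd_quadTest (i j : Fin k) :
    pd i (fun y => pd j (quadTest m p X t₀ x₀ t₀) y) x₀ =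
      1 / 2 * (inner ℝ (X (spaceIncl k (EuclideanSpace.single i 1)))
          (spaceIncl k (EuclideanSpace.single j 1)) +
        inner ℝ (X (spaceIncl k (EuclideanSpace.single j 1)))
          (spaceIncl k (EuclideanSpace.single i 1))) := by
  simp only [pd_quadTest]
  set e := spaceIncl k (EuclideanSpace.single j 1)
  have h2 : HasFDerivAt (fun y => spaceIncl k (y - x₀)) (spaceIncl k) x₀ :=
    (spaceIncl k).hasFDerivAt.comp x₀ ((hasFDerivAt_id x₀).sub_const x₀)
  have h3 : HasFDerivAt (fun y => X (spaceIncl k (y - x₀))) (X.comp (spaceIncl k)) x₀ :=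
    X.hasFDerivAt.comp x₀ h2
  have h4 := (((h3.inner ℝ (hasFDerivAt_const e x₀)).add
    ((hasFDerivAt_const (X e) x₀).inner ℝ h2)).const_mul (1 / 2)).const_add (inner ℝ p e)
  simp only [pd]
  have h5 := h4.fderiv
  simp only [Pi.add_apply] at h5
  rw [h5]
  simp [fderivInnerCLM_apply]
  ring

theorem genL_quadTest (b : ℝ → Euc k → Fin k → ℝ)
    (σm : ℝ → Euc k → Matrix (Fin k) (Fin d) ℝ) :
    timeDeriv (quadTest m p X t₀ x₀) t₀ x₀ + genL b σm (quadTest m p X t₀ x₀) t₀ x₀ =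
      inner ℝ p (driftDir b t₀ x₀) +
        1 / 2 * ∑ l, inner ℝ (X (noiseDir σm t₀ x₀ l)) (noiseDir σm t₀ x₀ l) := by
  have h1 : ∀ l, inner ℝ (X (noiseDir σm t₀ x₀ l)) (noiseDir σm t₀ x₀ l) =
      ∑ i, ∑ j, σm t₀ x₀ i l * σm t₀ x₀ j l *
        inner ℝ (X (spaceIncl k (EuclideanSpace.single i 1)))
          (spaceIncl k (EuclideanSpace.single j 1)) := by
    intro l
    rw [noiseDir_eq, map_sum, sum_inner]
    refine Finset.sum_congr rfl fun i _ => ?_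
    rw [inner_sum]
    refine Finset.sum_congr rfl fun j _ => ?_
    rw [map_smul, inner_smul_left, inner_smul_right, conj_trivial]
    ring
  have h2 : ∀ l, inner ℝ (X (noiseDir σm t₀ x₀ l)) (noiseDir σm t₀ x₀ l) =
      ∑ i, ∑ j, σm t₀ x₀ i l * σm t₀ x₀ j l *
        inner ℝ (X (spaceIncl k (EuclideanSpace.single j 1)))
          (spaceIncl k (EuclideanSpace.single i 1)) := by
    intro l
    rw [h1, Finset.sum_comm]
    refine Finset.sum_congr rfl fun i _ => Finset.sum_congr rfl fun j _ => ?_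
    ring
  have h3 : ∑ i, ∑ j, (σm t₀ x₀ * (σm t₀ x₀)ᵀ) i j *
      pd i (fun y => pd j (quadTest m p X t₀ x₀ t₀) y) x₀ =
      ∑ l, inner ℝ (X (noiseDir σm t₀ x₀ l)) (noiseDir σm t₀ x₀ l) := by
    have h4 : ∀ l, inner ℝ (X (noiseDir σm t₀ x₀ l)) (noiseDir σm t₀ x₀ l) =
        ∑ i, ∑ j, σm t₀ x₀ i l * σm t₀ x₀ j l *
          pd i (fun y => pd j (quadTest m p X t₀ x₀ t₀) y) x₀ := by
      intro l
      have : ∀ a c e : ℝ, a = c → a = e → a = 1 / 2 * (c + e) := by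
        intro a c e h h'; linarith
      rw [this _ _ _ (h1 l) (h2 l)]
      simp only [pd_pd_quadTest, ← Finset.sum_add_distrib, Finset.mul_sum]
      refine Finset.sum_congr rfl fun i _ => Finset.sum_congr rfl fun j _ => ?_
      ring
    simp only [h4, Matrix.mul_apply, Finset.sum_mul, Matrix.transpose_apply]
    refine (Finset.sum_congr rfl fun i _ => Finset.sum_comm).trans Finset.sum_comm
  have h5 : ∑ i, b t₀ x₀ i * pd i (quadTest m p X t₀ x₀ t₀) x₀ =
      inner ℝ p (∑ i, b t₀ x₀ i • spaceIncl k (EuclideanSpace.single i 1)) := by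
    rw [inner_sum]
    refine Finset.sum_congr rfl fun i _ => ?_
    rw [pd_quadTest, inner_smul_right]
    simp
  rw [genL, h3, h5, timeDeriv_quadTest, driftDir_eq, inner_add_right]
  ring

theorem sigGrad_quadTest (σm : ℝ → Euc k → Matrix (Fin k) (Fin d) ℝ) (l : Fin d) :
    sigGrad σm (quadTest m p X t₀ x₀) t₀ x₀ l = inner ℝ p (noiseDir σm t₀ x₀ l) := by
  rw [noiseDir_eq, inner_sum, sigGrad]
  refine Finset.sum_congr rfl fun i _ => ?_
  rw [pd_quadTest, inner_smul_right]
  simp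

/-- If `v - R` is touched from above to second order, then `v` is touched from above by a test
function with the corresponding derivatives. -/
theorem exists_test_of_second_order_touching (b : ℝ → Euc k → Fin k → ℝ)
    (σm : ℝ → Euc k → Matrix (Fin k) (Fin d) ℝ) {v R : ℝ → Euc k → ℝ}
    (hR : ContDiff ℝ 2 (Function.uncurry R))
    (htouch : ∀ᶠ h in 𝓝 (0 : SpaceTime k), v (t₀ + h.fst) (x₀ + h.snd) -
      R (t₀ + h.fst) (x₀ + h.snd) ≤ v t₀ x₀ - R t₀ x₀ + inner ℝ p h + 1 / 2 * inner ℝ (X h) h) :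
    ∃ φ : ℝ → Euc k → ℝ, IsC12 φ ∧
      IsLocalMax (fun z : ℝ × Euc k => v z.1 z.2 - φ z.1 z.2) (t₀, x₀) ∧ v t₀ x₀ = φ t₀ x₀ ∧
      timeDeriv φ t₀ x₀ + genL b σm φ t₀ x₀ = timeDeriv R t₀ x₀ + genL b σm R t₀ x₀ +
        (inner ℝ p (driftDir b t₀ x₀) +
          1 / 2 * ∑ l, inner ℝ (X (noiseDir σm t₀ x₀ l)) (noiseDir σm t₀ x₀ l)) ∧
      sigGrad σm φ t₀ x₀ = sigGrad σm R t₀ x₀ + fun l => inner ℝ p (noiseDir σm t₀ x₀ l) := by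
  set q := quadTest (v t₀ x₀ - R t₀ x₀) p X t₀ x₀ with hq
  have hqs : ContDiff ℝ 2 (Function.uncurry q) := contDiff_quadTest _ _ _ _ _
  obtain ⟨hR1, -, hR2, -, -⟩ := isC12_of_contDiff hR
  obtain ⟨hq1, -, hq2, -, -⟩ := isC12_of_contDiff hqs
  refine ⟨fun s y => R s y + q s y, isC12_of_contDiff (hR.add hqs), ?_, ?_, ?_, ?_⟩
  · have h0 : Tendsto (fun z : ℝ × Euc k => (WithLp.toLp 2 (z.1 - t₀, z.2 - x₀) : SpaceTime k))
        (𝓝 (t₀, x₀)) (𝓝 0) := by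
      have : Continuous fun z : ℝ × Euc k =>
          (WithLp.toLp 2 (z.1 - t₀, z.2 - x₀) : SpaceTime k) :=
        (WithLp.prodContinuousLinearEquiv 2 ℝ ℝ (Euc k)).symm.continuous.comp
          ((continuous_fst.sub continuous_const).prodMk (continuous_snd.sub continuous_const))
      have h1 := this.tendsto (t₀, x₀)
      simp only [sub_self] at h1
      exact h1
    filter_upwards [h0.eventually htouch] with z hz
    change v (t₀ + (z.1 - t₀)) (x₀ + (z.2 - x₀)) - R (t₀ + (z.1 - t₀)) (x₀ + (z.2 - x₀)) ≤ _ at hz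
    rw [add_sub_cancel, add_sub_cancel] at hz
    have h1 : q z.1 z.2 = v t₀ x₀ - R t₀ x₀ + inner ℝ p (WithLp.toLp 2 (z.1 - t₀, z.2 - x₀)) +
      1 / 2 * inner ℝ (X (WithLp.toLp 2 (z.1 - t₀, z.2 - x₀)))
        (WithLp.toLp 2 (z.1 - t₀, z.2 - x₀)) := rfl
    have h2 : q t₀ x₀ = v t₀ x₀ - R t₀ x₀ := quadTest_self _ _ _ _ _
    linarith
  · have h2 : q t₀ x₀ = v t₀ x₀ - R t₀ x₀ := quadTest_self _ _ _ _ _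
    linarith
  · rw [timeDeriv_add (hR1 x₀ t₀) (hq1 x₀ t₀), genL_add b σm (hR2 t₀) (hq2 t₀),
      ← genL_quadTest (v t₀ x₀ - R t₀ x₀)]
    ring
  · rw [sigGrad_add σm ((hR2 t₀).differentiable (by norm_num) x₀)
      ((hq2 t₀).differentiable (by norm_num) x₀)]
    congr 1
    ext l
    exact sigGrad_quadTest _ _ _ _ _ _ _

end Jets

section Doubling

open Filter Topology

variable {k d : ℕ}

theorem spaceTime_norm_sq (z : SpaceTime k) : ‖z‖ ^ 2 = z.fst ^ 2 + ‖z.snd‖ ^ 2 := by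
  rw [WithLp.prod_norm_sq_eq_of_L2, Real.norm_eq_abs, sq_abs]

theorem spaceTime_norm_snd_le (z : SpaceTime k) : ‖z.snd‖ ≤ ‖z‖ := by
  nlinarith [spaceTime_norm_sq z, sq_nonneg z.fst, norm_nonneg z, norm_nonneg z.snd]

theorem spaceTime_abs_fst_le (z : SpaceTime k) : |z.fst| ≤ ‖z‖ := by
  refine abs_le_of_sq_le_sq ?_ (norm_nonneg z)
  nlinarith [spaceTime_norm_sq z, sq_nonneg ‖z.snd‖]

/-- The diagonal operator with weight `β` on time and `α` on space. -/
def penaltyOp (k : ℕ) (α β : ℝ) : SpaceTime k →L[ℝ] SpaceTime k :=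
  ((WithLp.prodContinuousLinearEquiv 2 ℝ ℝ (Euc k)).symm.toContinuousLinearMap.comp
    (((β • ContinuousLinearMap.id ℝ ℝ).prodMap (α • ContinuousLinearMap.id ℝ (Euc k))))).comp
    (WithLp.prodContinuousLinearEquiv 2 ℝ ℝ (Euc k)).toContinuousLinearMap

theorem inner_penaltyOp (α β : ℝ) (y z : SpaceTime k) :
    inner ℝ (penaltyOp k α β y) z = β * (y.fst * z.fst) + α * inner ℝ y.snd z.snd := by
  have : penaltyOp k α β y = WithLp.toLp 2 (β * y.fst, α • y.snd) := rfl
  rw [this, WithLp.prod_inner_apply]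
  simp only [inner_smul_left]
  simp
  ring

theorem inner_penaltyOp_self (α β : ℝ) (y : SpaceTime k) :
    inner ℝ (penaltyOp k α β y) y = β * y.fst ^ 2 + α * ‖y.snd‖ ^ 2 := by
  rw [inner_penaltyOp, real_inner_self_eq_norm_sq, ← sq]

/-- Choice of the penalization weights: the time weight is taken large compared with the space
weight, so that the vector fields `V i`, Lipschitz in space only, do not see the penalty. -/
theorem exists_penalty_weights {K : Set (SpaceTime k)} (hK : IsCompact K) {w : SpaceTime k → ℝ}
    (hw : Continuous w) {ι : Type*} {V : ι → SpaceTime k → SpaceTime k} {C : ℝ}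
    (hV : ∀ η > 0, ∃ r > 0, ∀ y ∈ K, ∀ z ∈ K, |y.fst - z.fst| ≤ r →
      ∀ i, ‖V i y - V i z‖ ≤ η + C * ‖y.snd - z.snd‖) {δ : ℝ} (hδ : 0 < δ) :
    ∃ τ > 0, τ ≤ δ ∧ ∃ α > 0, ∃ β > 0, ∀ y ∈ K, ∀ z ∈ K,
      1 / 2 * (β * (y.fst - z.fst) ^ 2 + α * ‖y.snd - z.snd‖ ^ 2) ≤ w y - w z + τ →
      β * (y.fst - z.fst) ^ 2 + α * ‖y.snd - z.snd‖ ^ 2 ≤ δ ∧ |w z - w y| ≤ δ ∧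
      ‖y - z‖ ≤ δ ∧ ∀ i, α * ‖V i y - V i z‖ ^ 2 ≤ δ := by
  obtain ⟨M, hM⟩ := hK.exists_bound_of_continuousOn hw.continuousOn
  set δ' := δ / (4 * (C ^ 2 + 1)) with hδ'
  have hC1 : 0 < 4 * (C ^ 2 + 1) := by positivity
  have hδ'0 : 0 < δ' := by positivity
  have hδ'e : δ' * (4 * (C ^ 2 + 1)) = δ := div_mul_cancel₀ _ hC1.ne'
  have hδ'C : 2 * C ^ 2 * δ' ≤ δ / 2 := by nlinarith
  have hδ'δ : δ' ≤ δ := by nlinarith [sq_nonneg C]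
  have huc := hK.uniformContinuousOn_of_continuous hw.continuousOn
  obtain ⟨r₀, hr₀, hwr⟩ := Metric.uniformContinuousOn_iff.1 huc (δ' / 4) (by positivity)
  set ρ := min r₀ δ with hρ
  have hρ0 : 0 < ρ := lt_min hr₀ hδ
  set D := 4 * |M| + 2 with hD
  have hD0 : 0 < D := by positivity
  set α := 4 * D / ρ ^ 2 with hα
  have hα0 : 0 < α := by positivity
  obtain ⟨r, hr, hVr⟩ := hV (Real.sqrt (δ / (4 * α))) (by positivity)
  set β := max (4 * D / ρ ^ 2) (D / r ^ 2) with hβ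
  have hβ0 : 0 < β := lt_max_of_lt_left hα0
  refine ⟨min 1 (δ' / 4), by positivity, (min_le_right _ _).trans (by linarith), α, hα0, β, hβ0,
    fun y hy z hz h => ?_⟩
  have hτ1 : min 1 (δ' / 4) ≤ 1 := min_le_left _ _
  have hτ2 : min 1 (δ' / 4) ≤ δ' / 4 := min_le_right _ _
  have hMy := hM y hy
  have hMz := hM z hz
  rw [Real.norm_eq_abs] at hMy hMz
  have hMM := le_abs_self M
  have ha : 0 ≤ β * (y.fst - z.fst) ^ 2 := by positivity
  have hb : 0 ≤ α * ‖y.snd - z.snd‖ ^ 2 := by positivity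
  have hQD : β * (y.fst - z.fst) ^ 2 + α * ‖y.snd - z.snd‖ ^ 2 ≤ D := by
    rw [hD]
    linarith [neg_abs_le (w z), le_abs_self (w y)]
  have hx : ‖y.snd - z.snd‖ ^ 2 ≤ ρ ^ 2 / 4 := by
    have h1 : α * (ρ ^ 2 / 4) = D := by rw [hα]; field_simp
    exact le_of_mul_le_mul_left (by linarith) hα0
  have ht : (y.fst - z.fst) ^ 2 ≤ ρ ^ 2 / 4 := by
    have h1 : α * (ρ ^ 2 / 4) = D := by rw [hα]; field_simp
    have h2 : α * (ρ ^ 2 / 4) ≤ β * (ρ ^ 2 / 4) := by gcongr; exact le_max_left _ _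
    exact le_of_mul_le_mul_left (by linarith) hβ0
  have htr : (y.fst - z.fst) ^ 2 ≤ r ^ 2 := by
    have h1 : D / r ^ 2 * r ^ 2 = D := by field_simp
    have h2 : D / r ^ 2 * r ^ 2 ≤ β * r ^ 2 := by gcongr; exact le_max_right _ _
    exact le_of_mul_le_mul_left (by linarith) hβ0
  have hyz : ‖y - z‖ < ρ := by
    have h1 : ‖y - z‖ ^ 2 = (y.fst - z.fst) ^ 2 + ‖y.snd - z.snd‖ ^ 2 := spaceTime_norm_sq (y - z)
    nlinarith [norm_nonneg (y - z), sq_nonneg ρ]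
  have hwyz : |w z - w y| < δ' / 4 := by
    have := hwr z hz y hy (by rw [dist_comm, dist_eq_norm]; exact hyz.trans_le (min_le_left _ _))
    rwa [Real.dist_eq] at this
  have hQ : β * (y.fst - z.fst) ^ 2 + α * ‖y.snd - z.snd‖ ^ 2 ≤ δ' := by
    linarith [neg_abs_le (w z - w y)]
  refine ⟨hQ.trans hδ'δ, by linarith, hyz.le.trans (min_le_right _ _), fun i => ?_⟩
  have h1 := hVr y hy z hz (abs_le_of_sq_le_sq htr hr.le) i
  have h2 : Real.sqrt (δ / (4 * α)) ^ 2 = δ / (4 * α) := Real.sq_sqrt (by positivity)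
  have h3 : α * (δ / (4 * α)) = δ / 4 := by field_simp
  have h4 : ‖V i y - V i z‖ ^ 2 ≤
      2 * (δ / (4 * α)) + 2 * C ^ 2 * ‖y.snd - z.snd‖ ^ 2 := by
    rw [← h2]
    nlinarith [norm_nonneg (V i y - V i z), sq_nonneg (Real.sqrt (δ / (4 * α)) -
      C * ‖y.snd - z.snd‖)]
  calc α * ‖V i y - V i z‖ ^ 2
      ≤ α * (2 * (δ / (4 * α)) + 2 * C ^ 2 * ‖y.snd - z.snd‖ ^ 2) := by gcongr
    _ = 2 * (α * (δ / (4 * α))) + 2 * C ^ 2 * (α * ‖y.snd - z.snd‖ ^ 2) := by ring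
    _ ≤ 2 * (δ / 4) + 2 * C ^ 2 * δ' := by rw [h3]; gcongr; linarith
    _ ≤ δ := by linarith

theorem abs_inner_penaltyOp_le {α β δ : ℝ} (hα : 0 < α) (hβ : 0 < β) {y V : SpaceTime k}
    (hV : V.fst = 0) (hy : β * y.fst ^ 2 + α * ‖y.snd‖ ^ 2 ≤ δ) (hVδ : α * ‖V‖ ^ 2 ≤ δ) :
    |inner ℝ (penaltyOp k α β y) V| ≤ δ := by
  rw [inner_penaltyOp, hV, mul_zero, mul_zero, zero_add, abs_mul, abs_of_pos hα]
  have h1 := abs_real_inner_le_norm y.snd V.snd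
  have h2 := spaceTime_norm_snd_le V
  have h4 : 0 ≤ β * y.fst ^ 2 := by positivity
  have h5 : |inner ℝ y.snd V.snd| ≤ 1 / 2 * (‖y.snd‖ ^ 2 + ‖V‖ ^ 2) := by
    nlinarith [norm_nonneg y.snd, norm_nonneg V.snd, sq_nonneg (‖y.snd‖ - ‖V‖)]
  calc α * |inner ℝ y.snd V.snd| ≤ α * (1 / 2 * (‖y.snd‖ ^ 2 + ‖V‖ ^ 2)) := by gcongr
    _ = 1 / 2 * (α * ‖y.snd‖ ^ 2 + α * ‖V‖ ^ 2) := by ring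
    _ ≤ δ := by linarith

/-- First order error of the doubling penalty along two nearby vectors. -/
theorem abs_inner_add_inner_le {α β δ M : ℝ} (hδ : 0 ≤ δ) (hα : 0 < α) (hβ : 0 < β)
    {y V₁ V₂ p₁ p₂ : SpaceTime k}
    (hV : (V₁ - V₂).fst = 0) (hy : β * y.fst ^ 2 + α * ‖y.snd‖ ^ 2 ≤ δ)
    (hVδ : α * ‖V₁ - V₂‖ ^ 2 ≤ δ) (h₁ : ‖V₁‖ ≤ M) (h₂ : ‖V₂‖ ≤ M)
    (hp₁ : ‖p₁ - penaltyOp k α β y‖ ≤ δ) (hp₂ : ‖p₂ + penaltyOp k α β y‖ ≤ δ) :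
    |inner ℝ p₁ V₁ + inner ℝ p₂ V₂| ≤ 2 * δ * M + δ := by
  have e : inner ℝ p₁ V₁ + inner ℝ p₂ V₂ = inner ℝ (p₁ - penaltyOp k α β y) V₁ +
      inner ℝ (p₂ + penaltyOp k α β y) V₂ + inner ℝ (penaltyOp k α β y) (V₁ - V₂) := by
    rw [inner_sub_left, inner_add_left, inner_sub_right]; ring
  have e1 : |inner ℝ (p₁ - penaltyOp k α β y) V₁| ≤ δ * M :=
    (abs_real_inner_le_norm _ _).trans (mul_le_mul hp₁ h₁ (norm_nonneg _) hδ)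
  have e2 : |inner ℝ (p₂ + penaltyOp k α β y) V₂| ≤ δ * M :=
    (abs_real_inner_le_norm _ _).trans (mul_le_mul hp₂ h₂ (norm_nonneg _) hδ)
  have e3 := abs_inner_penaltyOp_le hα hβ hV hy hVδ
  rw [e]
  refine (abs_add_three _ _ _).trans ?_
  linarith

/-- Adding a small multiple of the identity. -/
def shiftOp (X : SpaceTime k →L[ℝ] SpaceTime k) (δ : ℝ) : SpaceTime k →L[ℝ] SpaceTime k :=
  X + (2 * δ) • ContinuousLinearMap.id ℝ (SpaceTime k)

theorem inner_shiftOp (X : SpaceTime k →L[ℝ] SpaceTime k) (δ : ℝ) (h : SpaceTime k) :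
    inner ℝ (shiftOp X δ h) h = inner ℝ (X h) h + 2 * δ * ‖h‖ ^ 2 := by
  simp [shiftOp, inner_add_left, inner_smul_left]

/-- Second order error of the doubling penalty along nearby vectors. -/
theorem sum_inner_shiftOp_le {α β δ M : ℝ} (hδ : 0 ≤ δ) (hα : 0 < α)
    {V₁ V₂ : Fin d → SpaceTime k} {X₁ X₂ : SpaceTime k →L[ℝ] SpaceTime k}
    (hX : ∀ h h', inner ℝ (X₁ h) h + inner ℝ (X₂ h') h' ≤
      inner ℝ (penaltyOp k α β (h - h')) (h - h'))
    (hV : ∀ l, (V₁ l - V₂ l).fst = 0) (hVδ : ∀ l, α * ‖V₁ l - V₂ l‖ ^ 2 ≤ δ)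
    (h₁ : ∀ l, ‖V₁ l‖ ≤ M) (h₂ : ∀ l, ‖V₂ l‖ ≤ M) :
    ∑ l, inner ℝ (shiftOp X₁ δ (V₁ l)) (V₁ l) + ∑ l, inner ℝ (shiftOp X₂ δ (V₂ l)) (V₂ l) ≤
      d * (δ + 4 * δ * M ^ 2) := by
  rw [← Finset.sum_add_distrib]
  have : ∀ l ∈ (Finset.univ : Finset (Fin d)), inner ℝ (shiftOp X₁ δ (V₁ l)) (V₁ l) +
      inner ℝ (shiftOp X₂ δ (V₂ l)) (V₂ l) ≤ δ + 4 * δ * M ^ 2 := by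
    intro l _
    rw [inner_shiftOp, inner_shiftOp]
    have h := hX (V₁ l) (V₂ l)
    have h3 := spaceTime_norm_snd_le (V₁ l - V₂ l)
    rw [inner_penaltyOp_self, hV l] at h
    have h7 : α * ‖(V₁ l - V₂ l).snd‖ ^ 2 ≤ α * ‖V₁ l - V₂ l‖ ^ 2 := by gcongr
    have h8 : 2 * δ * ‖V₁ l‖ ^ 2 ≤ 2 * δ * M ^ 2 := by gcongr; exact h₁ l
    have h9 : 2 * δ * ‖V₂ l‖ ^ 2 ≤ 2 * δ * M ^ 2 := by gcongr; exact h₂ l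
    linarith [hVδ l]
  refine (Finset.sum_le_sum this).trans (le_of_eq ?_)
  rw [Finset.sum_const, Finset.card_univ, Fintype.card_fin, nsmul_eq_mul]

theorem norm_toLp_le_sum (a : Fin k → ℝ) : ‖(WithLp.toLp 2 a : Euc k)‖ ≤ ∑ i, |a i| := by
  rw [toLp_eq_sum_single]
  refine (norm_sum_le _ _).trans (Finset.sum_le_sum fun i _ => ?_)
  simp [norm_smul]

theorem norm_toLp_zero (x : Euc k) : ‖(WithLp.toLp 2 ((0 : ℝ), x) : SpaceTime k)‖ = ‖x‖ := by
  have := spaceTime_norm_sq (WithLp.toLp 2 ((0 : ℝ), x) : SpaceTime k)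
  have h2 : ‖(WithLp.toLp 2 ((0 : ℝ), x) : SpaceTime k)‖ ^ 2 = ‖x‖ ^ 2 := by
    rw [this]; simp
  exact (sq_eq_sq₀ (norm_nonneg _) (norm_nonneg _)).1 h2

/-- The drift field, indexed by `none`, together with the noise fields. -/
def coeffDir (b : ℝ → Euc k → Fin k → ℝ) (σm : ℝ → Euc k → Matrix (Fin k) (Fin d) ℝ)
    (t : ℝ) (x : Euc k) : Option (Fin d) → SpaceTime k
  | none => driftDir b t x
  | some l => noiseDir σm t x l

variable {T : ℝ} {b : ℝ → Euc k → Fin k → ℝ} {σm : ℝ → Euc k → Matrix (Fin k) (Fin d) ℝ}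

theorem H0.continuous_coeffDir (h : H0 T b σm) (i : Option (Fin d)) :
    Continuous fun z : ℝ × Euc k => coeffDir b σm z.1 z.2 i := by
  obtain ⟨hb, hσ, -⟩ := h
  have e1 := (WithLp.prodContinuousLinearEquiv 2 ℝ ℝ (Euc k)).symm.continuous
  have e2 := (EuclideanSpace.equiv (Fin k) ℝ).symm.continuous
  cases i with
  | none => exact e1.comp (continuous_const.prodMk (e2.comp hb))
  | some l =>
    refine e1.comp (continuous_const.prodMk (e2.comp (continuous_pi fun i => ?_)))
    exact (continuous_apply l).comp ((continuous_apply i).comp hσ)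

theorem H0.exists_coeffDir_lipschitz (h : H0 T b σm) : ∃ C : ℝ, 0 ≤ C ∧ ∀ t ∈ Icc (0 : ℝ) T,
    ∀ x y : Euc k, ∀ i, ‖coeffDir b σm t x i - coeffDir b σm t y i‖ ≤ C * ‖x - y‖ := by
  obtain ⟨-, -, C, hC⟩ := h
  refine ⟨k * |C|, by positivity, fun t ht x y i => ?_⟩
  have hsum : ∀ a : Fin k → ℝ, (∀ i, |a i| ≤ C * ‖x - y‖) →
      ‖(WithLp.toLp 2 ((0 : ℝ), (WithLp.toLp 2 a : Euc k)) : SpaceTime k)‖ ≤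
        k * |C| * ‖x - y‖ := by
    intro a ha
    rw [norm_toLp_zero]
    refine (norm_toLp_le_sum a).trans ((Finset.sum_le_sum fun i _ => ha i).trans ?_)
    rw [Finset.sum_const, Finset.card_univ, Fintype.card_fin, nsmul_eq_mul, ← mul_assoc]
    gcongr
    exact le_abs_self C
  cases i with
  | none =>
    have : coeffDir b σm t x none - coeffDir b σm t y none =
        WithLp.toLp 2 ((0 : ℝ), (WithLp.toLp 2 fun i => b t x i - b t y i : Euc k)) := by
      simp only [coeffDir, driftDir, ← WithLp.toLp_sub, Prod.mk_sub_mk, sub_self]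
      rfl
    rw [this]
    exact hsum _ (hC t ht x y).1
  | some l =>
    have : coeffDir b σm t x (some l) - coeffDir b σm t y (some l) =
        WithLp.toLp 2 ((0 : ℝ), (WithLp.toLp 2 fun i => σm t x i l - σm t y i l : Euc k)) := by
      simp only [coeffDir, noiseDir, ← WithLp.toLp_sub, Prod.mk_sub_mk, sub_self]
      rfl
    rw [this]
    exact hsum _ fun i => (hC t ht x y).2 i l

theorem coeffDir_sub_fst (t s : ℝ) (x y : Euc k) (i : Option (Fin d)) :
    (coeffDir b σm t x i - coeffDir b σm s y i).fst = 0 := by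
  cases i <;> simp [coeffDir, driftDir, noiseDir]

theorem continuous_timeDeriv_add_genL (h : H0 T b σm) {φ : ℝ → Euc k → ℝ} (hφ : IsC12 φ) :
    Continuous fun z : ℝ × Euc k => timeDeriv φ z.1 z.2 + genL b σm φ z.1 z.2 := by
  obtain ⟨hb, hσ, -⟩ := h
  obtain ⟨-, h1, h2, h3, h4⟩ := hφ
  have hpd : ∀ i, Continuous fun z : ℝ × Euc k => pd i (φ z.1) z.2 := fun i =>
    h3.clm_apply continuous_const
  have hpd2 : ∀ i j, Continuous fun z : ℝ × Euc k => pd i (fun y => pd j (φ z.1) y) z.2 := by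
    intro i j
    have : ∀ z : ℝ × Euc k, pd i (fun y => pd j (φ z.1) y) z.2 =
        fderiv ℝ (fderiv ℝ (φ z.1)) z.2 (EuclideanSpace.single i 1)
          (EuclideanSpace.single j 1) := by
      intro z
      have hd : DifferentiableAt ℝ (fderiv ℝ (φ z.1)) z.2 :=
        ((h2 z.1).fderiv_right (m := 1) (by norm_num)).differentiable (by norm_num) z.2
      have := (hd.hasFDerivAt.clm_apply (hasFDerivAt_const (EuclideanSpace.single j (1 : ℝ)) z.2))
      simp only [pd]
      rw [this.fderiv]
      simp
    simp only [this]
    exact (h4.clm_apply continuous_const).clm_apply continuous_const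
  refine h1.add (Continuous.add (continuous_const.mul ?_) ?_)
  · refine continuous_finsetSum _ fun i _ => continuous_finsetSum _ fun j _ => ?_
    have hm : Continuous fun z : ℝ × Euc k => σm z.1 z.2 * (σm z.1 z.2)ᵀ :=
      hσ.matrix_mul hσ.matrix_transpose
    exact (hm.matrix_elem i j).mul (hpd2 i j)
  · exact continuous_finsetSum _ fun i _ => ((continuous_apply i).comp hb).mul (hpd i)

theorem continuous_sigGrad (h : H0 T b σm) {φ : ℝ → Euc k → ℝ} (hφ : IsC12 φ) :
    Continuous fun z : ℝ × Euc k => sigGrad σm φ z.1 z.2 := by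
  obtain ⟨-, hσ, -⟩ := h
  obtain ⟨-, h1, h2, h3, h4⟩ := hφ
  refine continuous_pi fun l => continuous_finsetSum _ fun i _ => ?_
  exact (Continuous.matrix_elem hσ i l).mul (h3.clm_apply continuous_const)

end Doubling

section TestPair

open Filter Topology

variable {k d : ℕ} {T : ℝ} {b : ℝ → Euc k → Fin k → ℝ}
  {σm : ℝ → Euc k → Matrix (Fin k) (Fin d) ℝ}

theorem H0.coeffDir_modulus (h : H0 T b σm) {K : Set (SpaceTime k)} {ρ : ℝ} {x₀ : Euc k}
    (hKt : ∀ z ∈ K, z.fst ∈ Icc (0 : ℝ) T)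
    (hKx : ∀ z ∈ K, ‖z.snd - x₀‖ ≤ ρ) :
    ∃ C : ℝ, ∀ η > 0, ∃ r > 0, ∀ y ∈ K, ∀ z ∈ K, |y.fst - z.fst| ≤ r →
      ∀ i, ‖coeffDir b σm y.fst y.snd i - coeffDir b σm z.fst z.snd i‖ ≤
        η + C * ‖y.snd - z.snd‖ := by
  obtain ⟨C, -, hC⟩ := h.exists_coeffDir_lipschitz
  refine ⟨C, fun η hη => ?_⟩
  have hcpt : IsCompact (Icc (0 : ℝ) T ×ˢ Metric.closedBall x₀ ρ) :=
    isCompact_Icc.prod (isCompact_closedBall _ _)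
  have huc : ∀ i, ∃ r > 0, ∀ a ∈ Icc (0 : ℝ) T ×ˢ Metric.closedBall x₀ ρ,
      ∀ c ∈ Icc (0 : ℝ) T ×ˢ Metric.closedBall x₀ ρ, dist a c < r →
      dist (coeffDir b σm a.1 a.2 i) (coeffDir b σm c.1 c.2 i) < η := fun i =>
    Metric.uniformContinuousOn_iff.1 (hcpt.uniformContinuousOn_of_continuous
      (h.continuous_coeffDir i).continuousOn) η hη
  choose r hr hru using huc
  have hne : (Finset.univ : Finset (Option (Fin d))).Nonempty := ⟨none, Finset.mem_univ _⟩
  refine ⟨Finset.univ.inf' hne r / 2, half_pos ((Finset.lt_inf'_iff hne).2 fun i _ => hr i),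
    fun y hy z hz hyz i => ?_⟩
  have hri : |y.fst - z.fst| < r i := by
    have h1 := Finset.inf'_le r (Finset.mem_univ i)
    have h2 := (Finset.lt_inf'_iff hne).2 fun i _ => hr i
    linarith
  have hym : y.snd ∈ Metric.closedBall x₀ ρ := by
    rw [Metric.mem_closedBall, dist_eq_norm]; exact hKx y hy
  have h1 := hru i (y.fst, y.snd) ⟨hKt y hy, hym⟩ (z.fst, y.snd) ⟨hKt z hz, hym⟩ (by
    rw [Prod.dist_eq, dist_self, Real.dist_eq]
    exact max_lt hri (hr i))
  rw [dist_eq_norm] at h1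
  have h2 := hC z.fst (hKt z hz) y.snd z.snd i
  have h3 := norm_sub_le_norm_sub_add_norm_sub (coeffDir b σm y.fst y.snd i)
    (coeffDir b σm z.fst y.snd i) (coeffDir b σm z.fst z.snd i)
  simp only at h1
  linarith

set_option maxHeartbeats 1000000 in
/-- Doubling of variables: if `u - w - R` has a strict local maximum at `(t₀, x₀)`, then `u` and
`w` admit test functions at nearby points, whose derivatives differ almost by those of `R`. -/
theorem exists_test_pair (h0 : H0 T b σm) {u w R : ℝ → Euc k → ℝ}
    (hu : Continuous fun z : ℝ × Euc k => u z.1 z.2)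
    (hw : Continuous fun z : ℝ × Euc k => w z.1 z.2)
    (hR : ContDiff ℝ 2 (Function.uncurry R)) {t₀ : ℝ} (ht₀ : t₀ ∈ Ioo 0 T) {x₀ : Euc k}
    (heq : u t₀ x₀ - w t₀ x₀ - R t₀ x₀ = 0) {κ : ℝ} (hκ : 0 < κ)
    (hmax : ∀ t ∈ Icc 0 T, ∀ x,
      u t x - w t x - R t x + κ * ((t - t₀) ^ 2 + ‖x - x₀‖ ^ 2) ≤ 0)
    {ε : ℝ} (hε : 0 < ε) :
    ∃ t₁ x₁ t₂ x₂ φ ψ, |t₁ - t₀| < ε ∧ ‖x₁ - x₀‖ < ε ∧ |t₂ - t₀| < ε ∧ ‖x₂ - x₀‖ < ε ∧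
      IsC12 φ ∧ IsLocalMax (fun z : ℝ × Euc k => u z.1 z.2 - φ z.1 z.2) (t₁, x₁) ∧
      u t₁ x₁ = φ t₁ x₁ ∧
      IsC12 ψ ∧ IsLocalMin (fun z : ℝ × Euc k => w z.1 z.2 - ψ z.1 z.2) (t₂, x₂) ∧
      w t₂ x₂ = ψ t₂ x₂ ∧
      timeDeriv φ t₁ x₁ + genL b σm φ t₁ x₁ ≤ timeDeriv ψ t₂ x₂ + genL b σm ψ t₂ x₂ +
        (timeDeriv R t₀ x₀ + genL b σm R t₀ x₀) + ε ∧
      ‖sigGrad σm φ t₁ x₁ - sigGrad σm ψ t₂ x₂‖ ≤ ‖sigGrad σm R t₀ x₀‖ + ε := by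
  have hRC := isC12_of_contDiff hR
  -- choice of the ball
  have hG := continuous_timeDeriv_add_genL h0 hRC
  have hS := (continuous_sigGrad h0 hRC).norm
  have hev : ∀ᶠ z in 𝓝 (t₀, x₀), z.1 ∈ Ioo 0 T ∧
      timeDeriv R z.1 z.2 + genL b σm R z.1 z.2 <
        timeDeriv R t₀ x₀ + genL b σm R t₀ x₀ + ε / 4 ∧
      ‖sigGrad σm R z.1 z.2‖ < ‖sigGrad σm R t₀ x₀‖ + ε / 4 := by
    have h1 := (continuous_fst.tendsto (t₀, x₀)).eventually (Ioo_mem_nhds ht₀.1 ht₀.2)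
    have h2 := (hG.tendsto (t₀, x₀)).eventually (gt_mem_nhds (lt_add_of_pos_right _
      (by linarith : 0 < ε / 4)))
    have h3 := (hS.tendsto (t₀, x₀)).eventually (gt_mem_nhds (lt_add_of_pos_right _
      (by linarith : 0 < ε / 4)))
    exact h1.and (h2.and h3)
  obtain ⟨ρ₀, hρ₀, hball⟩ := Metric.eventually_nhds_iff.1 hev
  set ρ := min (ρ₀ / 2) (ε / 2) with hρ
  have hρ0 : 0 < ρ := by positivity
  set z₀ : SpaceTime k := WithLp.toLp 2 (t₀, x₀) with hz₀
  have hz₀1 : z₀.fst = t₀ := rfl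
  have hz₀2 : z₀.snd = x₀ := rfl
  set K := Metric.closedBall z₀ ρ with hK
  have hKc : IsCompact K := isCompact_closedBall _ _
  have hKn : ∀ z ∈ K, |z.fst - t₀| ≤ ρ ∧ ‖z.snd - x₀‖ ≤ ρ := by
    intro z hz
    rw [hK, Metric.mem_closedBall, dist_eq_norm] at hz
    exact ⟨(spaceTime_abs_fst_le (z - z₀)).trans hz, (spaceTime_norm_snd_le (z - z₀)).trans hz⟩
  have hKe : ∀ z ∈ K, z.fst ∈ Ioo 0 T ∧
      timeDeriv R z.fst z.snd + genL b σm R z.fst z.snd <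
        timeDeriv R t₀ x₀ + genL b σm R t₀ x₀ + ε / 4 ∧
      ‖sigGrad σm R z.fst z.snd‖ < ‖sigGrad σm R t₀ x₀‖ + ε / 4 := by
    intro z hz
    obtain ⟨h1, h2⟩ := hKn z hz
    have h3 : ρ < ρ₀ := (min_le_left _ _).trans_lt (half_lt_self hρ₀)
    refine @hball (z.fst, z.snd) ?_
    rw [Prod.dist_eq, Real.dist_eq, dist_eq_norm]
    exact max_lt (h1.trans_lt h3) (h2.trans_lt h3)
  have hKt : ∀ z ∈ K, z.fst ∈ Icc (0 : ℝ) T := fun z hz => Ioo_subset_Icc_self (hKe z hz).1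
  have hpr : Continuous fun z : SpaceTime k => ((z.fst, z.snd) : ℝ × Euc k) :=
    (WithLp.prodContinuousLinearEquiv 2 ℝ ℝ (Euc k)).continuous
  have hu₁ : Continuous fun z : SpaceTime k => u z.fst z.snd - R z.fst z.snd :=
    (hu.sub hR.continuous).comp hpr
  have hw₁ : Continuous fun z : SpaceTime k => w z.fst z.snd := hw.comp hpr
  obtain ⟨C, hmod⟩ := h0.coeffDir_modulus hKt fun z hz => (hKn z hz).2
  have hMV : ∃ M : ℝ, 0 ≤ M ∧ ∀ z ∈ K, ∀ i, ‖coeffDir b σm z.fst z.snd i‖ ≤ M := by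
    have : ∀ i, ∃ M : ℝ, ∀ z ∈ K, ‖coeffDir b σm z.fst z.snd i‖ ≤ M := fun i =>
      hKc.exists_bound_of_continuousOn ((h0.continuous_coeffDir i).comp hpr).continuousOn
    choose M hM using this
    refine ⟨∑ i, |M i|, Finset.sum_nonneg fun i _ => abs_nonneg _, fun z hz i => ?_⟩
    exact (hM i z hz).trans ((le_abs_self _).trans
      (Finset.single_le_sum (f := fun i => |M i|) (fun i _ => abs_nonneg _) (Finset.mem_univ i)))
  obtain ⟨M, hM0, hM⟩ := hMV
  set A : ℝ := 2 * M + 1 + d + 2 * d * M ^ 2 with hA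
  have hA1 : 0 < A := by positivity
  set δ := min (min (ρ / 4) (κ * ρ ^ 2 / 16)) (ε / (4 * A)) with hδ
  have hδ0 : 0 < δ := by positivity
  have hδ1 : δ ≤ ρ / 4 := (min_le_left _ _).trans (min_le_left _ _)
  have hδ2 : δ ≤ κ * ρ ^ 2 / 16 := (min_le_left _ _).trans (min_le_right _ _)
  have hδ3 : A * δ ≤ ε / 4 := by
    have h1 : δ ≤ ε / (4 * A) := min_le_right _ _
    calc A * δ ≤ A * (ε / (4 * A)) := by gcongr
      _ = ε / 4 := by field_simp
  have hδA : 2 * δ * M + δ + d * δ / 2 + 2 * δ * d * M ^ 2 ≤ ε / 4 := by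
    have : 0 ≤ d * δ := by positivity
    rw [hA] at hδ3
    nlinarith
  obtain ⟨τ, hτ0, hτδ, α, hα0, β, hβ0, hpen⟩ := exists_penalty_weights hKc hw₁ hmod hδ0
  -- touching points
  obtain ⟨y₁, hy₁, y₂, hy₂, p₁, p₂, X₁, X₂, hτmax, hp₁, hp₂, htouch₁, htouch₂, hX⟩ :=
    exists_second_order_touching hKc ⟨z₀, Metric.mem_closedBall_self hρ0.le⟩ hu₁ hw₁.fun_neg
      (penaltyOp k α β)
      (fun x y => by
        have e : inner ℝ x (penaltyOp k α β y) = inner ℝ (penaltyOp k α β y) x :=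
          real_inner_comm _ _
        rw [e, inner_penaltyOp, inner_penaltyOp, real_inner_comm x.snd, mul_comm x.fst])
      (fun x => by rw [inner_penaltyOp_self]; positivity) hτ0
  simp only [inner_penaltyOp_self] at hτmax
  have hsum : ∀ z ∈ K, u z.fst z.snd - R z.fst z.snd - w z.fst z.snd ≤
      -(κ * ‖z - z₀‖ ^ 2) := by
    intro z hz
    have h1 := hmax z.fst (hKt z hz) z.snd
    have h2 : ‖z - z₀‖ ^ 2 = (z.fst - t₀) ^ 2 + ‖z.snd - x₀‖ ^ 2 := spaceTime_norm_sq (z - z₀)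
    rw [h2]
    linarith
  have hd1 : (y₁ - y₂).fst = y₁.fst - y₂.fst := rfl
  have hd2 : (y₁ - y₂).snd = y₁.snd - y₂.snd := rfl
  have hz₀K : z₀ ∈ K := Metric.mem_closedBall_self hρ0.le
  rw [hd1, hd2] at hτmax
  obtain ⟨hQδ, hwδ, hyδ, hVδ⟩ := hpen y₁ hy₁ y₂ hy₂ (by
    have := hτmax y₁ hy₁ y₁ hy₁
    simp only [sub_self, WithLp.zero_fst, WithLp.zero_snd, norm_zero] at this
    linarith)
  have hy₁ρ : ‖y₁ - z₀‖ < ρ / 2 := by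
    have h1 := hτmax z₀ hz₀K z₀ hz₀K
    simp only [sub_self, WithLp.zero_fst, WithLp.zero_snd, norm_zero] at h1
    rw [hz₀1, hz₀2] at h1
    have h2 := hsum y₁ hy₁
    have h3 : 0 ≤ β * (y₁.fst - y₂.fst) ^ 2 := by positivity
    have h4 : 0 ≤ α * ‖y₁.snd - y₂.snd‖ ^ 2 := by positivity
    have h5 : κ * ‖y₁ - z₀‖ ^ 2 ≤ 2 * δ := by
      have := neg_abs_le (w y₂.fst y₂.snd - w y₁.fst y₁.snd)
      linarith
    have h6 : ‖y₁ - z₀‖ ^ 2 ≤ ρ ^ 2 / 8 := by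
      refine le_of_mul_le_mul_left ?_ hκ
      linarith
    refine lt_of_pow_lt_pow_left₀ 2 (by positivity) ?_
    nlinarith [sq_pos_of_pos hρ0]
  have hy₂ρ : ‖y₂ - z₀‖ < ρ := by
    have h1 := norm_sub_le_norm_sub_add_norm_sub y₂ y₁ z₀
    rw [norm_sub_rev y₂ y₁] at h1
    linarith
  have hnear : ∀ y : SpaceTime k, ‖y - z₀‖ < ρ → ∀ᶠ h in 𝓝 (0 : SpaceTime k), y + h ∈ K := by
    intro y hy
    have h1 : Tendsto (fun h => y + h) (𝓝 (0 : SpaceTime k)) (𝓝 y) := by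
      have : Continuous fun h : SpaceTime k => y + h := by fun_prop
      have h2 := this.tendsto 0
      rwa [add_zero] at h2
    refine h1.eventually (Metric.closedBall_mem_nhds_of_mem ?_)
    rwa [Metric.mem_ball, dist_eq_norm]
  obtain ⟨φ, hφ, hφmax, hφeq, hφd, hφs⟩ := exists_test_of_second_order_touching p₁
    (shiftOp X₁ δ) y₁.fst y₁.snd b σm (v := u) hR (by
      filter_upwards [htouch₁ δ hδ0, hnear y₁ (by linarith)] with h hh hK'
      have := hh hK'
      rw [inner_shiftOp]
      simp only [WithLp.add_fst, WithLp.add_snd] at this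
      linarith)
  obtain ⟨ψ, hψ, hψmax, hψeq, hψd, hψs⟩ := exists_test_of_second_order_touching p₂
    (shiftOp X₂ δ) y₂.fst y₂.snd b σm
    (v := fun t x => -w t x) (R := fun _ _ => 0) contDiff_const (by
      filter_upwards [htouch₂ δ hδ0, hnear y₂ hy₂ρ] with h hh hK'
      have := hh hK'
      rw [inner_shiftOp]
      simp only [WithLp.add_fst, WithLp.add_snd] at this
      linarith)
  have hz1 : timeDeriv (fun _ _ => 0 : ℝ → Euc k → ℝ) y₂.fst y₂.snd = 0 := by simp [timeDeriv]
  have hz2 : genL b σm (fun _ _ => 0 : ℝ → Euc k → ℝ) y₂.fst y₂.snd = 0 := by simp [genL, pd]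
  have hz3 : sigGrad σm (fun _ _ => 0 : ℝ → Euc k → ℝ) y₂.fst y₂.snd = 0 := by
    ext l; simp [sigGrad, pd]
  rw [hz1, hz2, zero_add, zero_add] at hψd
  rw [hz3, zero_add] at hψs
  -- first order errors
  have hρε : ρ < ε := (min_le_right _ _).trans_lt (half_lt_self hε)
  have hpV : ∀ i, |inner ℝ p₁ (coeffDir b σm y₁.fst y₁.snd i) +
      inner ℝ p₂ (coeffDir b σm y₂.fst y₂.snd i)| ≤ 2 * δ * M + δ := by
    intro i
    exact abs_inner_add_inner_le (y := y₁ - y₂) hδ0.le hα0 hβ0 (coeffDir_sub_fst _ _ _ _ _)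
      hQδ (hVδ i)
      (hM y₁ hy₁ i) (hM y₂ hy₂ i) (hp₁.trans hτδ) (hp₂.trans hτδ)
  have hXV := sum_inner_shiftOp_le (V₁ := noiseDir σm y₁.fst y₁.snd)
    (V₂ := noiseDir σm y₂.fst y₂.snd) hδ0.le hα0 hX
    (fun l => coeffDir_sub_fst (b := b) _ _ _ _ (some l)) (fun l => hVδ (some l))
    (fun l => hM y₁ hy₁ (some l)) (fun l => hM y₂ hy₂ (some l))
  have hzρ : ∀ y ∈ K, |y.fst - t₀| < ε ∧ ‖y.snd - x₀‖ < ε := fun y hy =>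
    ⟨(hKn y hy).1.trans_lt hρε, (hKn y hy).2.trans_lt hρε⟩
  have hMd : 0 ≤ 2 * δ * d * M ^ 2 := by positivity
  have hdδ : 0 ≤ d * δ / 2 := by positivity
  refine ⟨y₁.fst, y₁.snd, y₂.fst, y₂.snd, φ, fun s y => -ψ s y, (hzρ y₁ hy₁).1, (hzρ y₁ hy₁).2,
    (hzρ y₂ hy₂).1, (hzρ y₂ hy₂).2, hφ, hφmax, hφeq, hψ.neg, ?_, by linarith, ?_, ?_⟩
  · have h1 := hψmax.neg
    refine h1.mono fun z hz => ?_
    simp only [neg_le_neg_iff] at hz ⊢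
    linarith
  · rw [timeDeriv_neg, genL_neg, hφd]
    have h1 := (hKe y₁ hy₁).2.1
    have h2 : |inner ℝ p₁ (driftDir b y₁.fst y₁.snd) + inner ℝ p₂ (driftDir b y₂.fst y₂.snd)| ≤
      2 * δ * M + δ := hpV none
    have h3 := (abs_le.1 h2).2
    linarith
  · rw [sigGrad_neg, hφs, hψs]
    refine (pi_norm_le_iff_of_nonneg (by positivity)).2 fun l => ?_
    have h1 := (hKe y₁ hy₁).2.2
    have h2 : |inner ℝ p₁ (noiseDir σm y₁.fst y₁.snd l) +
      inner ℝ p₂ (noiseDir σm y₂.fst y₂.snd l)| ≤ 2 * δ * M + δ := hpV (some l)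
    have h3 := norm_le_pi_norm (sigGrad σm R y₁.fst y₁.snd) l
    rw [Real.norm_eq_abs] at h3 ⊢
    simp only [Pi.add_apply, Pi.sub_apply, Pi.neg_apply, sub_neg_eq_add, add_assoc]
    refine (abs_add_le _ _).trans ?_
    linarith

end TestPair

section MaxPoint

open Filter Topology

variable {k d : ℕ} {T : ℝ} {b : ℝ → Euc k → Fin k → ℝ}
  {σm : ℝ → Euc k → Matrix (Fin k) (Fin d) ℝ}

/-- Variant of `exists_test_pair` for a maximum that need not be strict. -/
theorem exists_test_pair_of_max (h0 : H0 T b σm) {u w P : ℝ → Euc k → ℝ}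
    (hu : Continuous fun z : ℝ × Euc k => u z.1 z.2)
    (hw : Continuous fun z : ℝ × Euc k => w z.1 z.2)
    (hP : ContDiff ℝ 2 (Function.uncurry P)) {t₀ : ℝ} (ht₀ : t₀ ∈ Ioo 0 T) {x₀ : Euc k}
    (heq : u t₀ x₀ - w t₀ x₀ - P t₀ x₀ = 0)
    (hmax : ∀ t ∈ Icc 0 T, ∀ x, u t x - w t x - P t x ≤ 0)
    {ε : ℝ} (hε : 0 < ε) :
    ∃ t₁ x₁ t₂ x₂ φ ψ, |t₁ - t₀| < ε ∧ ‖x₁ - x₀‖ < ε ∧ |t₂ - t₀| < ε ∧ ‖x₂ - x₀‖ < ε ∧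
      IsC12 φ ∧ IsLocalMax (fun z : ℝ × Euc k => u z.1 z.2 - φ z.1 z.2) (t₁, x₁) ∧
      u t₁ x₁ = φ t₁ x₁ ∧
      IsC12 ψ ∧ IsLocalMin (fun z : ℝ × Euc k => w z.1 z.2 - ψ z.1 z.2) (t₂, x₂) ∧
      w t₂ x₂ = ψ t₂ x₂ ∧
      timeDeriv φ t₁ x₁ + genL b σm φ t₁ x₁ ≤ timeDeriv ψ t₂ x₂ + genL b σm ψ t₂ x₂ +
        (timeDeriv P t₀ x₀ + genL b σm P t₀ x₀) + ε ∧
      ‖sigGrad σm φ t₁ x₁ - sigGrad σm ψ t₂ x₂‖ ≤ ‖sigGrad σm P t₀ x₀‖ + ε := by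
  set N := ∑ l, ‖noiseDir σm t₀ x₀ l‖ ^ 2 with hN
  have hN0 : 0 ≤ N := Finset.sum_nonneg fun l _ => sq_nonneg _
  set κ := ε / (2 * (1 + N)) with hκ
  have hκ0 : 0 < κ := by positivity
  have hκN : κ * N ≤ ε / 2 := by
    have : κ * (1 + N) = ε / 2 := by rw [hκ]; field_simp
    nlinarith
  set X : SpaceTime k →L[ℝ] SpaceTime k := (2 * κ) • ContinuousLinearMap.id ℝ (SpaceTime k)
  set q := quadTest 0 0 X t₀ x₀ with hq
  have hXi : ∀ h : SpaceTime k, inner ℝ (X h) h = 2 * κ * ‖h‖ ^ 2 := by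
    intro h
    simp [X, inner_smul_left]
  have hqv : ∀ t x, q t x = κ * ((t - t₀) ^ 2 + ‖x - x₀‖ ^ 2) := by
    intro t x
    have h1 : ‖(WithLp.toLp 2 (t - t₀, x - x₀) : SpaceTime k)‖ ^ 2 =
      (t - t₀) ^ 2 + ‖x - x₀‖ ^ 2 := spaceTime_norm_sq _
    simp only [hq, quadTest, hXi, h1, inner_zero_left]
    ring
  have hqC : ContDiff ℝ 2 (Function.uncurry q) := contDiff_quadTest _ _ _ _ _
  obtain ⟨hP1, -, hP2, -, -⟩ := isC12_of_contDiff hP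
  obtain ⟨hq1, -, hq2, -, -⟩ := isC12_of_contDiff hqC
  have hd : timeDeriv (fun s y => P s y + q s y) t₀ x₀ +
      genL b σm (fun s y => P s y + q s y) t₀ x₀ =
      timeDeriv P t₀ x₀ + genL b σm P t₀ x₀ + κ * N := by
    have h1 := genL_quadTest 0 0 X t₀ x₀ b σm
    simp only [hXi, inner_zero_left, ← Finset.mul_sum] at h1
    rw [timeDeriv_add (hP1 x₀ t₀) (hq1 x₀ t₀), genL_add b σm (hP2 t₀) (hq2 t₀)]
    linarith
  have hs : sigGrad σm (fun s y => P s y + q s y) t₀ x₀ = sigGrad σm P t₀ x₀ := by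
    rw [sigGrad_add σm ((hP2 t₀).differentiable (by norm_num) x₀)
      ((hq2 t₀).differentiable (by norm_num) x₀)]
    have : sigGrad σm q t₀ x₀ = 0 := by
      ext l
      rw [hq, sigGrad_quadTest, inner_zero_left]
      rfl
    rw [this, add_zero]
  obtain ⟨t₁, x₁, t₂, x₂, φ, ψ, h1, h2, h3, h4, h5, h6, h7, h8, h9, h10, h11, h12⟩ :=
    exists_test_pair h0 hu hw (R := fun s y => P s y + q s y) (hP.add hqC) ht₀ (x₀ := x₀)
      (by rw [hqv, sub_self, sub_self, norm_zero]; linarith) hκ0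
      (fun t ht x => by rw [hqv]; linarith [hmax t ht x]) (half_pos hε)
  rw [hd] at h11
  rw [hs] at h12
  exact ⟨t₁, x₁, t₂, x₂, φ, ψ, by linarith, by linarith, by linarith, by linarith, h5, h6, h7, h8,
    h9, h10, by linarith, by linarith⟩

/-- The viscosity inequality at a maximum point of `u^{ij} - w^{ij} - P`. -/
theorem nonneg_of_max (h0 : H0 T b σm) {Γ : Type} [Fintype Γ] {u w : Γ → ℝ → Euc k → ℝ}
    {P : ℝ → Euc k → ℝ}
    (hu : ∀ a, Continuous fun z : ℝ × Euc k => u a z.1 z.2)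
    (hw : ∀ a, Continuous fun z : ℝ × Euc k => w a z.1 z.2)
    (hP : ContDiff ℝ 2 (Function.uncurry P)) {t₀ : ℝ} (ht₀ : t₀ ∈ Ioo 0 T) {x₀ : Euc k} (a : Γ)
    (heq : u a t₀ x₀ - w a t₀ x₀ - P t₀ x₀ = 0)
    (hmax : ∀ t ∈ Icc 0 T, ∀ x, u a t x - w a t x - P t x ≤ 0)
    (hle : ∀ c, u c t₀ x₀ ≤ w c t₀ x₀ + P t₀ x₀) (hP0 : 0 ≤ P t₀ x₀)
    {g : ℝ → Euc k → (Γ → ℝ) → (Fin d → ℝ) → ℝ} {C : ℝ} (hC : 0 ≤ C)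
    (hgc : ∀ ε > 0, ∃ η > 0, ∀ t' ∈ Icc 0 T, ∀ x', |t' - t₀| + ‖x' - x₀‖ < η →
      ∀ y z, |g t' x' y z - g t₀ x₀ y z| < ε)
    (hgl : ∀ y y' z z', |g t₀ x₀ y z - g t₀ x₀ y' z'| ≤ C * (‖y - y'‖ + ‖z - z'‖))
    (hgm : ∀ y y' z, (∀ c, y c ≤ y' c) → y a = y' a → g t₀ x₀ y z ≤ g t₀ x₀ y' z)
    (hsub : ∀ᶠ p in 𝓝 (t₀, x₀), ∀ φ, IsC12 φ →
      IsLocalMax (fun z : ℝ × Euc k => u a z.1 z.2 - φ z.1 z.2) p → u a p.1 p.2 = φ p.1 p.2 →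
      0 ≤ timeDeriv φ p.1 p.2 + genL b σm φ p.1 p.2 +
        g p.1 p.2 (fun c => u c p.1 p.2) (sigGrad σm φ p.1 p.2))
    (hsup : ∀ᶠ p in 𝓝 (t₀, x₀), ∀ φ, IsC12 φ →
      IsLocalMin (fun z : ℝ × Euc k => w a z.1 z.2 - φ z.1 z.2) p → w a p.1 p.2 = φ p.1 p.2 →
      timeDeriv φ p.1 p.2 + genL b σm φ p.1 p.2 +
        g p.1 p.2 (fun c => w c p.1 p.2) (sigGrad σm φ p.1 p.2) ≤ 0) :
    0 ≤ timeDeriv P t₀ x₀ + genL b σm P t₀ x₀ + C * (P t₀ x₀ + ‖sigGrad σm P t₀ x₀‖) := by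
  refine le_of_forall_pos_le_add fun e he => ?_
  set ε := e / (3 + 3 * C) with hε
  have hε0 : 0 < ε := by positivity
  have hεe : 3 * ε + 3 * C * ε = e := by rw [hε]; field_simp
  have huc : Continuous fun z : ℝ × Euc k => fun c => u c z.1 z.2 := continuous_pi hu
  have hwc : Continuous fun z : ℝ × Euc k => fun c => w c z.1 z.2 := continuous_pi hw
  have hu1 := (huc.tendsto (t₀, x₀)).eventually (Metric.ball_mem_nhds _ hε0)
  have hw1 := (hwc.tendsto (t₀, x₀)).eventually (Metric.ball_mem_nhds _ hε0)
  have ht1 := (continuous_fst.tendsto (t₀, x₀)).eventually (Icc_mem_nhds ht₀.1 ht₀.2)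
  obtain ⟨η, hη, hgη⟩ := hgc ε hε0
  obtain ⟨r, hr, hball⟩ := Metric.eventually_nhds_iff.1
    (hu1.and (hw1.and (ht1.and (hsub.and hsup))))
  set δ := min (min (r / 2) (η / 4)) ε with hδ
  have hδ0 : 0 < δ := by positivity
  have hδ1 : δ < r := ((min_le_left _ _).trans (min_le_left _ _)).trans_lt (half_lt_self hr)
  have hδ2 : δ ≤ η / 4 := (min_le_left _ _).trans (min_le_right _ _)
  have hδ3 : δ ≤ ε := min_le_right _ _
  obtain ⟨t₁, x₁, t₂, x₂, φ, ψ, h1, h2, h3, h4, h5, h6, h7, h8, h9, h10, h11, h12⟩ :=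
    exists_test_pair_of_max h0 (hu a) (hw a) hP ht₀ heq hmax hδ0
  have hnear : ∀ t x, |t - t₀| < δ → ‖x - x₀‖ < δ → dist (t, x) (t₀, x₀) < r := by
    intro t x ht hx
    rw [Prod.dist_eq, Real.dist_eq, dist_eq_norm]
    exact max_lt (ht.trans hδ1) (hx.trans hδ1)
  obtain ⟨hu1', -, ht1', hsub', -⟩ := hball (hnear t₁ x₁ h1 h2)
  obtain ⟨-, hw1', ht2', -, hsup'⟩ := hball (hnear t₂ x₂ h3 h4)
  have e1 := hsub' φ h5 h6 h7
  have e2 := hsup' ψ h8 h9 h10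
  simp only at e1 e2
  have e3 := hgη t₁ ht1' x₁ (by linarith) (fun c => u c t₁ x₁) (sigGrad σm φ t₁ x₁)
  have e4 := hgη t₂ ht2' x₂ (by linarith) (fun c => w c t₂ x₂) (sigGrad σm ψ t₂ x₂)
  have e5 := hgl (fun c => u c t₁ x₁) (fun c => u c t₀ x₀) (sigGrad σm φ t₁ x₁)
    (sigGrad σm φ t₁ x₁)
  have e6 := hgl (fun c => w c t₂ x₂) (fun c => w c t₀ x₀) (sigGrad σm ψ t₂ x₂)
    (sigGrad σm ψ t₂ x₂)
  have e7 := hgm (fun c => u c t₀ x₀) (fun c => w c t₀ x₀ + P t₀ x₀) (sigGrad σm φ t₁ x₁) hle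
    (by linarith)
  have e8 := hgl (fun c => w c t₀ x₀ + P t₀ x₀) (fun c => w c t₀ x₀) (sigGrad σm φ t₁ x₁)
    (sigGrad σm ψ t₂ x₂)
  rw [sub_self, norm_zero, add_zero] at e5 e6
  rw [dist_eq_norm] at hu1' hw1'
  have e9 : ‖(fun c => w c t₀ x₀ + P t₀ x₀) - (fun c => w c t₀ x₀)‖ ≤ P t₀ x₀ := by
    refine (pi_norm_le_iff_of_nonneg hP0).2 fun c => ?_
    rw [Pi.sub_apply, add_sub_cancel_left, Real.norm_eq_abs, abs_of_nonneg hP0]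
  have f5 := mul_le_mul_of_nonneg_left hu1'.le hC
  have f6 := mul_le_mul_of_nonneg_left hw1'.le hC
  have f8 := mul_le_mul_of_nonneg_left (add_le_add e9 (h12.trans
    (add_le_add_right hδ3 _))) hC
  have g3 := (abs_lt.1 e3).2
  have g4 := (abs_lt.1 e4).1
  have g5 := (abs_le.1 e5).2
  have g6 := (abs_le.1 e6).1
  have g8 := (abs_le.1 e8).2
  simp only at f5 f6
  nlinarith

end MaxPoint

section Barrier

open Filter Topology

variable {k d : ℕ} {T : ℝ} {b : ℝ → Euc k → Fin k → ℝ}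
  {σm : ℝ → Euc k → Matrix (Fin k) (Fin d) ℝ}

/-- The polynomial weight `(1 + |x|²)^n`. -/
def weight {k : ℕ} (n : ℕ) (x : Euc k) : ℝ := (1 + ‖x‖ ^ 2) ^ n

theorem weight_pos (n : ℕ) (x : Euc k) : 0 < weight n x := by unfold weight; positivity

theorem contDiff_weight (n : ℕ) : ContDiff ℝ 2 (weight n : Euc k → ℝ) :=
  (contDiff_const.add (contDiff_norm_sq ℝ)).pow n

theorem abs_coord_le (x : Euc k) (i : Fin k) : |x i| ≤ ‖x‖ := by
  simpa using PiLp.norm_apply_le x i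

theorem hasFDerivAt_weight (n : ℕ) (x : Euc k) :
    HasFDerivAt (weight (n + 1) : Euc k → ℝ)
      ((2 * (n + 1) * weight n x) • innerSL ℝ x) x := by
  have h1 : HasFDerivAt (fun y : Euc k => 1 + ‖y‖ ^ 2) (2 • innerSL ℝ x) x :=
    (hasStrictFDerivAt_norm_sq x).hasFDerivAt.const_add 1
  have h2 := (hasDerivAt_pow (n + 1) (1 + ‖x‖ ^ 2)).comp_hasFDerivAt x h1
  refine h2.congr_fderiv ?_
  ext y
  simp [weight]
  ring

theorem pd_weight (n : ℕ) (i : Fin k) (x : Euc k) :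
    pd i (weight (n + 1)) x = 2 * (n + 1) * weight n x * x i := by
  rw [pd, (hasFDerivAt_weight n x).fderiv]
  simp [EuclideanSpace.inner_single_right]

theorem pd_pd_weight (n : ℕ) (i j : Fin k) (x : Euc k) :
    pd i (fun y => pd j (weight (n + 2)) y) x =
      2 * (n + 2) * (2 * (n + 1) * weight n x * x i * x j +
        weight (n + 1) x * if i = j then 1 else 0) := by
  have h1 : (fun y : Euc k => pd j (weight (n + 2)) y) =
      fun y => 2 * (n + 2) * (weight (n + 1) y * y j) := by
    ext1 y
    rw [pd_weight (n + 1)]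
    push_cast
    ring
  have h2 : HasFDerivAt (fun y : Euc k => y j) (EuclideanSpace.proj j : Euc k →L[ℝ] ℝ) x :=
    (EuclideanSpace.proj j : Euc k →L[ℝ] ℝ).hasFDerivAt
  have h3 := ((hasFDerivAt_weight n x).fun_mul h2).const_mul (2 * ((n : ℝ) + 2))
  rw [h1, pd, h3.fderiv]
  by_cases hij : i = j
  · subst hij
    simp [EuclideanSpace.inner_single_right]
    ring
  · simp [hij, Ne.symm hij, EuclideanSpace.inner_single_right]
    left
    ring

theorem H0.exists_linear_growth (h : H0 T b σm) :
    ∃ c : ℝ, 0 ≤ c ∧ ∀ t ∈ Icc (0 : ℝ) T, ∀ x : Euc k,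
      (∀ i, |b t x i| ≤ c * (1 + ‖x‖)) ∧ ∀ i l, |σm t x i l| ≤ c * (1 + ‖x‖) := by
  obtain ⟨hb, hσ, C, hC⟩ := h
  have hp : Continuous fun t : ℝ => (t, (0 : Euc k)) := by fun_prop
  have h1 : ∀ i, ∃ M : ℝ, ∀ t ∈ Icc (0 : ℝ) T, ‖b t 0 i‖ ≤ M := fun i =>
    isCompact_Icc.exists_bound_of_continuousOn
      ((continuous_apply i).comp (hb.comp hp)).continuousOn
  have h2 : ∀ q : Fin k × Fin d, ∃ M : ℝ, ∀ t ∈ Icc (0 : ℝ) T, ‖σm t 0 q.1 q.2‖ ≤ M := fun q =>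
    isCompact_Icc.exists_bound_of_continuousOn
      (Continuous.matrix_elem (hσ.comp hp) q.1 q.2).continuousOn
  choose M hM using h1
  choose N hN using h2
  have hMs : ∀ i, M i ≤ ∑ i, |M i| := fun i => (le_abs_self _).trans
    (Finset.single_le_sum (f := fun i => |M i|) (fun i _ => abs_nonneg _) (Finset.mem_univ i))
  have hNs : ∀ i, N i ≤ ∑ i, |N i| := fun i => (le_abs_self _).trans
    (Finset.single_le_sum (f := fun i => |N i|) (fun i _ => abs_nonneg _) (Finset.mem_univ i))
  have hM0 : 0 ≤ ∑ i, |M i| := Finset.sum_nonneg fun i _ => abs_nonneg _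
  have hN0 : 0 ≤ ∑ i, |N i| := Finset.sum_nonneg fun i _ => abs_nonneg _
  have key : ∀ a a' x : ℝ, 0 ≤ x → |a - a'| ≤ C * x →
      |a'| ≤ (∑ i, |M i|) + ∑ i, |N i| →
      |a| ≤ ((∑ i, |M i|) + (∑ i, |N i|) + |C|) * (1 + x) := by
    intro a a' x hx h3 h4
    have h5 := abs_add_le (a - a') a'
    rw [sub_add_cancel] at h5
    have h6 : C * x ≤ |C| * x := mul_le_mul_of_nonneg_right (le_abs_self C) hx
    have h7 : 0 ≤ ((∑ i, |M i|) + ∑ i, |N i|) * x := by positivity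
    nlinarith [abs_nonneg C]
  refine ⟨(∑ i, |M i|) + (∑ i, |N i|) + |C|, by positivity, fun t ht x => ⟨fun i => ?_,
    fun i l => ?_⟩⟩
  · refine key _ (b t 0 i) _ (norm_nonneg x) ?_ ?_
    · simpa using (hC t ht x 0).1 i
    · have := hM i t ht
      rw [Real.norm_eq_abs] at this
      linarith [hMs i]
  · refine key _ (σm t 0 i l) _ (norm_nonneg x) ?_ ?_
    · simpa using (hC t ht x 0).2 i l
    · have := hN (i, l) t ht
      rw [Real.norm_eq_abs] at this
      linarith [hNs (i, l)]

/-- The generator and the diffusion gradient of the weight are controlled by the weight. -/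
theorem H0.exists_weight_bound (h : H0 T b σm) (n : ℕ) :
    ∃ A : ℝ, 0 ≤ A ∧ ∀ t ∈ Icc (0 : ℝ) T, ∀ x : Euc k,
      genL b σm (fun _ => weight (n + 2)) t x ≤ A * weight (n + 2) x ∧
      ‖sigGrad σm (fun _ => weight (n + 2)) t x‖ ≤ A * weight (n + 2) x := by
  obtain ⟨c, hc, hbσ⟩ := h.exists_linear_growth
  set B : ℝ := 2 * (n + 2) * (2 * (n + 1) + 1) with hB
  have hB0 : 0 ≤ B := by positivity
  have hB2 : 2 * ((n : ℝ) + 2) ≤ B := by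
    rw [hB]
    have : (0 : ℝ) ≤ n := by positivity
    nlinarith
  refine ⟨k * k * d * c ^ 2 * B + 2 * k * c * B + 2 * k * c * B, by positivity,
    fun t ht x => ?_⟩
  obtain ⟨hb, hσ⟩ := hbσ t ht x
  have hr : (1 + ‖x‖) ^ 2 ≤ 2 * (1 + ‖x‖ ^ 2) := by nlinarith [sq_nonneg (‖x‖ - 1)]
  have hw0 := weight_pos n x
  have hw1 := weight_pos (n + 1) x
  have hw2 := weight_pos (n + 2) x
  have hws : weight (n + 1) x = weight n x * (1 + ‖x‖ ^ 2) := pow_succ _ _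
  have hws' : weight (n + 2) x = weight (n + 1) x * (1 + ‖x‖ ^ 2) := pow_succ _ _
  have hwr : weight (n + 1) x * (1 + ‖x‖) ^ 2 ≤ 2 * weight (n + 2) x := by
    rw [hws']; nlinarith
  have hx0 := norm_nonneg x
  have hpd : ∀ i, |pd i (weight (n + 2)) x| ≤ B * weight (n + 1) x * (1 + ‖x‖) := by
    intro i
    rw [pd_weight (n + 1), abs_mul]
    have h1 := abs_coord_le x i
    push_cast
    rw [abs_of_nonneg (by positivity)]
    have : 2 * ((n : ℝ) + 1 + 1) ≤ B := by linarith
    gcongr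
    linarith
  have hpd2 : ∀ i j, |pd i (fun y => pd j (weight (n + 2)) y) x| ≤ B * weight (n + 1) x := by
    intro i j
    have h1 : |2 * ((n : ℝ) + 1) * weight n x * x i * x j| ≤ 2 * (n + 1) * weight (n + 1) x := by
      rw [abs_mul, abs_mul, abs_of_nonneg (a := 2 * ((n : ℝ) + 1) * weight n x) (by positivity),
        hws]
      have h5 : |x i| * |x j| ≤ 1 + ‖x‖ ^ 2 := by
        have := mul_le_mul (abs_coord_le x i) (abs_coord_le x j) (abs_nonneg _) hx0
        nlinarith
      calc 2 * ((n : ℝ) + 1) * weight n x * |x i| * |x j|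
          = 2 * ((n : ℝ) + 1) * weight n x * (|x i| * |x j|) := by ring
        _ ≤ 2 * ((n : ℝ) + 1) * weight n x * (1 + ‖x‖ ^ 2) := by gcongr
        _ = _ := by ring
    have h2 : |weight (n + 1) x * if i = j then (1 : ℝ) else 0| ≤ weight (n + 1) x := by
      split_ifs
      · rw [mul_one, abs_of_pos hw1]
      · rw [mul_zero, abs_zero]; exact hw1.le
    have h3 : |2 * ((n : ℝ) + 1) * weight n x * x i * x j +
        weight (n + 1) x * if i = j then (1 : ℝ) else 0| ≤
        (2 * (n + 1) + 1) * weight (n + 1) x := by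
      refine (abs_add_le _ _).trans ?_
      linarith
    rw [pd_pd_weight, abs_mul, abs_of_nonneg (a := 2 * ((n : ℝ) + 2)) (by positivity), hB,
      mul_assoc (2 * ((n : ℝ) + 2))]
    exact mul_le_mul_of_nonneg_left h3 (by positivity)
  have hfst : ∀ a : ℝ, |a| ≤ c * (1 + ‖x‖) → ∀ i,
      |a * pd i (weight (n + 2)) x| ≤ 2 * c * B * weight (n + 2) x := by
    intro a ha i
    rw [abs_mul]
    calc |a| * |pd i (weight (n + 2)) x|
        ≤ c * (1 + ‖x‖) * (B * weight (n + 1) x * (1 + ‖x‖)) := by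
          gcongr; exact hpd i
      _ = c * B * (weight (n + 1) x * (1 + ‖x‖) ^ 2) := by ring
      _ ≤ c * B * (2 * weight (n + 2) x) := by gcongr
      _ = _ := by ring
  have hkk : 0 ≤ k * k * d * c ^ 2 * B * weight (n + 2) x := by positivity
  have hkc : 0 ≤ 2 * k * c * B * weight (n + 2) x := by positivity
  constructor
  · have h1 : ∑ i, ∑ j, (σm t x * (σm t x)ᵀ) i j * pd i (fun y => pd j (weight (n + 2)) y) x ≤
        2 * (k * k * d * c ^ 2 * B * weight (n + 2) x) := by
      have : ∀ i j, (σm t x * (σm t x)ᵀ) i j * pd i (fun y => pd j (weight (n + 2)) y) x ≤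
          2 * (d * c ^ 2 * B * weight (n + 2) x) := by
        intro i j
        have h2 : |(σm t x * (σm t x)ᵀ) i j| ≤ d * (c * (1 + ‖x‖)) ^ 2 := by
          rw [Matrix.mul_apply]
          refine (Finset.abs_sum_le_sum_abs _ _).trans ((Finset.sum_le_sum
            (g := fun _ => (c * (1 + ‖x‖)) ^ 2) fun l _ => ?_).trans (le_of_eq ?_))
          · rw [abs_mul, sq, Matrix.transpose_apply]
            exact mul_le_mul (hσ i l) (hσ j l) (abs_nonneg _) (by positivity)
          · rw [Finset.sum_const, Finset.card_univ, Fintype.card_fin, nsmul_eq_mul]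
        refine (le_abs_self _).trans ?_
        rw [abs_mul]
        calc |(σm t x * (σm t x)ᵀ) i j| * |pd i (fun y => pd j (weight (n + 2)) y) x|
            ≤ d * (c * (1 + ‖x‖)) ^ 2 * (B * weight (n + 1) x) := by
              gcongr; exact hpd2 i j
          _ = d * c ^ 2 * B * (weight (n + 1) x * (1 + ‖x‖) ^ 2) := by ring
          _ ≤ d * c ^ 2 * B * (2 * weight (n + 2) x) := by gcongr
          _ = _ := by ring
      refine (Finset.sum_le_sum fun i _ => Finset.sum_le_sum fun j _ => this i j).trans
        (le_of_eq ?_)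
      simp only [Finset.sum_const, Finset.card_univ, Fintype.card_fin, nsmul_eq_mul]
      ring
    have h3 : ∑ i, b t x i * pd i (weight (n + 2)) x ≤ 2 * k * c * B * weight (n + 2) x := by
      refine (Finset.sum_le_sum fun i _ => (le_abs_self _).trans (hfst _ (hb i) i)).trans
        (le_of_eq ?_)
      simp only [Finset.sum_const, Finset.card_univ, Fintype.card_fin, nsmul_eq_mul]
      ring
    simp only [genL]
    linarith
  · refine (pi_norm_le_iff_of_nonneg (by positivity)).2 fun l => ?_
    rw [Real.norm_eq_abs, sigGrad]
    have h3 : |∑ i, σm t x i l * pd i (weight (n + 2)) x| ≤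
        2 * k * c * B * weight (n + 2) x := by
      refine (Finset.abs_sum_le_sum_abs _ _).trans
        ((Finset.sum_le_sum fun i _ => hfst _ (hσ i l) i).trans (le_of_eq ?_))
      simp only [Finset.sum_const, Finset.card_univ, Fintype.card_fin, nsmul_eq_mul]
      ring
    linarith

/-- The barrier used in the comparison argument. -/
def barrier {k : ℕ} (n : ℕ) (lam θ S c N s t : ℝ) (x : Euc k) : ℝ :=
  Real.exp (-lam * t) * θ * weight n x +
    (Real.exp (-lam * t) * S + c * Real.exp (N * (s - t)))

theorem contDiff_barrier (n : ℕ) (lam θ S c N s : ℝ) :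
    ContDiff ℝ 2 (Function.uncurry (barrier (k := k) n lam θ S c N s)) := by
  have h1 : ContDiff ℝ 2 fun z : ℝ × Euc k => weight n z.2 :=
    (contDiff_weight n).comp contDiff_snd
  have h2 : ContDiff ℝ 2 fun z : ℝ × Euc k => Real.exp (-lam * z.1) :=
    (contDiff_const.mul contDiff_fst).exp
  have h3 : ContDiff ℝ 2 fun z : ℝ × Euc k => Real.exp (N * (s - z.1)) :=
    (contDiff_const.mul (contDiff_const.sub contDiff_fst)).exp
  exact ((h2.mul contDiff_const).mul h1).add
    ((h2.mul contDiff_const).add (contDiff_const.mul h3))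

theorem timeDeriv_barrier (n : ℕ) (lam θ S c N s t : ℝ) (x : Euc k) :
    timeDeriv (barrier n lam θ S c N s) t x =
      -lam * (Real.exp (-lam * t) * (θ * weight n x + S)) - N * (c * Real.exp (N * (s - t))) := by
  have h1 : HasDerivAt (fun t => Real.exp (-lam * t)) (Real.exp (-lam * t) * (-lam * 1)) t :=
    ((hasDerivAt_id t).const_mul (-lam)).exp
  have h2 : HasDerivAt (fun t => Real.exp (N * (s - t))) (Real.exp (N * (s - t)) * (N * -1)) t :=
    (((hasDerivAt_id t).const_sub s).const_mul N).exp
  have h3 := ((h1.mul_const θ).mul_const (weight n x)).fun_add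
    ((h1.mul_const S).fun_add (h2.const_mul c))
  refine h3.deriv.trans ?_
  ring

theorem pd_const_mul_add_const (i : Fin k) {ψ : Euc k → ℝ} {x : Euc k}
    (h : DifferentiableAt ℝ ψ x) (a e : ℝ) : pd i (fun y => a * ψ y + e) x = a * pd i ψ x := by
  simp only [pd]
  rw [((h.hasFDerivAt.const_mul a).add_const e).fderiv]
  rfl

theorem pd_barrier (n : ℕ) (lam θ S c N s t : ℝ) (i : Fin k) (x : Euc k) :
    pd i (barrier n lam θ S c N s t) x = Real.exp (-lam * t) * θ * pd i (weight n) x :=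
  pd_const_mul_add_const i ((contDiff_weight n).differentiable (by norm_num) x) _ _

theorem sigGrad_barrier (n : ℕ) (lam θ S c N s t : ℝ) (x : Euc k) :
    sigGrad σm (barrier n lam θ S c N s) t x =
      (Real.exp (-lam * t) * θ) • sigGrad σm (fun _ => weight n) t x := by
  ext l
  simp only [sigGrad, pd_barrier, Pi.smul_apply, smul_eq_mul, Finset.mul_sum]
  exact Finset.sum_congr rfl fun i _ => by ring

theorem genL_barrier (n : ℕ) (lam θ S c N s t : ℝ) (x : Euc k) :
    genL b σm (barrier n lam θ S c N s) t x =
      Real.exp (-lam * t) * θ * genL b σm (fun _ => weight n) t x := by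
  have h2 : ∀ i j, pd i (fun y => pd j (barrier n lam θ S c N s t) y) x =
      Real.exp (-lam * t) * θ * pd i (fun y => pd j (weight n) y) x := by
    intro i j
    have h := pd_const_mul_add_const i (differentiable_pd j (contDiff_weight n) x)
      (Real.exp (-lam * t) * θ) 0
    simp only [pd_barrier]
    simpa using h
  simp only [genL, h2, mul_add, Finset.mul_sum]
  simp only [pd_barrier]
  congr 1
  · exact Finset.sum_congr rfl fun i _ => Finset.sum_congr rfl fun j _ => by ring
  · exact Finset.sum_congr rfl fun i _ => by ring

/-- For `lam` and `N` large, the barrier is a strict supersolution of the linear inequality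
satisfied at maximum points. -/
theorem barrier_strict {n : ℕ} {lam θ S c N s A C t : ℝ} {x : Euc k} (hA : 0 ≤ A) (hC : 0 ≤ C)
    (hL : genL b σm (fun _ => weight n) t x ≤ A * weight n x)
    (hG : ‖sigGrad σm (fun _ => weight n) t x‖ ≤ A * weight n x)
    (hlam : A + C * A + C < lam) (hθ : 0 ≤ θ) (hS : 0 < S) (hc : 0 ≤ c) (hN : C ≤ N) :
    timeDeriv (barrier n lam θ S c N s) t x + genL b σm (barrier n lam θ S c N s) t x +
      C * (barrier n lam θ S c N s t x + ‖sigGrad σm (barrier n lam θ S c N s) t x‖) < 0 := by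
  have hw := weight_pos n x
  rw [timeDeriv_barrier, genL_barrier, sigGrad_barrier, norm_smul, Real.norm_eq_abs,
    abs_of_nonneg (by positivity), barrier]
  set E := Real.exp (-lam * t)
  have hE : 0 < E := Real.exp_pos _
  set F := c * Real.exp (N * (s - t))
  have hF : 0 ≤ F := by positivity
  have h1 : E * θ * genL b σm (fun _ => weight n) t x ≤ E * θ * (A * weight n x) := by gcongr
  have h2 : C * (E * θ * ‖sigGrad σm (fun _ => weight n) t x‖) ≤
      C * (E * θ * (A * weight n x)) := by gcongr
  have h3 : C * F ≤ N * F := by gcongr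
  have h4 : 0 < E * (θ * weight n x + S) := by positivity
  have h5 := mul_lt_mul_of_pos_right hlam h4
  have h6 : 0 ≤ E * S * A := by positivity
  have h7 : 0 ≤ C * (E * S * A) := by positivity
  nlinarith

theorem PolyGrowth.exists_weight_bound {Φ : ℝ → Euc k → ℝ} (h : PolyGrowth T Φ) :
    ∃ G : ℝ, 0 ≤ G ∧ ∃ m₀ : ℕ, ∀ m ≥ m₀, ∀ t ∈ Icc (0 : ℝ) T, ∀ x, |Φ t x| ≤ G * weight m x := by
  obtain ⟨C, γ, hC, hγ, h⟩ := h
  refine ⟨2 * C, by positivity, ⌈γ⌉₊, fun m hm t ht x => (h t ht x).trans ?_⟩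
  have h1 : 1 ≤ 1 + ‖x‖ ^ 2 := by nlinarith [sq_nonneg ‖x‖]
  have hx : ‖x‖ ≤ 1 + ‖x‖ ^ 2 := by nlinarith [sq_nonneg (‖x‖ - 1)]
  have hγm : γ ≤ m := (Nat.le_ceil γ).trans (by exact_mod_cast hm)
  have h2 : ‖x‖ ^ γ ≤ weight m x := by
    calc ‖x‖ ^ γ ≤ (1 + ‖x‖ ^ 2) ^ γ := Real.rpow_le_rpow (norm_nonneg _) hx hγ
      _ ≤ (1 + ‖x‖ ^ 2) ^ (m : ℝ) := Real.rpow_le_rpow_of_exponent_le h1 hγm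
      _ = weight m x := Real.rpow_natCast _ _
  have h3 : 1 ≤ weight m x := one_le_pow₀ h1
  nlinarith

end Barrier

section Comparison

open Filter Topology

variable {k d : ℕ} {Γ1 Γ2 : Type} [Fintype Γ1] [Fintype Γ2] [DecidableEq Γ1] [DecidableEq Γ2]
  [Nontrivial Γ1] [Nontrivial Γ2] {T : ℝ} {b : ℝ → Euc k → Fin k → ℝ}
  {σm : ℝ → Euc k → Matrix (Fin k) (Fin d) ℝ}
  {f : Γ1 → Γ2 → ℝ → Euc k → ((Γ1 × Γ2) → ℝ) → (Fin d → ℝ) → ℝ}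
  {gLow : Γ1 → Γ1 → ℝ → Euc k → ℝ} {gUp : Γ2 → Γ2 → ℝ → Euc k → ℝ}

/-- By the non-free-loop property, among the indices realizing the maximal gap `P` there is one at
which neither obstacle is active. -/
theorem NoFreeLoop.exists_obst_lt (H : NoFreeLoop T gLow gUp) {t : ℝ} (ht : t ∈ Icc 0 T)
    (x : Euc k) {u w : Γ1 × Γ2 → ℝ} {P : ℝ} (hle : ∀ a, u a - w a ≤ P) (hP : ∃ a, u a - w a = P)
    (hu : ∀ a, u a ≤ upperObst gUp a.1 a.2 t x u)
    (hw : ∀ a, lowerObst gLow a.1 a.2 t x w ≤ w a) :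
    ∃ a, u a - w a = P ∧ lowerObst gLow a.1 a.2 t x u < u a ∧
      w a < upperObst gUp a.1 a.2 t x w := by
  obtain ⟨⟨i, j⟩, haA, h1, h2⟩ :=
    H.exists_forall_not_step ht x u (A := {a | u a - w a = P}) hP
  simp only [Set.mem_ofPred_eq] at haA h1 h2
  refine ⟨(i, j), haA, ?_, ?_⟩
  · by_contra! hlt
    obtain ⟨i', hi', he⟩ := exists_lowerObst_eq gLow i j t x u
    have h3 := (le_lowerObst (gLow := gLow) hi' j t x w).trans (hw (i, j))
    have h4 := hle (i', j)
    simp only at hlt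
    exact h1 i' hi' (by linarith) (by linarith)
  · by_contra! hlt
    obtain ⟨j', hj', he⟩ := exists_upperObst_eq gUp i j t x w
    have h3 := (hu (i, j)).trans (upperObst_le (gUp := gUp) hj' i t x u)
    have h4 := hle (i, j')
    simp only at hlt
    exact h2 j' hj' (by linarith) (by linarith)

theorem exists_barrier_touching {Γ : Type} [Finite Γ] {D : Γ → ℝ → Euc k → ℝ}
    (hD : ∀ a, Continuous fun z : ℝ × Euc k => D a z.1 z.2) {G : ℝ} {m : ℕ} (hG : 0 ≤ G)
    (hDG : ∀ a, ∀ t ∈ Icc (0 : ℝ) T, ∀ x, D a t x ≤ G * weight m x)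
    (hDT : ∀ a x, D a T x ≤ 0) {s : ℝ} (hs : s ∈ Ioo 0 T) {e : Γ} {y : Euc k}
    (hpos : 0 < D e s y) {lam : ℝ} (hlam : 0 ≤ lam) (N₀ : ℝ) :
    ∃ θ S c N : ℝ, 0 ≤ θ ∧ 0 < S ∧ 0 ≤ c ∧ N₀ ≤ N ∧ ∃ a, ∃ t ∈ Ioo (0 : ℝ) T, ∃ x,
      D a t x = barrier (m + 1) lam θ S c N s t x ∧
      ∀ a, ∀ t ∈ Icc (0 : ℝ) T, ∀ x, D a t x ≤ barrier (m + 1) lam θ S c N s t x := by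
  have hT : 0 < T := hs.1.trans hs.2
  set δ := D e s y with hδ
  have hwy := weight_pos (m + 1) y
  set θ := Real.exp (lam * s) * δ / (4 * weight (m + 1) y) with hθ
  have hθ0 : 0 < θ := by positivity
  set c := δ / 2 with hc
  have hc0 : 0 < c := by positivity
  set R := Real.sqrt (Real.exp (lam * T) * G / θ) with hR
  have hR0 : 0 ≤ R := Real.sqrt_nonneg _
  have hR2 : θ * R ^ 2 = Real.exp (lam * T) * G := by
    rw [hR, Real.sq_sqrt (by positivity)]
    field_simp
  set M := G * (1 + R ^ 2) ^ m with hM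
  have hM0 : 0 ≤ M := by positivity
  set N := max N₀ (M / (c * s)) with hN
  set H : Γ → ℝ → Euc k → ℝ := fun a t x =>
    Real.exp (lam * t) * (D a t x - c * Real.exp (N * (s - t))) - θ * weight (m + 1) x with hH
  have hHc : ∀ a, Continuous fun z : ℝ × Euc k => H a z.1 z.2 := by
    intro a
    have h1 : Continuous fun z : ℝ × Euc k => weight (m + 1) z.2 :=
      (contDiff_weight (m + 1)).continuous.comp continuous_snd
    have h2 := hD a
    simp only [hH]
    fun_prop
  have hHy : 0 < H e s y := by
    have h1 : θ * weight (m + 1) y = Real.exp (lam * s) * δ / 4 := by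
      rw [hθ]
      field_simp
    have h2 : 0 < Real.exp (lam * s) * δ := by positivity
    simp only [hH, sub_self, mul_zero, Real.exp_zero]
    rw [h1, ← hδ, hc]
    linarith
  have hHle : ∀ a t x, D a t x ≤ c * Real.exp (N * (s - t)) → H a t x ≤ 0 := by
    intro a t x h
    have h1 : Real.exp (lam * t) * (D a t x - c * Real.exp (N * (s - t))) ≤ 0 :=
      mul_nonpos_of_nonneg_of_nonpos (Real.exp_pos _).le (by linarith)
    have h2 : 0 < θ * weight (m + 1) x := mul_pos hθ0 (weight_pos _ x)
    simp only [hH]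
    linarith
  have hout : ∀ a, ∀ t ∈ Icc (0 : ℝ) T, ∀ x, R < ‖x‖ → H a t x ≤ 0 := by
    intro a t ht x hx
    have hw := weight_pos m x
    have h1 : Real.exp (lam * t) * (D a t x - c * Real.exp (N * (s - t))) ≤
        Real.exp (lam * T) * (G * weight m x) := by
      have h3 : 0 ≤ c * Real.exp (N * (s - t)) := by positivity
      have h4 : Real.exp (lam * t) ≤ Real.exp (lam * T) :=
        Real.exp_le_exp.2 (mul_le_mul_of_nonneg_left ht.2 hlam)
      have h5 : 0 ≤ G * weight m x := by positivity
      calc Real.exp (lam * t) * (D a t x - c * Real.exp (N * (s - t)))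
          ≤ Real.exp (lam * t) * (G * weight m x) :=
            mul_le_mul_of_nonneg_left (by linarith [hDG a t ht x]) (Real.exp_pos _).le
        _ ≤ _ := mul_le_mul_of_nonneg_right h4 h5
    have h2 : weight (m + 1) x = weight m x * (1 + ‖x‖ ^ 2) := pow_succ _ _
    have h6 : Real.exp (lam * T) * G ≤ θ * (1 + ‖x‖ ^ 2) := by
      rw [← hR2]
      gcongr
      nlinarith
    have h7 := mul_le_mul_of_nonneg_right h6 hw.le
    simp only [hH]
    rw [h2]
    linarith
  have hzero : ∀ a x, H a 0 x ≤ 0 := by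
    intro a x
    by_cases hx : R < ‖x‖
    · exact hout a 0 ⟨le_rfl, hT.le⟩ x hx
    · push Not at hx
      refine hHle a 0 x ?_
      have h1 : D a 0 x ≤ M := by
        refine (hDG a 0 ⟨le_rfl, hT.le⟩ x).trans ?_
        rw [hM, weight]
        gcongr
      have hcs : 0 < c * s := mul_pos hc0 hs.1
      have h2 : M ≤ N * (c * s) := (div_le_iff₀ hcs).1 (le_max_right _ _)
      have h3 : N * (s - 0) ≤ Real.exp (N * (s - 0)) := by
        linarith [Real.add_one_le_exp (N * (s - 0))]
      have h4 := mul_le_mul_of_nonneg_left h3 hc0.le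
      rw [sub_zero] at h4 ⊢
      linarith
  have hterm : ∀ a x, H a T x ≤ 0 := fun a x => hHle a T x ((hDT a x).trans (by positivity))
  have hK : IsCompact (Icc 0 T ×ˢ Metric.closedBall (0 : Euc k) R) :=
    isCompact_Icc.prod (isCompact_closedBall 0 R)
  have hKn : (Icc 0 T ×ˢ Metric.closedBall (0 : Euc k) R).Nonempty :=
    ⟨(s, 0), ⟨hs.1.le, hs.2.le⟩, Metric.mem_closedBall_self hR0⟩
  choose q hqK hq using fun a => hK.exists_isMaxOn hKn (hHc a).continuousOn
  have : Nonempty Γ := ⟨e⟩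
  obtain ⟨a₀, ha₀⟩ := Finite.exists_max fun a => H a (q a).1 (q a).2
  set S := H a₀ (q a₀).1 (q a₀).2 with hS
  have hin : ∀ a, ∀ t ∈ Icc (0 : ℝ) T, ∀ x, ‖x‖ ≤ R → H a t x ≤ S := fun a t ht x hx =>
    (hq a (show (t, x) ∈ _ from ⟨ht, mem_closedBall_zero_iff.2 hx⟩)).trans (ha₀ a)
  have hyR : ‖y‖ ≤ R := by
    by_contra! hlt
    exact (hout e s ⟨hs.1.le, hs.2.le⟩ y hlt).not_gt hHy
  have hS0 : 0 < S := hHy.trans_le (hin e s ⟨hs.1.le, hs.2.le⟩ y hyR)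
  have hall : ∀ a, ∀ t ∈ Icc (0 : ℝ) T, ∀ x, H a t x ≤ S := by
    intro a t ht x
    by_cases hx : R < ‖x‖
    · exact (hout a t ht x hx).trans hS0.le
    · exact hin a t ht x (not_lt.1 hx)
  have hbar : ∀ a t x, D a t x - barrier (m + 1) lam θ S c N s t x =
      Real.exp (-lam * t) * (H a t x - S) := by
    intro a t x
    have h1 : Real.exp (-lam * t) * Real.exp (lam * t) = 1 := by
      rw [← Real.exp_add, neg_mul, neg_add_cancel, Real.exp_zero]
    simp only [hH, barrier]
    linear_combination (-(D a t x - c * Real.exp (N * (s - t)))) * h1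
  refine ⟨θ, S, c, N, hθ0.le, hS0, hc0.le, le_max_left _ _, a₀, (q a₀).1, ?_, (q a₀).2, ?_, ?_⟩
  · have h1 := (hqK a₀).1
    refine ⟨lt_of_le_of_ne h1.1 fun h => ?_, lt_of_le_of_ne h1.2 fun h => ?_⟩
    · exact ((congrArg (fun t => H a₀ t (q a₀).2) h).ge.trans (hzero a₀ (q a₀).2)).not_gt hS0
    · have := hterm a₀ (q a₀).2
      rw [← h] at this
      exact this.not_gt hS0
  · have := hbar a₀ (q a₀).1 (q a₀).2
    rw [← hS, sub_self, mul_zero] at this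
    linarith
  · intro a t ht x
    have h1 := hbar a t x
    have h2 := mul_nonneg (Real.exp_pos (-lam * t)).le (sub_nonneg.2 (hall a t ht x))
    linarith

theorem le_of_forall_le_update {Γ : Type} [Fintype Γ] [DecidableEq Γ] {F : (Γ → ℝ) → ℝ} {e : Γ}
    (hF : ∀ a, a ≠ e → ∀ y y' : Γ → ℝ, (∀ c, c ≠ a → y c = y' c) → y a ≤ y' a → F y ≤ F y')
    {y y' : Γ → ℝ} (hle : ∀ a, y a ≤ y' a) (he : y e = y' e) : F y ≤ F y' := by
  have key : ∀ s : Finset Γ, e ∉ s → F y ≤ F (s.piecewise y' y) := by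
    intro s
    induction s using Finset.induction_on with
    | empty => simp
    | insert a s ha ih =>
      intro hes
      rw [Finset.mem_insert, not_or] at hes
      refine (ih hes.2).trans (hF a (Ne.symm hes.1) _ _ (fun c hc => ?_) ?_)
      · rw [Finset.piecewise_insert, Function.update_of_ne hc]
      · rw [Finset.piecewise_insert, Function.update_self, Finset.piecewise_eq_of_notMem _ _ _ ha]
        exact hle a
  have h := key (Finset.univ.erase e) (Finset.notMem_erase e _)
  convert h using 2
  ext a
  by_cases ha : a = e
  · subst ha
    simp [he]
  · simp [ha]

/-- Comparison principle: a function satisfying the subsolution inequality above its lower obstacle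
lies below any function satisfying the supersolution inequality below its upper obstacle. -/
theorem le_of_sub_super (h0 : H0 T b σm)
    (hfc : ∀ (i : Γ1) (j : Γ2), ∀ t ∈ Icc (0 : ℝ) T, ∀ x : Euc k, ∀ ε > (0 : ℝ),
      ∃ η > (0 : ℝ), ∀ t' ∈ Icc (0 : ℝ) T, ∀ x' : Euc k, |t' - t| + ‖x' - x‖ < η →
        ∀ (y : (Γ1 × Γ2) → ℝ) (z : Fin d → ℝ), |f i j t' x' y z - f i j t x y z| < ε)
    (hfl : ∃ C : ℝ, ∀ (i : Γ1) (j : Γ2) (t : ℝ) (x : Euc k)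
      (y y' : (Γ1 × Γ2) → ℝ) (z z' : Fin d → ℝ),
      |f i j t x y z - f i j t x y' z'| ≤ C * (‖y - y'‖ + ‖z - z'‖))
    (hfm : ∀ (i : Γ1) (j : Γ2) (kl : Γ1 × Γ2), kl ≠ (i, j) →
      ∀ (t : ℝ) (x : Euc k) (z : Fin d → ℝ) (y y' : (Γ1 × Γ2) → ℝ),
      (∀ ab, ab ≠ kl → y ab = y' ab) → y kl ≤ y' kl → f i j t x y z ≤ f i j t x y' z)
    (hgl : ∀ i i' : Γ1, Continuous fun p : ℝ × Euc k => gLow i i' p.1 p.2)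
    (hgu : ∀ j j' : Γ2, Continuous fun p : ℝ × Euc k => gUp j j' p.1 p.2)
    (hnfl : NoFreeLoop T gLow gUp) {u w : Γ1 × Γ2 → ℝ → Euc k → ℝ}
    (hu : ∀ ij, Continuous fun p : ℝ × Euc k => u ij p.1 p.2)
    (hw : ∀ ij, Continuous fun p : ℝ × Euc k => w ij p.1 p.2)
    (hug : ∀ ij, PolyGrowth T (u ij)) (hwg : ∀ ij, PolyGrowth T (w ij))
    (hterm : ∀ ij x, u ij T x ≤ w ij T x)
    (huU : ∀ ij, ∀ t ∈ Ioo (0 : ℝ) T, ∀ x,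
      u ij t x ≤ upperObst gUp ij.1 ij.2 t x fun kl => u kl t x)
    (hwL : ∀ ij, ∀ t ∈ Ioo (0 : ℝ) T, ∀ x,
      lowerObst gLow ij.1 ij.2 t x (fun kl => w kl t x) ≤ w ij t x)
    (hsub : ∀ ij, ∀ t ∈ Ioo (0 : ℝ) T, ∀ x,
      lowerObst gLow ij.1 ij.2 t x (fun kl => u kl t x) < u ij t x → ∀ φ, IsC12 φ →
      IsLocalMax (fun p : ℝ × Euc k => u ij p.1 p.2 - φ p.1 p.2) (t, x) → u ij t x = φ t x →
      0 ≤ timeDeriv φ t x + genL b σm φ t x +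
        f ij.1 ij.2 t x (fun kl => u kl t x) (sigGrad σm φ t x))
    (hsup : ∀ ij, ∀ t ∈ Ioo (0 : ℝ) T, ∀ x,
      w ij t x < upperObst gUp ij.1 ij.2 t x (fun kl => w kl t x) → ∀ φ, IsC12 φ →
      IsLocalMin (fun p : ℝ × Euc k => w ij p.1 p.2 - φ p.1 p.2) (t, x) → w ij t x = φ t x →
      timeDeriv φ t x + genL b σm φ t x +
        f ij.1 ij.2 t x (fun kl => w kl t x) (sigGrad σm φ t x) ≤ 0) :
    ∀ ij, ∀ t ∈ Icc (0 : ℝ) T, ∀ x, u ij t x ≤ w ij t x := by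
  suffices hmain : ∀ ij, ∀ t ∈ Ioo (0 : ℝ) T, ∀ x, u ij t x ≤ w ij t x by
    intro ij t ht x
    by_cases htT : t = T
    · rw [htT]
      exact hterm ij x
    have hcl : IsClosed {t : ℝ | u ij t x ≤ w ij t x} :=
      isClosed_le ((hu ij).comp (by fun_prop : Continuous fun t : ℝ => (t, x)))
        ((hw ij).comp (by fun_prop : Continuous fun t : ℝ => (t, x)))
    have hT : (0 : ℝ) ≠ T := fun h => htT (le_antisymm ht.2 (h ▸ ht.1))
    rw [← closure_Ioo hT] at ht
    exact closure_minimal (fun t ht => hmain ij t ht x) hcl ht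
  intro e s hs y
  by_contra! hlt
  obtain ⟨C₀, hfl⟩ := hfl
  have hfl' : ∀ (i : Γ1) (j : Γ2) (t : ℝ) (x : Euc k) (y y' : (Γ1 × Γ2) → ℝ) (z z' : Fin d → ℝ),
      |f i j t x y z - f i j t x y' z'| ≤ |C₀| * (‖y - y'‖ + ‖z - z'‖) :=
    fun i j t x y y' z z' => (hfl i j t x y y' z z').trans (by gcongr; exact le_abs_self C₀)
  choose Gu hGu mu hmu using fun ij => (hug ij).exists_weight_bound
  choose Gw hGw mw hmw using fun ij => (hwg ij).exists_weight_bound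
  set n := ∑ ij, (mu ij + mw ij) with hn
  set G := ∑ ij, (Gu ij + Gw ij) with hG
  have hG0 : 0 ≤ G := Finset.sum_nonneg fun ij _ => add_nonneg (hGu ij) (hGw ij)
  have hDG : ∀ ij, ∀ t ∈ Icc (0 : ℝ) T, ∀ x, u ij t x - w ij t x ≤ G * weight (n + 1) x := by
    intro ij t ht x
    have h1 : mu ij + mw ij ≤ n := Finset.single_le_sum (f := fun ij => mu ij + mw ij)
      (fun _ _ => Nat.zero_le _) (Finset.mem_univ ij)
    have h2 : Gu ij + Gw ij ≤ G := Finset.single_le_sum (f := fun ij => Gu ij + Gw ij)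
      (fun ij _ => add_nonneg (hGu ij) (hGw ij)) (Finset.mem_univ ij)
    have h3 := hmu ij (n + 1) (by omega) t ht x
    have h4 := hmw ij (n + 1) (by omega) t ht x
    have h5 := mul_le_mul_of_nonneg_right h2 (weight_pos (n + 1) x).le
    linarith [le_abs_self (u ij t x), neg_abs_le (w ij t x)]
  obtain ⟨A, hA, hAw⟩ := h0.exists_weight_bound n
  obtain ⟨θ, S, c, N, hθ, hS, hc, hN, a₁, t₀, ht₀, x₀, heq, hmax⟩ :=
    exists_barrier_touching (D := fun ij t x => u ij t x - w ij t x)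
      (fun ij => (hu ij).sub (hw ij)) hG0 hDG (fun ij x => by linarith [hterm ij x]) hs
      (sub_pos.2 hlt) (lam := A + |C₀| * A + |C₀| + 1) (by positivity) |C₀|
  have ht₀' : t₀ ∈ Icc 0 T := ⟨ht₀.1.le, ht₀.2.le⟩
  obtain ⟨a, ha, haL, haU⟩ := hnfl.exists_obst_lt ht₀' x₀ (u := fun a => u a t₀ x₀)
    (w := fun a => w a t₀ x₀) (fun a => hmax a t₀ ht₀' x₀) ⟨a₁, heq⟩
    (fun a => huU a t₀ ht₀ x₀) (fun a => hwL a t₀ ht₀ x₀)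
  have hlam : 0 ≤ barrier (n + 2) (A + |C₀| * A + |C₀| + 1) θ S c N s t₀ x₀ := by
    have := weight_pos (n + 2) x₀
    unfold barrier
    positivity
  have hIoo : ∀ᶠ p : ℝ × Euc k in 𝓝 (t₀, x₀), p.1 ∈ Ioo 0 T :=
    continuous_fst.continuousAt.eventually_mem (isOpen_Ioo.mem_nhds ht₀)
  have key := nonneg_of_max h0 hu hw (contDiff_barrier (n + 2) _ θ S c N s) ht₀ a
    (g := f a.1 a.2) (C := |C₀|) (sub_eq_zero.2 ha)
    (fun t ht x => sub_nonpos.2 (hmax a t ht x))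
    (fun a' => by linarith [hmax a' t₀ ht₀' x₀]) hlam (abs_nonneg _)
    (hfc a.1 a.2 t₀ ht₀' x₀) (hfl' a.1 a.2 t₀ x₀)
    (fun y y' z hle he => le_of_forall_le_update (F := fun y => f a.1 a.2 t₀ x₀ y z)
      (fun kl hkl y y' => hfm a.1 a.2 kl hkl t₀ x₀ z y y') hle he)
    (by
      filter_upwards [hIoo, (continuous_lowerObst hgl hu a.1 a.2).continuousAt.eventually_lt
        (hu a).continuousAt haL] with p hp hpL
      exact fun φ hφ hm he => hsub a p.1 hp p.2 hpL φ hφ hm he)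
    (by
      filter_upwards [hIoo, (hw a).continuousAt.eventually_lt
        (continuous_upperObst hgu hw a.1 a.2).continuousAt haU] with p hp hpU
      exact fun φ hφ hm he => hsup a p.1 hp p.2 hpU φ hφ hm he)
  obtain ⟨hL, hGr⟩ := hAw t₀ ht₀' x₀
  exact key.not_gt (barrier_strict hA (abs_nonneg C₀) hL hGr (by linarith) hθ hS hc hN)

end Comparison

/-- **Theorem 3.1**: under (H0)-(H5), any continuous polynomial-growth viscosity
solution `\bar v` of the min-max system and any continuous polynomial-growth viscosity
solution `\underline v` of the max-min system coincide: `\bar v^{ij} = \underline v^{ij}`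
for every `(i,j) ∈ Γ¹ × Γ²` (on `[0,T] × ℝ^k`). -/
theorem minmax_eq_maxmin_system
    {k d : ℕ} (hk : 1 ≤ k) (hd : 1 ≤ d) {Γ1 Γ2 : Type}
    [Fintype Γ1] [Fintype Γ2] [DecidableEq Γ1] [DecidableEq Γ2]
    [Nontrivial Γ1] [Nontrivial Γ2]
    (T : ℝ) (hT : 0 < T)
    (b : ℝ → Euc k → Fin k → ℝ) (σm : ℝ → Euc k → Matrix (Fin k) (Fin d) ℝ)
    (f : Γ1 → Γ2 → ℝ → Euc k → ((Γ1 × Γ2) → ℝ) → (Fin d → ℝ) → ℝ)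
    (hfun : Γ1 → Γ2 → Euc k → ℝ)
    (gLow : Γ1 → Γ1 → ℝ → Euc k → ℝ) (gUp : Γ2 → Γ2 → ℝ → Euc k → ℝ)
    -- (H0): `b`, `σ` jointly continuous, Lipschitz in `x` uniformly in `t`
    (H0b : Continuous fun p : ℝ × Euc k => b p.1 p.2)
    (H0s : Continuous fun p : ℝ × Euc k => σm p.1 p.2)
    (H0lip : ∃ C : ℝ, ∀ t ∈ Icc (0 : ℝ) T, ∀ x x' : Euc k,
      (∀ i, |b t x i - b t x' i| ≤ C * ‖x - x'‖) ∧
      (∀ i l, |σm t x i l - σm t x' i l| ≤ C * ‖x - x'‖))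
    -- (H1)(i): each `f^{ij}` is continuous in `(t,x)` uniformly w.r.t. `(y,z)`,
    -- and `(t,x) ↦ f^{ij}(t,x,0,0)` is of polynomial growth
    (H1cont : ∀ (i : Γ1) (j : Γ2), ∀ t ∈ Icc (0 : ℝ) T, ∀ x : Euc k, ∀ ε > (0 : ℝ),
      ∃ η > (0 : ℝ), ∀ t' ∈ Icc (0 : ℝ) T, ∀ x' : Euc k, |t' - t| + ‖x' - x‖ < η →
        ∀ (y : (Γ1 × Γ2) → ℝ) (z : Fin d → ℝ), |f i j t' x' y z - f i j t x y z| < ε)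
    (H1growth : ∀ (i : Γ1) (j : Γ2), PolyGrowth T fun t x => f i j t x 0 0)
    -- (H1)(ii): Lipschitz continuity in `(\vec y, z)` uniformly in `(t,x)`
    (H1lip : ∃ C : ℝ, ∀ (i : Γ1) (j : Γ2) (t : ℝ) (x : Euc k)
      (y y' : (Γ1 × Γ2) → ℝ) (z z' : Fin d → ℝ),
      |f i j t x y z - f i j t x y' z'| ≤ C * (‖y - y'‖ + ‖z - z'‖))
    -- (H2): monotonicity: `f^{ij}` is nondecreasing in `y^{kl}` for `(k,l) ≠ (i,j)`
    (H2 : ∀ (i : Γ1) (j : Γ2) (kl : Γ1 × Γ2), kl ≠ (i, j) →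
      ∀ (t : ℝ) (x : Euc k) (z : Fin d → ℝ) (y y' : (Γ1 × Γ2) → ℝ),
      (∀ ab, ab ≠ kl → y ab = y' ab) → y kl ≤ y' kl → f i j t x y z ≤ f i j t x y' z)
    -- (H3): the terminal data are continuous, of polynomial growth and consistent
    (H3cont : ∀ (i : Γ1) (j : Γ2), Continuous (hfun i j))
    (H3growth : ∀ (i : Γ1) (j : Γ2), ∃ C γ : ℝ, 0 ≤ C ∧ 0 ≤ γ ∧
      ∀ x : Euc k, |hfun i j x| ≤ C * (1 + ‖x‖ ^ γ))
    (H3consist : ∀ (i : Γ1) (j : Γ2) (x : Euc k),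
      (∀ kk, kk ≠ i → hfun kk j x - gLow i kk T x ≤ hfun i j x) ∧
      (∀ l, l ≠ j → hfun i j x ≤ hfun i l x + gUp j l T x))
    -- (H4): switching costs: nonnegative, jointly continuous, polynomial growth,
    -- vanishing on the diagonal, and the non-free-loop property
    (H4lnn : ∀ (i i' : Γ1), ∀ t ∈ Icc (0 : ℝ) T, ∀ x : Euc k, 0 ≤ gLow i i' t x)
    (H4unn : ∀ (j j' : Γ2), ∀ t ∈ Icc (0 : ℝ) T, ∀ x : Euc k, 0 ≤ gUp j j' t x)
    (H4lcont : ∀ i i' : Γ1, Continuous fun p : ℝ × Euc k => gLow i i' p.1 p.2)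
    (H4ucont : ∀ j j' : Γ2, Continuous fun p : ℝ × Euc k => gUp j j' p.1 p.2)
    (H4lgrowth : ∀ i i' : Γ1, PolyGrowth T (gLow i i'))
    (H4ugrowth : ∀ j j' : Γ2, PolyGrowth T (gUp j j'))
    (H4lzero : ∀ (i : Γ1) (t : ℝ) (x : Euc k), gLow i i t x = 0)
    (H4uzero : ∀ (j : Γ2) (t : ℝ) (x : Euc k), gUp j j t x = 0)
    (H4nfl : NoFreeLoop T gLow gUp)
    -- (H5)(i): the costs `\bar g_{jl}` are `C^{1,2}` with space derivatives of
    -- polynomial growth, and satisfy the strict triangle inequality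
    (H5reg : ∀ j l : Γ2, IsC12 (gUp j l))
    (H5d1 : ∀ j l : Γ2, PolyGrowth T fun t x => ‖fderiv ℝ (gUp j l t) x‖)
    (H5d2 : ∀ j l : Γ2, PolyGrowth T fun t x => ‖fderiv ℝ (fderiv ℝ (gUp j l t)) x‖)
    (H5tri : ∀ j1 j2 j3 : Γ2, j1 ≠ j2 → j2 ≠ j3 → j1 ≠ j3 →
      ∀ t ∈ Icc (0 : ℝ) T, ∀ x : Euc k, gUp j1 j3 t x < gUp j1 j2 t x + gUp j2 j3 t x)
    -- (H5)(ii): each `f^{ij}` is bounded by `C (1 + |x|^p)`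
    (H5bound : ∃ C p : ℝ, 0 ≤ C ∧ 0 ≤ p ∧ ∀ (i : Γ1) (j : Γ2), ∀ t ∈ Icc (0 : ℝ) T,
      ∀ (x : Euc k) (y : (Γ1 × Γ2) → ℝ) (z : Fin d → ℝ),
      |f i j t x y z| ≤ C * (1 + ‖x‖ ^ p))
    -- the two solutions
    (vbar vund : Γ1 × Γ2 → ℝ → Euc k → ℝ)
    (hvbar : (∀ ij, Continuous fun p : ℝ × Euc k => vbar ij p.1 p.2) ∧
      (∀ ij, PolyGrowth T (vbar ij)) ∧
      IsViscSolSys T b σm (fun ij => hfun ij.1 ij.2) (FminMax f gLow gUp) vbar)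
    (hvund : (∀ ij, Continuous fun p : ℝ × Euc k => vund ij p.1 p.2) ∧
      (∀ ij, PolyGrowth T (vund ij)) ∧
      IsViscSolSys T b σm (fun ij => hfun ij.1 ij.2) (FmaxMin f gLow gUp) vund) :
    ∀ ij : Γ1 × Γ2, ∀ t ∈ Icc (0 : ℝ) T, ∀ x : Euc k, vbar ij t x = vund ij t x := by
  have h0 : H0 T b σm := ⟨H0b, H0s, H0lip⟩
  obtain ⟨hvc, hvg, hv⟩ := hvbar
  obtain ⟨hwc, hwg, hw⟩ := hvund
  have hle : ∀ ij, ∀ t ∈ Icc (0 : ℝ) T, ∀ x, vbar ij t x ≤ vund ij t x := by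
    refine le_of_sub_super h0 H1cont H1lip H2 H4lcont H4ucont H4nfl hvc hwc hvg hwg
      (fun ij x => (hv.1.1 ij x).trans (hw.2.1 ij x))
      (fun ij t ht x => le_upperObst_of_minMax hvc H4lcont H4ucont H4nfl hv ij ht x)
      (fun ij t ht x => lowerObst_le_of_maxMin hwc H4lcont H4ucont H4nfl hw ij ht x)
      (fun ij t ht x hlt φ hφ hm he => ?_) (fun ij t ht x hlt φ hφ hm he => ?_)
    · rcases min_le_iff.1 (hv.1.2 ij t x ht φ hφ hm he) with h | h
      · linarith
      · linarith [(max_le_iff.1 h).2]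
    · rcases le_max_iff.1 (hw.2.2 ij t x ht φ hφ hm he) with h | h
      · linarith
      · linarith [(le_min_iff.1 h).2]
  have hge : ∀ ij, ∀ t ∈ Icc (0 : ℝ) T, ∀ x, vund ij t x ≤ vbar ij t x := by
    refine le_of_sub_super h0 H1cont H1lip H2 H4lcont H4ucont H4nfl hwc hvc hwg hvg
      (fun ij x => (hw.1.1 ij x).trans (hv.2.1 ij x))
      (fun ij t ht x => le_upperObst_of_maxMin hwc H4ucont hw.1 ij ht x)
      (fun ij t ht x => lowerObst_le_of_minMax hvc H4lcont hv.2 ij ht x)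
      (fun ij t ht x hlt φ hφ hm he => ?_) (fun ij t ht x hlt φ hφ hm he => ?_)
    · rcases min_le_iff.1 (max_le_iff.1 (hw.1.2 ij t x ht φ hφ hm he)).2 with h | h <;> linarith
    · rcases le_max_iff.1 (le_min_iff.1 (hv.2.2 ij t x ht φ hφ hm he)).2 with h | h <;> linarith
  exact fun ij t ht x => le_antisymm (hle ij t ht x) (hge ij t ht x)

end
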